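/- There exists an absolute constant C > 0 such that for every δ > 0 and every integer d ≥ 1 there exist constants c = c(d,δ) > 0 and N = N(d,δ) with the following property. For every n ≥ N, every d-local function f : {0,1}^m → {0,1}^n, and every Ψ ⊆ {0,1,…,n} containing an element s with |s − n/2| ≤ c·n, there exist a ∈ [0,1] with a ≤ C·dTV(f(U^m), D_Ψ), probability distributions E and X on {0,1}^n with f(U^m) = a·E + (1−a)·X, and η ∈ [0,1], such that for every t ∈ ℝ: |Pr[|X| > t and |X| is even] − η·Pr[|U^n| > t]| ≤ C·δ and |Pr[|X| > t and |X| is odd] − (1−η)·Pr[|U^n| > t]| ≤ C·δ, where the probabilities on |X| refer to the Hamming weight of a sample from X and |U^n| is the Hamming weight of a uniform sample from {0,1}^n. -/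

import Mathlib

open Finset

noncomputable section

/-- Hamming weight of a Boolean string. -/
def hw {n : ℕ} (x : Fin n → Bool) : ℕ := (Finset.univ.filter fun i => x i = true).card

/-- Uniform distribution on a finite set `C` (zero if `C` is empty). -/
def unifOn {α : Type} [Fintype α] [DecidableEq α] (C : Finset α) : α → ℝ :=
  fun x => if x ∈ C then (C.card : ℝ)⁻¹ else 0

/-- Total variation distance between two (mass functions of) distributions. -/
def tvd {α : Type} [Fintype α] (A B : α → ℝ) : ℝ := (∑ x, |A x - B x|) / 2

/-- Pushforward of a distribution along `f`. -/
def pushf {α β : Type} [Fintype α] [DecidableEq β] (f : α → β) (A : α → ℝ) : β → ℝ :=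
  fun y => ∑ x ∈ Finset.univ.filter (fun x => f x = y), A x

/-- `f` is `d`-local: each output coordinate depends on at most `d` input coordinates. -/
def IsLocal {m n : ℕ} (d : ℕ) (f : (Fin m → Bool) → (Fin n → Bool)) : Prop :=
  ∀ i : Fin n, ∃ T : Finset (Fin m), T.card ≤ d ∧
    ∀ x y : Fin m → Bool, (∀ j ∈ T, x j = y j) → f x i = f y i

/-- `D_Ψ`: uniform distribution on strings whose Hamming weight lies in `Ψ`. -/
def DPsi (n : ℕ) (Ψ : Finset ℕ) : (Fin n → Bool) → ℝ :=
  unifOn (Finset.univ.filter fun x => hw x ∈ Ψ)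

/-- The weight distribution of `A`: probability that the Hamming weight equals `k`. -/
def wd {n : ℕ} (A : (Fin n → Bool) → ℝ) (k : ℕ) : ℝ :=
  ∑ x ∈ Finset.univ.filter (fun x => hw x = k), A x

/-- Total variation distance between the weight distributions of `A` and `B`. -/
def tvW {n : ℕ} (A B : (Fin n → Bool) → ℝ) : ℝ :=
  (∑ k ∈ Finset.range (n + 1), |wd A k - wd B k|) / 2

/-- Symmetrization of the distribution `A`. -/
def symA {n : ℕ} (A : (Fin n → Bool) → ℝ) : (Fin n → Bool) → ℝ :=
  fun x => wd A (hw x) / (n.choose (hw x))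

/-! ### Averages over the Boolean cube -/

/-- Average of a real function over the Boolean cube. -/
def cubeAvg {m : ℕ} (F : (Fin m → Bool) → ℝ) : ℝ := (∑ x, F x) / 2 ^ m

section CubeAvg

variable {m : ℕ}

lemma cubeAvg_add (F G : (Fin m → Bool) → ℝ) :
    cubeAvg (fun x => F x + G x) = cubeAvg F + cubeAvg G := by
  simp [cubeAvg, Finset.sum_add_distrib, add_div]

lemma cubeAvg_sub (F G : (Fin m → Bool) → ℝ) :
    cubeAvg (fun x => F x - G x) = cubeAvg F - cubeAvg G := by
  simp [cubeAvg, Finset.sum_sub_distrib, sub_div]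

lemma cubeAvg_const_mul (c : ℝ) (F : (Fin m → Bool) → ℝ) :
    cubeAvg (fun x => c * F x) = c * cubeAvg F := by
  simp [cubeAvg, ← Finset.mul_sum, mul_div_assoc]

lemma cubeAvg_mul_const (F : (Fin m → Bool) → ℝ) (c : ℝ) :
    cubeAvg (fun x => F x * c) = cubeAvg F * c := by
  simp [cubeAvg, ← Finset.sum_mul, div_mul_eq_mul_div]

lemma cubeAvg_sum {ι : Type*} (s : Finset ι) (F : ι → (Fin m → Bool) → ℝ) :
    cubeAvg (fun x => ∑ i ∈ s, F i x) = ∑ i ∈ s, cubeAvg (F i) := by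
  simp only [cubeAvg]
  rw [Finset.sum_comm, Finset.sum_div]

lemma cubeAvg_const (c : ℝ) : cubeAvg (fun _ : Fin m → Bool => c) = c := by
  simp [cubeAvg, Finset.sum_const]

lemma cubeAvg_mono {F G : (Fin m → Bool) → ℝ} (h : ∀ x, F x ≤ G x) :
    cubeAvg F ≤ cubeAvg G := by
  unfold cubeAvg
  gcongr with x
  exact h x

lemma cubeAvg_nonneg {F : (Fin m → Bool) → ℝ} (h : ∀ x, 0 ≤ F x) : 0 ≤ cubeAvg F :=
  div_nonneg (Finset.sum_nonneg fun x _ => h x) (by positivity)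

lemma abs_cubeAvg_le (F : (Fin m → Bool) → ℝ) : |cubeAvg F| ≤ cubeAvg (fun x => |F x|) := by
  unfold cubeAvg
  rw [abs_div, abs_of_pos (by positivity : (0 : ℝ) < 2 ^ m)]
  gcongr
  exact Finset.abs_sum_le_sum_abs _ _

lemma cubeAvg_comm {n : ℕ} (F : (Fin m → Bool) → (Fin n → Bool) → ℝ) :
    cubeAvg (fun x => cubeAvg (F x)) = cubeAvg (fun y => cubeAvg (fun x => F x y)) := by
  simp only [cubeAvg, ← Finset.sum_div]
  rw [Finset.sum_comm, div_right_comm]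

lemma cubeAvg_mul_sq_le (F G : (Fin m → Bool) → ℝ) :
    (cubeAvg (fun x => F x * G x)) ^ 2 ≤ cubeAvg (fun x => F x ^ 2) * cubeAvg (fun x => G x ^ 2) := by
  unfold cubeAvg
  rw [div_pow, div_mul_div_comm, ← sq]
  gcongr
  exact Finset.sum_mul_sq_le_sq_mul_sq _ _ _

lemma sq_cubeAvg_le (F : (Fin m → Bool) → ℝ) :
    (cubeAvg F) ^ 2 ≤ cubeAvg (fun x => F x ^ 2) := by
  have := cubeAvg_mul_sq_le F (fun _ => 1)
  simpa [cubeAvg_const] using this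

lemma cubeAvg_comp_equiv (e : (Fin m → Bool) ≃ (Fin m → Bool)) (F : (Fin m → Bool) → ℝ) :
    cubeAvg (fun x => F (e x)) = cubeAvg F := by
  unfold cubeAvg
  rw [Equiv.sum_comp e F]

/-- Pointwise sum modulo two. -/
def cubeXor (x y : Fin m → Bool) : Fin m → Bool := fun i => xor (x i) (y i)

lemma cubeXor_comm (x y : Fin m → Bool) : cubeXor x y = cubeXor y x := by
  funext i; simp [cubeXor, Bool.xor_comm]

lemma cubeXor_assoc (x y z : Fin m → Bool) :
    cubeXor (cubeXor x y) z = cubeXor x (cubeXor y z) := by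
  funext i; simp [cubeXor]

lemma cubeXor_cancel (x y : Fin m → Bool) : cubeXor (cubeXor x y) y = x := by
  funext i; simp [cubeXor]

/-- Translation by `y` as a permutation of the cube. -/
def cubeXorEquiv (y : Fin m → Bool) : (Fin m → Bool) ≃ (Fin m → Bool) where
  toFun x := cubeXor x y
  invFun x := cubeXor x y
  left_inv x := cubeXor_cancel x y
  right_inv x := cubeXor_cancel x y

lemma cubeAvg_comp_cubeXor (y : Fin m → Bool) (F : (Fin m → Bool) → ℝ) :
    cubeAvg (fun x => F (cubeXor x y)) = cubeAvg F :=
  cubeAvg_comp_equiv (cubeXorEquiv y) F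

/-- The string which agrees with `σ` on `T` and with `x` off `T`. -/
def overwrite (T : Finset (Fin m)) (σ x : Fin m → Bool) : Fin m → Bool :=
  fun i => if i ∈ T then σ i else x i

/-- Exchanging two strings on the coordinates in `T` preserves the uniform measure on pairs. -/
lemma cubeAvg_overwrite_swap (T : Finset (Fin m)) (H : (Fin m → Bool) → (Fin m → Bool) → ℝ) :
    cubeAvg (fun σ => cubeAvg (fun x => H (overwrite T σ x) (overwrite T x σ))) =
      cubeAvg (fun σ => cubeAvg (fun x => H σ x)) := by
  let e : ((Fin m → Bool) × (Fin m → Bool)) ≃ ((Fin m → Bool) × (Fin m → Bool)) :=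
    { toFun := fun p => (overwrite T p.1 p.2, overwrite T p.2 p.1)
      invFun := fun p => (overwrite T p.1 p.2, overwrite T p.2 p.1)
      left_inv := fun p => by
        ext i <;> simp only [overwrite] <;> split_ifs <;> rfl
      right_inv := fun p => by
        ext i <;> simp only [overwrite] <;> split_ifs <;> rfl }
  have h := Equiv.sum_comp e (fun p => H p.1 p.2)
  rw [Fintype.sum_prod_type, Fintype.sum_prod_type] at h
  simp only [cubeAvg, ← Finset.sum_div]
  rw [← h]
  rfl

lemma cubeAvg_overwrite (T : Finset (Fin m)) (F : (Fin m → Bool) → ℝ) :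
    cubeAvg (fun σ => cubeAvg (fun x => F (overwrite T σ x))) = cubeAvg F := by
  have h := cubeAvg_overwrite_swap T (fun σ _ => F σ)
  simpa only [cubeAvg_const] using h

/-- `F` depends only on the coordinates in `T`. -/
def DependsOnlyOn {α : Type*} (T : Finset (Fin m)) (F : (Fin m → Bool) → α) : Prop :=
  ∀ x y : Fin m → Bool, (∀ j ∈ T, x j = y j) → F x = F y

lemma DependsOnlyOn.mono {α : Type*} {S T : Finset (Fin m)} {F : (Fin m → Bool) → α}
    (h : DependsOnlyOn S F) (hST : S ⊆ T) : DependsOnlyOn T F :=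
  fun x y hxy => h x y fun j hj => hxy j (hST hj)

lemma DependsOnlyOn.comp_overwrite {α : Type*} {S : Finset (Fin m)} {F : (Fin m → Bool) → α}
    (h : DependsOnlyOn S F) (T : Finset (Fin m)) (σ : Fin m → Bool) :
    DependsOnlyOn (S \ T) (fun x => F (overwrite T σ x)) := by
  intro x y hxy
  apply h
  intro j hj
  by_cases hT : j ∈ T
  · simp [overwrite, hT]
  · simpa [overwrite, hT] using hxy j (by simp [hj, hT])

/-- Functions of disjoint sets of coordinates are uncorrelated. -/
lemma cubeAvg_mul_of_disjoint {A B : Finset (Fin m)} (hAB : Disjoint A B)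
    {F G : (Fin m → Bool) → ℝ} (hF : DependsOnlyOn A F) (hG : DependsOnlyOn B G) :
    cubeAvg (fun x => F x * G x) = cubeAvg F * cubeAvg G := by
  have h := cubeAvg_overwrite_swap A (fun σ _ => F σ * G σ)
  simp only [cubeAvg_const] at h
  rw [← h]
  have : ∀ σ x, F (overwrite A σ x) * G (overwrite A σ x) = F σ * G x := by
    intro σ x
    congr 1
    · exact hF _ _ fun j hj => by simp [overwrite, hj]
    · exact hG _ _ fun j hj => by simp [overwrite, Finset.disjoint_right.1 hAB hj]
  simp only [this, cubeAvg_const_mul, cubeAvg_mul_const]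

end CubeAvg

/-! ### Walsh characters -/

/-- The sign `(-1)^b`. -/
def boolSign (b : Bool) : ℝ := if b then -1 else 1

lemma boolSign_mul_self (b : Bool) : boolSign b * boolSign b = 1 := by
  cases b <;> simp [boolSign]

lemma abs_boolSign (b : Bool) : |boolSign b| = 1 := by
  cases b <;> simp [boolSign]

lemma boolSign_xor (a b : Bool) : boolSign (xor a b) = boolSign a * boolSign b := by
  cases a <;> cases b <;> simp [boolSign]

/-- The Walsh character indexed by `T`. -/
def walsh {m : ℕ} (T : Finset (Fin m)) (x : Fin m → Bool) : ℝ := ∏ i ∈ T, boolSign (x i)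

/-- The Walsh–Fourier coefficient of `F` at `T`. -/
def walshCoeff {m : ℕ} (F : (Fin m → Bool) → ℝ) (T : Finset (Fin m)) : ℝ :=
  cubeAvg (fun x => F x * walsh T x)

section Walsh

variable {m : ℕ}

lemma walsh_empty (x : Fin m → Bool) : walsh ∅ x = 1 := by simp [walsh]

lemma walsh_mul_self (T : Finset (Fin m)) (x : Fin m → Bool) : walsh T x * walsh T x = 1 := by
  simp [walsh, ← Finset.prod_mul_distrib, boolSign_mul_self]

lemma abs_walsh (T : Finset (Fin m)) (x : Fin m → Bool) : |walsh T x| = 1 := by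
  simp [walsh, Finset.abs_prod, abs_boolSign]

lemma walsh_cubeXor (T : Finset (Fin m)) (x y : Fin m → Bool) :
    walsh T (cubeXor x y) = walsh T x * walsh T y := by
  simp [walsh, cubeXor, boolSign_xor, Finset.prod_mul_distrib]

lemma walsh_mul_walsh (S T : Finset (Fin m)) (x : Fin m → Bool) :
    walsh S x * walsh T x = walsh (symmDiff S T) x := by
  have h1 : walsh S x = walsh (S \ T) x * walsh (S ∩ T) x := by
    unfold walsh
    rw [← Finset.prod_union (Finset.disjoint_sdiff_inter S T), Finset.sdiff_union_inter]
  have h2 : walsh T x = walsh (T \ S) x * walsh (S ∩ T) x := by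
    unfold walsh
    rw [Finset.inter_comm S T, ← Finset.prod_union (Finset.disjoint_sdiff_inter T S),
      Finset.sdiff_union_inter]
  have h3 : walsh (symmDiff S T) x = walsh (S \ T) x * walsh (T \ S) x := by
    unfold walsh
    rw [symmDiff_def, Finset.sup_eq_union, Finset.prod_union disjoint_sdiff_sdiff]
  rw [h1, h2, h3]
  linear_combination (walsh (S \ T) x * walsh (T \ S) x) * walsh_mul_self (S ∩ T) x

lemma walsh_dependsOnlyOn (T : Finset (Fin m)) : DependsOnlyOn T (walsh T) :=
  fun x y h => Finset.prod_congr rfl fun i hi => by rw [h i hi]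

lemma cubeAvg_walsh {T : Finset (Fin m)} (hT : T.Nonempty) : cubeAvg (walsh T) = 0 := by
  obtain ⟨j, hj⟩ := hT
  have h := cubeAvg_comp_cubeXor (fun i => decide (i = j)) (walsh T)
  have h2 : walsh T (fun i => decide (i = j)) = -1 := by
    unfold walsh
    rw [Finset.prod_eq_single_of_mem j hj]
    · simp [boolSign]
    · intro b _ hb
      simp [boolSign, hb]
  simp only [walsh_cubeXor, h2, cubeAvg_mul_const] at h
  linarith

lemma cubeAvg_walsh_mul (S T : Finset (Fin m)) :
    cubeAvg (fun x => walsh S x * walsh T x) = if S = T then 1 else 0 := by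
  simp only [walsh_mul_walsh]
  split_ifs with h
  · simp [h, walsh_empty, cubeAvg_const]
  · exact cubeAvg_walsh (by
      rw [Finset.nonempty_iff_ne_empty]
      intro h'
      exact h (symmDiff_eq_bot.1 h'))

lemma sum_walsh_mul_walsh (x y : Fin m → Bool) :
    ∑ T : Finset (Fin m), walsh T x * walsh T y = if x = y then 2 ^ m else 0 := by
  have h : ∑ T : Finset (Fin m), walsh T x * walsh T y
      = ∏ i : Fin m, (1 + boolSign (x i) * boolSign (y i)) := by
    rw [Finset.prod_one_add, Finset.powerset_univ]
    exact Finset.sum_congr rfl fun T _ => by rw [Finset.prod_mul_distrib]; rfl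
  rw [h]
  split_ifs with hxy
  · subst hxy
    simp [boolSign_mul_self]
    norm_num
  · obtain ⟨i, hi⟩ := Function.ne_iff.1 hxy
    apply Finset.prod_eq_zero (Finset.mem_univ i)
    revert hi
    cases x i <;> cases y i <;> simp [boolSign]

lemma walsh_inversion (F : (Fin m → Bool) → ℝ) (x : Fin m → Bool) :
    F x = ∑ T, walshCoeff F T * walsh T x := by
  simp only [walshCoeff, cubeAvg, div_mul_eq_mul_div, Finset.sum_mul, ← Finset.sum_div]
  rw [Finset.sum_comm]
  simp only [mul_assoc, ← Finset.mul_sum, sum_walsh_mul_walsh]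
  simp

lemma cubeAvg_mul_eq_sum_walshCoeff (F G : (Fin m → Bool) → ℝ) :
    cubeAvg (fun x => F x * G x) = ∑ T, walshCoeff F T * walshCoeff G T := by
  have : ∀ x, F x * G x = ∑ T, walshCoeff G T * (F x * walsh T x) := by
    intro x
    conv_lhs => rw [walsh_inversion G x, Finset.mul_sum]
    exact Finset.sum_congr rfl fun T _ => by ring
  simp only [this, cubeAvg_sum, cubeAvg_const_mul]
  exact Finset.sum_congr rfl fun T _ => by rw [mul_comm]; rfl

lemma cubeAvg_sq_eq_sum_walshCoeff (F : (Fin m → Bool) → ℝ) :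
    cubeAvg (fun x => F x ^ 2) = ∑ T, walshCoeff F T ^ 2 := by
  simpa only [sq] using cubeAvg_mul_eq_sum_walshCoeff F F

lemma walshCoeff_sum_walsh (a : Finset (Fin m) → ℝ) (T : Finset (Fin m)) :
    walshCoeff (fun x => ∑ S, a S * walsh S x) T = a T := by
  simp only [walshCoeff, Finset.sum_mul, mul_assoc, cubeAvg_sum, cubeAvg_const_mul,
    cubeAvg_walsh_mul]
  simp

lemma walshCoeff_empty (F : (Fin m → Bool) → ℝ) : walshCoeff F ∅ = cubeAvg F := by
  simp [walshCoeff, walsh_empty]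

lemma walshCoeff_eq_zero_of_dependsOnlyOn {A : Finset (Fin m)} {F : (Fin m → Bool) → ℝ}
    (hF : DependsOnlyOn A F) {T : Finset (Fin m)} (hT : ¬ T ⊆ A) : walshCoeff F T = 0 := by
  obtain ⟨j, hjT, hjA⟩ := Finset.not_subset.1 hT
  have h : ∀ x, F x * walsh T x = (F x * walsh (T.erase j) x) * walsh {j} x := by
    intro x
    rw [mul_assoc, walsh, walsh, walsh, Finset.prod_singleton,
      Finset.prod_erase_mul _ _ hjT]
  unfold walshCoeff
  simp only [h]
  rw [cubeAvg_mul_of_disjoint (A := A ∪ T.erase j) (B := {j}), cubeAvg_walsh (by simp), mul_zero]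
  · simp [hjA]
  · intro x y hxy
    dsimp only
    rw [hF x y fun i hi => hxy i (by simp [hi]),
      walsh_dependsOnlyOn (T.erase j) x y fun i hi => hxy i (Finset.mem_union_right _ hi)]
  · exact walsh_dependsOnlyOn _

end Walsh

/-! ### Hypercontractivity and correlation with polynomial phases -/

section Hypercontractivity

variable {m : ℕ}

lemma sum_walsh_dependsOnlyOn (V : Finset (Fin m)) (a : Finset (Fin m) → ℝ) :
    DependsOnlyOn V (fun x => ∑ T ∈ V.powerset, a T * walsh T x) := by
  intro x y hxy
  refine Finset.sum_congr rfl fun T hT => ?_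
  rw [walsh_dependsOnlyOn T x y fun j hj => hxy j (Finset.mem_powerset.1 hT hj)]

lemma cubeAvg_boolSign_mul_eq_zero {V : Finset (Fin m)} {i : Fin m} (hi : i ∉ V)
    {F : (Fin m → Bool) → ℝ} (hF : DependsOnlyOn V F) :
    cubeAvg (fun x => boolSign (x i) * F x) = 0 := by
  have h := cubeAvg_mul_of_disjoint (Finset.disjoint_singleton_left.2 hi)
    (walsh_dependsOnlyOn {i}) hF
  rw [cubeAvg_walsh (by simp), zero_mul] at h
  simpa [walsh] using h

/-- Bonami's hypercontractive inequality for fourth moments. -/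
lemma cubeAvg_pow_four_le (V : Finset (Fin m)) (a : Finset (Fin m) → ℝ) :
    cubeAvg (fun x => (∑ T ∈ V.powerset, a T * walsh T x) ^ 4) ≤
      (∑ T ∈ V.powerset, 3 ^ T.card * a T ^ 2) ^ 2 := by
  induction V using Finset.induction_on generalizing a with
  | empty => simp [walsh_empty, cubeAvg_const]; apply le_of_eq; ring
  | insert i V hi ih =>
    set A : (Fin m → Bool) → ℝ := fun x => ∑ T ∈ V.powerset, a T * walsh T x with hA
    set B : (Fin m → Bool) → ℝ := fun x => ∑ T ∈ V.powerset, a (insert i T) * walsh T x with hB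
    have hAd : DependsOnlyOn V A := sum_walsh_dependsOnlyOn V a
    have hBd : DependsOnlyOn V B := sum_walsh_dependsOnlyOn V fun T => a (insert i T)
    have hnot : ∀ T ∈ V.powerset, i ∉ T := fun T hT h => hi (Finset.mem_powerset.1 hT h)
    have hsum : ∀ x, ∑ T ∈ (insert i V).powerset, a T * walsh T x
        = A x + boolSign (x i) * B x := by
      intro x
      rw [Finset.sum_powerset_insert hi, hA, hB, Finset.mul_sum]
      congr 1
      refine Finset.sum_congr rfl fun T hT => ?_
      rw [walsh, Finset.prod_insert (hnot T hT), walsh]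
      ring
    have hexp : ∀ x, (∑ T ∈ (insert i V).powerset, a T * walsh T x) ^ 4
        = ((A x ^ 4 + 6 * (A x ^ 2 * B x ^ 2)) + B x ^ 4)
          + boolSign (x i) * (4 * A x ^ 3 * B x + 4 * A x * B x ^ 3) := by
      intro x
      rw [hsum]
      have h2 : boolSign (x i) ^ 2 = 1 := by rw [sq, boolSign_mul_self]
      have h3 : boolSign (x i) ^ 3 = boolSign (x i) := by rw [pow_succ, h2, one_mul]
      have h4 : boolSign (x i) ^ 4 = 1 := by rw [pow_succ, h3, boolSign_mul_self]
      linear_combination (6 * A x ^ 2 * B x ^ 2) * h2 + (4 * A x * B x ^ 3) * h3 + B x ^ 4 * h4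
    have hodd : cubeAvg (fun x => boolSign (x i) * (4 * A x ^ 3 * B x + 4 * A x * B x ^ 3)) = 0 :=
      cubeAvg_boolSign_mul_eq_zero hi fun x y hxy => by
        simp only [hAd x y hxy, hBd x y hxy]
    set s := ∑ T ∈ V.powerset, (3 : ℝ) ^ T.card * a T ^ 2 with hs
    set t := ∑ T ∈ V.powerset, (3 : ℝ) ^ T.card * a (insert i T) ^ 2 with ht
    have hs0 : 0 ≤ s := Finset.sum_nonneg fun T _ => by positivity
    have ht0 : 0 ≤ t := Finset.sum_nonneg fun T _ => by positivity
    have hA4 : cubeAvg (fun x => A x ^ 4) ≤ s ^ 2 := ih a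
    have hB4 : cubeAvg (fun x => B x ^ 4) ≤ t ^ 2 := ih fun T => a (insert i T)
    have hAB : cubeAvg (fun x => A x ^ 2 * B x ^ 2) ≤ s * t := by
      apply abs_le_of_sq_le_sq' _ (mul_nonneg hs0 ht0) |>.2
      refine (cubeAvg_mul_sq_le _ _).trans ?_
      rw [mul_pow]
      simp only [← pow_mul]
      exact mul_le_mul hA4 hB4 (cubeAvg_nonneg fun x => Even.pow_nonneg (by decide) _) (sq_nonneg _)
    have hrhs : ∑ T ∈ (insert i V).powerset, (3 : ℝ) ^ T.card * a T ^ 2 = s + 3 * t := by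
      rw [Finset.sum_powerset_insert hi, hs, ht, Finset.mul_sum]
      congr 1
      refine Finset.sum_congr rfl fun T hT => ?_
      rw [Finset.card_insert_of_notMem (hnot T hT)]
      ring
    rw [hrhs]
    simp only [hexp]
    rw [cubeAvg_add, hodd, add_zero, cubeAvg_add, cubeAvg_add, cubeAvg_const_mul]
    nlinarith

lemma cubeAvg_pow_four_le_of_degree (K : ℕ) (a : Finset (Fin m) → ℝ)
    (ha : ∀ T, K < T.card → a T = 0) :
    cubeAvg (fun x => (∑ T, a T * walsh T x) ^ 4) ≤ 9 ^ K * (∑ T, a T ^ 2) ^ 2 := by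
  have h := cubeAvg_pow_four_le Finset.univ a
  rw [Finset.powerset_univ] at h
  refine h.trans ?_
  have h9 : (9 : ℝ) ^ K = (3 ^ K) ^ 2 := by rw [← pow_mul, mul_comm, pow_mul]; norm_num
  rw [h9, ← mul_pow, Finset.mul_sum]
  refine pow_le_pow_left₀ (Finset.sum_nonneg fun T _ => by positivity)
    (Finset.sum_le_sum fun T _ => ?_) 2
  by_cases hT : K < T.card
  · simp [ha T hT]
  · exact mul_le_mul_of_nonneg_right
      (pow_le_pow_right₀ (by norm_num) (by omega)) (sq_nonneg _)

/-- Phase polynomials of degree at most `d`, defined through iterated multiplicative derivatives. -/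
def IsPolyPhase : ℕ → ((Fin m → Bool) → ℝ) → Prop
  | 0, F => ∃ c : ℝ, |c| ≤ 1 ∧ ∀ x, F x = c
  | d + 1, F => ∀ y, IsPolyPhase d (fun x => F x * F (cubeXor x y))

lemma IsPolyPhase.abs_le_one {d : ℕ} {F : (Fin m → Bool) → ℝ} (hF : IsPolyPhase d F)
    (x : Fin m → Bool) : |F x| ≤ 1 := by
  induction d generalizing F with
  | zero =>
    obtain ⟨c, hc, h⟩ := hF
    rw [h]; exact hc
  | succ d ih =>
    have h := ih (hF fun _ => false)
    have h0 : cubeXor x (fun _ => false) = x := by funext i; simp [cubeXor]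
    rw [h0, abs_mul] at h
    nlinarith [abs_nonneg (F x)]

lemma walshCoeff_mul_cubeXor (G : (Fin m → Bool) → ℝ) (y : Fin m → Bool) (U : Finset (Fin m)) :
    walshCoeff (fun x => G x * G (cubeXor x y)) U =
      ∑ S, (walshCoeff G (symmDiff U S) * walshCoeff G S) * walsh S y := by
  have h : walshCoeff (fun x => G x * G (cubeXor x y)) U
      = cubeAvg (fun x => (G x * walsh U x) * G (cubeXor x y)) := by
    unfold walshCoeff
    congr 1; funext x; ring
  rw [h, cubeAvg_mul_eq_sum_walshCoeff]
  refine Finset.sum_congr rfl fun S _ => ?_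
  have h1 : walshCoeff (fun x => G x * walsh U x) S = walshCoeff G (symmDiff U S) := by
    unfold walshCoeff
    simp only [mul_assoc, walsh_mul_walsh]
  have h2 : walshCoeff (fun x => G (cubeXor x y)) S = walshCoeff G S * walsh S y := by
    unfold walshCoeff
    rw [← cubeAvg_mul_const, ← cubeAvg_comp_cubeXor y (fun x => G x * walsh S x * walsh S y)]
    congr 1; funext x
    rw [walsh_cubeXor]
    linear_combination (-(G (cubeXor x y) * walsh S x)) * walsh_mul_self S y
  rw [h1, h2, mul_assoc]

lemma sum_symmDiff (U : Finset (Fin m)) (φ : Finset (Fin m) → ℝ) :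
    ∑ S, φ (symmDiff U S) = ∑ S, φ S := by
  refine Fintype.sum_equiv ⟨fun S => symmDiff U S, fun S => symmDiff U S, fun S => ?_, fun S => ?_⟩
    _ _ fun S => rfl
  · exact symmDiff_symmDiff_cancel_left U S
  · exact symmDiff_symmDiff_cancel_left U S

lemma sum_sq_convolution_le (g : Finset (Fin m) → ℝ) (hg : ∀ S, 0 ≤ g S) :
    ∑ U, (∑ S, g (symmDiff U S) * g S) ^ 2 ≤ (∑ S, g S ^ 2) * (∑ S, g S) ^ 2 := by
  have hle : ∀ U, ∑ S, g (symmDiff U S) * g S ≤ ∑ S, g S ^ 2 := by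
    intro U
    have h1 : ∑ S, g (symmDiff U S) * g S ≤ ∑ S, (g (symmDiff U S) ^ 2 / 2 + g S ^ 2 / 2) :=
      Finset.sum_le_sum fun S _ => by nlinarith [sq_nonneg (g (symmDiff U S) - g S)]
    rw [Finset.sum_add_distrib, sum_symmDiff U fun S => g S ^ 2 / 2, ← Finset.sum_div] at h1
    linarith
  have htot : ∑ U, ∑ S, g (symmDiff U S) * g S = (∑ S, g S) ^ 2 := by
    rw [Finset.sum_comm]
    simp only [← Finset.sum_mul]
    have : ∀ S, ∑ U, g (symmDiff U S) = ∑ U, g U := by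
      intro S
      simpa only [symmDiff_comm] using sum_symmDiff S g
    simp only [this, ← Finset.mul_sum, sq]
  calc ∑ U, (∑ S, g (symmDiff U S) * g S) ^ 2
      ≤ ∑ U, (∑ S, g S ^ 2) * ∑ S, g (symmDiff U S) * g S := by
        refine Finset.sum_le_sum fun U _ => ?_
        rw [sq]
        exact mul_le_mul_of_nonneg_right (hle U)
          (Finset.sum_nonneg fun S _ => mul_nonneg (hg _) (hg _))
    _ = _ := by rw [← Finset.mul_sum, htot]

lemma cubeAvg_sum_walshCoeff_pow_four_le (K : ℕ) (G : (Fin m → Bool) → ℝ)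
    (hK : ∀ T, K < T.card → walshCoeff G T = 0) :
    cubeAvg (fun y => ∑ U, walshCoeff (fun x => G x * G (cubeXor x y)) U ^ 4) ≤
      9 ^ K * ((∑ T, walshCoeff G T ^ 4) * (∑ T, walshCoeff G T ^ 2) ^ 2) := by
  rw [cubeAvg_sum]
  calc ∑ U, cubeAvg (fun y => walshCoeff (fun x => G x * G (cubeXor x y)) U ^ 4)
      ≤ ∑ U, 9 ^ K * (∑ S, walshCoeff G (symmDiff U S) ^ 2 * walshCoeff G S ^ 2) ^ 2 := by
        refine Finset.sum_le_sum fun U _ => ?_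
        simp only [walshCoeff_mul_cubeXor, ← mul_pow]
        exact cubeAvg_pow_four_le_of_degree K _ fun T hT => by rw [hK T hT, mul_zero]
    _ ≤ _ := by
        rw [← Finset.mul_sum]
        gcongr
        have := sum_sq_convolution_le (fun S => walshCoeff G S ^ 2) fun S => sq_nonneg _
        simpa only [← pow_mul] using this

lemma cubeAvg_cubeAvg_cubeXor (F G : (Fin m → Bool) → ℝ) :
    cubeAvg (fun y => cubeAvg (fun x => F x * G (cubeXor x y))) = cubeAvg F * cubeAvg G := by
  rw [cubeAvg_comm]
  simp only [cubeAvg_const_mul]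
  have : ∀ x, cubeAvg (fun y => G (cubeXor x y)) = cubeAvg G := by
    intro x
    simpa only [cubeXor_comm x] using cubeAvg_comp_cubeXor x G
  simp only [this, cubeAvg_mul_const]

lemma walshCoeff_mul_cubeXor_eq_zero {K : ℕ} {G : (Fin m → Bool) → ℝ}
    (hK : ∀ T, K < T.card → walshCoeff G T = 0) (y : Fin m → Bool) (U : Finset (Fin m))
    (hU : 2 * K < U.card) : walshCoeff (fun x => G x * G (cubeXor x y)) U = 0 := by
  rw [walshCoeff_mul_cubeXor]
  refine Finset.sum_eq_zero fun S _ => ?_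
  by_cases hS : K < S.card
  · rw [hK S hS]; ring
  · have : K < (symmDiff U S).card := by
      have h1 : U ⊆ symmDiff U S ∪ S := by
        intro i hi
        by_cases hiS : i ∈ S
        · exact Finset.mem_union_right _ hiS
        · exact Finset.mem_union_left _ (Finset.mem_symmDiff.2 (Or.inl ⟨hi, hiS⟩))
      have h2 := (Finset.card_le_card h1).trans (Finset.card_union_le _ _)
      omega
    rw [hK _ this]; ring

/-- A low-degree real polynomial with small coefficients is almost uncorrelated with every phase
polynomial of bounded degree. -/
theorem exists_abs_cubeAvg_polyPhase_mul_le (d : ℕ) : ∀ (K : ℕ) (δ : ℝ), 0 < δ → ∃ ε : ℝ, 0 < ε ∧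
    ∀ (m : ℕ) (χ G : (Fin m → Bool) → ℝ), IsPolyPhase d χ →
      (∀ T, K < T.card → walshCoeff G T = 0) → cubeAvg (fun x => G x ^ 2) ≤ 1 →
      ∑ T, walshCoeff G T ^ 4 ≤ ε → |cubeAvg (fun x => χ x * G x)| ≤ δ := by
  induction d with
  | zero =>
    intro K δ hδ
    refine ⟨δ ^ 4, by positivity, ?_⟩
    rintro m χ G ⟨c, hc, hχ⟩ - - h4
    simp only [hχ, cubeAvg_const_mul]
    rw [abs_mul]
    have h1 : |cubeAvg G| ≤ δ := by
      have h2 : walshCoeff G ∅ ^ 4 ≤ δ ^ 4 :=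
        (Finset.single_le_sum (f := fun T => walshCoeff G T ^ 4)
          (fun T _ => by positivity) (Finset.mem_univ ∅)).trans h4
      rw [walshCoeff_empty] at h2
      have h3 : |cubeAvg G| ^ 4 ≤ δ ^ 4 := by
        rwa [← abs_pow, abs_of_nonneg (by positivity)]
      exact (pow_le_pow_iff_left₀ (abs_nonneg _) hδ.le (by norm_num)).1 h3
    calc |c| * |cubeAvg G| ≤ 1 * δ := by gcongr
      _ = δ := one_mul _
  | succ d ih =>
    intro K δ hδ
    set η : ℝ := δ ^ 2 / 3 with hη
    have hη0 : 0 < η := by positivity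
    set M : ℝ := η⁻¹ with hM
    have hM0 : 0 < M := by positivity
    obtain ⟨ε₁, hε₁, h₁⟩ := ih (2 * K) (η / M) (by positivity)
    refine ⟨η * (ε₁ * M ^ 3) / 9 ^ K, by positivity, ?_⟩
    intro m χ G hχ hK h2 h4
    set H : (Fin m → Bool) → (Fin m → Bool) → ℝ := fun y x => G x * G (cubeXor x y) with hH
    set D : (Fin m → Bool) → (Fin m → Bool) → ℝ := fun y x => χ x * χ (cubeXor x y) with hD
    set A : (Fin m → Bool) → ℝ := fun y => cubeAvg (fun x => H y x ^ 2) with hAdef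
    set B : (Fin m → Bool) → ℝ := fun y => ∑ U, walshCoeff (H y) U ^ 4 with hBdef
    have hA0 : ∀ y, 0 ≤ A y := fun y => cubeAvg_nonneg fun x => by positivity
    have hB0 : ∀ y, 0 ≤ B y := fun y => Finset.sum_nonneg fun x _ => by positivity
    have hEA : cubeAvg A ≤ 1 := by
      have := cubeAvg_cubeAvg_cubeXor (fun x => G x ^ 2) (fun x => G x ^ 2)
      simp only [← mul_pow] at this
      rw [hAdef, this]
      have h0 : 0 ≤ cubeAvg (fun x => G x ^ 2) := cubeAvg_nonneg fun x => by positivity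
      nlinarith
    have hEB : cubeAvg B ≤ η * (ε₁ * M ^ 3) := by
      refine (cubeAvg_sum_walshCoeff_pow_four_le K G hK).trans ?_
      have h5 : (∑ T, walshCoeff G T ^ 2) ^ 2 ≤ 1 := by
        rw [← cubeAvg_sq_eq_sum_walshCoeff]
        exact pow_le_one₀ (cubeAvg_nonneg fun x => by positivity) h2
      calc (9 : ℝ) ^ K * ((∑ T, walshCoeff G T ^ 4) * (∑ T, walshCoeff G T ^ 2) ^ 2)
          ≤ 9 ^ K * ((η * (ε₁ * M ^ 3) / 9 ^ K) * 1) := by gcongr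
        _ = _ := by field_simp
    have hDle : ∀ y x, |D y x| ≤ 1 := fun y x => (hχ y).abs_le_one x
    have hCS : ∀ y, |cubeAvg (fun x => D y x * H y x)| ^ 2 ≤ A y := by
      intro y
      rw [sq_abs]
      refine (cubeAvg_mul_sq_le _ _).trans ?_
      have : cubeAvg (fun x => D y x ^ 2) ≤ 1 := by
        rw [← cubeAvg_const (m := m) (1 : ℝ)]
        exact cubeAvg_mono fun x => by
          have := hDle y x
          rw [← sq_abs]
          exact pow_le_one₀ (abs_nonneg _) this
      exact mul_le_of_le_one_left (hA0 y) this
    have hpt : ∀ y, |cubeAvg (fun x => D y x * H y x)| ≤ η + A y * η + B y / (ε₁ * M ^ 3) := by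
      intro y
      set q := |cubeAvg (fun x => D y x * H y x)| with hq
      have hq0 : 0 ≤ q := abs_nonneg _
      have hBn : 0 ≤ B y / (ε₁ * M ^ 3) := div_nonneg (hB0 y) (by positivity)
      have hAn : 0 ≤ A y * η := mul_nonneg (hA0 y) hη0.le
      by_cases hAy : A y ≤ M ^ 2
      · by_cases hBy : B y ≤ ε₁ * M ^ 4
        · have h := h₁ m (D y) (fun x => M⁻¹ * H y x) (hχ y) ?_ ?_ ?_
          · have he : cubeAvg (fun x => D y x * (M⁻¹ * H y x))
                = M⁻¹ * cubeAvg (fun x => D y x * H y x) := by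
              rw [← cubeAvg_const_mul]; congr 1; funext x; ring
            rw [he, abs_mul, abs_of_pos (inv_pos.2 hM0), inv_mul_eq_div,
              div_le_div_iff_of_pos_right hM0] at h
            linarith
          · intro T hT
            have : walshCoeff (fun x => M⁻¹ * H y x) T = M⁻¹ * walshCoeff (H y) T := by
              simp only [walshCoeff, mul_assoc, cubeAvg_const_mul]
            rw [this, walshCoeff_mul_cubeXor_eq_zero hK y T hT, mul_zero]
          · simp only [mul_pow, cubeAvg_const_mul]
            rw [inv_pow, inv_mul_le_iff₀ (by positivity), mul_one]
            exact hAy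
          · have : ∀ T, walshCoeff (fun x => M⁻¹ * H y x) T = M⁻¹ * walshCoeff (H y) T := by
              intro T
              simp only [walshCoeff, mul_assoc, cubeAvg_const_mul]
            simp only [this, mul_pow, ← Finset.mul_sum]
            rw [inv_pow, inv_mul_le_iff₀ (by positivity), mul_comm]
            exact hBy
        · have hqM : q ≤ M := abs_le_of_sq_le_sq' ((hCS y).trans hAy) hM0.le |>.2
          have : M ≤ B y / (ε₁ * M ^ 3) := by
            rw [le_div_iff₀ (by positivity)]
            push Not at hBy
            nlinarith
          linarith
      · push Not at hAy
        have hMη : M * η = 1 := by rw [hM]; field_simp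
        have : q ≤ A y * η := by
          by_contra hcon
          push Not at hcon
          have hc1 : M < q := by nlinarith
          have hc2 : M * (A y * η) = A y := by rw [mul_comm (A y), ← mul_assoc, hMη, one_mul]
          nlinarith [hCS y, hA0 y]
        linarith
    have hmain : (cubeAvg (fun x => χ x * G x)) ^ 2 ≤ δ ^ 2 := by
      have h1 := cubeAvg_cubeAvg_cubeXor (fun x => χ x * G x) (fun x => χ x * G x)
      have h1' : cubeAvg (fun y => cubeAvg (fun x => D y x * H y x))
          = (cubeAvg (fun x => χ x * G x)) ^ 2 := by
        rw [sq, ← h1]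
        congr 1; funext y; congr 1; funext x; simp only [hD, hH]; ring
      rw [← h1']
      refine (le_abs_self _).trans ((abs_cubeAvg_le _).trans ((cubeAvg_mono hpt).trans ?_))
      rw [cubeAvg_add, cubeAvg_add, cubeAvg_const, cubeAvg_mul_const]
      simp only [div_eq_mul_inv, cubeAvg_mul_const]
      rw [← div_eq_mul_inv]
      have h6 : cubeAvg B / (ε₁ * M ^ 3) ≤ η := by
        rw [div_le_iff₀ (by positivity)]; exact hEB
      have h7 : cubeAvg A * η ≤ 1 * η := by gcongr
      have : δ ^ 2 = η + η + η := by rw [hη]; ring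
      linarith
    exact abs_le_of_sq_le_sq hmain hδ.le

/-- If all low-degree nonconstant coefficients of a phase polynomial are small then they carry
little total weight. -/
theorem exists_sum_sq_walshCoeff_polyPhase_le (d K : ℕ) (δ : ℝ) (hδ : 0 < δ) :
    ∃ ε : ℝ, 0 < ε ∧ ∀ (m : ℕ) (χ : (Fin m → Bool) → ℝ), IsPolyPhase d χ →
      (∀ T : Finset (Fin m), T.Nonempty → T.card ≤ K → |walshCoeff χ T| ≤ ε) →
      ∑ T ∈ Finset.univ.filter (fun T : Finset (Fin m) => T.Nonempty ∧ T.card ≤ K),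
        walshCoeff χ T ^ 2 ≤ δ := by
  obtain ⟨ε₁, hε₁, h₁⟩ := exists_abs_cubeAvg_polyPhase_mul_le d K δ hδ
  refine ⟨min 1 ε₁, by positivity, ?_⟩
  intro m χ hχ hsmall
  set a : Finset (Fin m) → ℝ := fun T => if T.Nonempty ∧ T.card ≤ K then walshCoeff χ T else 0
    with ha
  set G : (Fin m → Bool) → ℝ := fun x => ∑ T, a T * walsh T x with hG
  have hGc : ∀ T, walshCoeff G T = a T := walshCoeff_sum_walsh a
  have hW : ∑ T ∈ Finset.univ.filter (fun T : Finset (Fin m) => T.Nonempty ∧ T.card ≤ K),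
        walshCoeff χ T ^ 2 = ∑ T, a T ^ 2 := by
    rw [Finset.sum_filter]
    refine Finset.sum_congr rfl fun T _ => ?_
    simp only [ha]
    split_ifs <;> simp
  have hχG : cubeAvg (fun x => χ x * G x) = ∑ T, a T ^ 2 := by
    rw [cubeAvg_mul_eq_sum_walshCoeff]
    refine Finset.sum_congr rfl fun T _ => ?_
    rw [hGc]
    simp only [ha]
    split_ifs <;> ring
  have hle1 : ∑ T, a T ^ 2 ≤ 1 := by
    have h1 : cubeAvg (fun x => χ x ^ 2) ≤ 1 := by
      rw [← cubeAvg_const (m := m) (1 : ℝ)]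
      exact cubeAvg_mono fun x => by
        rw [← sq_abs]
        exact pow_le_one₀ (abs_nonneg _) (hχ.abs_le_one x)
    rw [cubeAvg_sq_eq_sum_walshCoeff] at h1
    refine (Finset.sum_le_sum fun T _ => ?_).trans h1
    simp only [ha]
    split_ifs
    · exact le_rfl
    · simpa using sq_nonneg (walshCoeff χ T)
  have hmin1 : min 1 ε₁ ≤ 1 := min_le_left _ _
  have hmin0 : 0 < min 1 ε₁ := by positivity
  have habs : ∀ T, a T ^ 2 ≤ ε₁ := by
    intro T
    have : |a T| ≤ min 1 ε₁ := by
      simp only [ha]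
      split_ifs with h
      · exact hsmall T h.1 h.2
      · simpa using hmin0.le
    rw [← sq_abs]
    nlinarith [abs_nonneg (a T), min_le_right 1 ε₁]
  have h := h₁ m χ G hχ (fun T hT => by rw [hGc]; simp only [ha]; rw [if_neg]; omega)
    (by rw [cubeAvg_sq_eq_sum_walshCoeff]; simpa only [hGc] using hle1)
    (by
      simp only [hGc]
      calc ∑ T, a T ^ 4 ≤ ∑ T, ε₁ * a T ^ 2 := Finset.sum_le_sum fun T _ => by
            nlinarith [habs T, sq_nonneg (a T)]
        _ = ε₁ * ∑ T, a T ^ 2 := by rw [Finset.mul_sum]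
        _ ≤ ε₁ * 1 := by gcongr
        _ = ε₁ := mul_one _)
  rw [hW, ← hχG]
  exact (le_abs_self _).trans h

end Hypercontractivity

section LocalFunctions

variable {m n : ℕ}

lemma IsPolyPhase.mul : ∀ {d : ℕ} {F G : (Fin m → Bool) → ℝ}, IsPolyPhase d F → IsPolyPhase d G →
    IsPolyPhase d (fun x => F x * G x)
  | 0, F, G, ⟨a, ha, hF⟩, ⟨b, hb, hG⟩ => ⟨a * b, by
      rw [abs_mul]; exact mul_le_one₀ ha (abs_nonneg _) hb, fun x => by simp only [hF, hG]⟩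
  | d + 1, F, G, hF, hG => fun y => by
      have h := (hF y).mul (hG y)
      convert h using 2
      ring

lemma IsPolyPhase.comp_cubeXor (s : Fin m → Bool) : ∀ {d : ℕ} {F : (Fin m → Bool) → ℝ},
    IsPolyPhase d F → IsPolyPhase d (fun x => F (cubeXor x s))
  | 0, F, ⟨a, ha, hF⟩ => ⟨a, ha, fun x => hF _⟩
  | d + 1, F, hF => fun y => by
      have h := IsPolyPhase.comp_cubeXor s (hF y)
      convert h using 3
      simp only [cubeXor_assoc, cubeXor_comm s y]

lemma isPolyPhase_one : ∀ d : ℕ, IsPolyPhase d (fun _ : Fin m → Bool => (1 : ℝ))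
  | 0 => ⟨1, by simp, fun _ => rfl⟩
  | d + 1 => fun y => by simpa using isPolyPhase_one d

lemma IsPolyPhase.prod {ι : Type*} {d : ℕ} (s : Finset ι) {F : ι → (Fin m → Bool) → ℝ}
    (h : ∀ i ∈ s, IsPolyPhase d (F i)) : IsPolyPhase d (fun x => ∏ i ∈ s, F i x) := by
  classical
  induction s using Finset.induction_on with
  | empty => simpa using isPolyPhase_one d
  | insert i s hi ih =>
    simp only [Finset.prod_insert hi]
    exact (h i (Finset.mem_insert_self _ _)).mul
      (ih fun j hj => h j (Finset.mem_insert_of_mem hj))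

/-- The indicator string of a set of coordinates. -/
def indicatorString (Y : Finset (Fin m)) : Fin m → Bool := fun i => decide (i ∈ Y)

lemma cubeXor_indicatorString_insert {j : Fin m} {Y : Finset (Fin m)} (hj : j ∉ Y)
    (x : Fin m → Bool) : cubeXor x (indicatorString (insert j Y)) =
      cubeXor (cubeXor x (indicatorString Y)) (indicatorString {j}) := by
  funext i
  by_cases hi : i = j
  · subst hi; simp [cubeXor, indicatorString, hj]
  · simp [cubeXor, indicatorString, hi]

/-- Agreement of two strings on `T` given agreement on `T.erase j`, up to flipping `j`. -/
lemma agree_or_agree_flip {T : Finset (Fin m)} {j : Fin m} {x y : Fin m → Bool}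
    (h : ∀ i ∈ T.erase j, x i = y i) :
    ((∀ i ∈ T, x i = y i) ∧ ∀ i ∈ T, cubeXor x (indicatorString {j}) i =
        cubeXor y (indicatorString {j}) i) ∨
    ((∀ i ∈ T, x i = cubeXor y (indicatorString {j}) i) ∧
      ∀ i ∈ T, cubeXor x (indicatorString {j}) i = y i) := by
  by_cases hj : x j = y j
  · have h1 : ∀ i ∈ T, x i = y i := by
      intro i hi
      by_cases hij : i = j
      · rw [hij, hj]
      · exact h i (Finset.mem_erase.2 ⟨hij, hi⟩)
    exact Or.inl ⟨h1, fun i hi => by simp [cubeXor, h1 i hi]⟩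
  · refine Or.inr ⟨fun i hi => ?_, fun i hi => ?_⟩
    all_goals
      by_cases hij : i = j
      · subst hij
        revert hj
        cases hx : x i <;> cases hy : y i <;> simp [cubeXor, indicatorString, hx, hy]
      · simp [cubeXor, indicatorString, hij, h i (Finset.mem_erase.2 ⟨hij, hi⟩)]

lemma isPolyPhase_of_dependsOnlyOn : ∀ {d : ℕ} {F : (Fin m → Bool) → ℝ} {T : Finset (Fin m)},
    (∀ x, F x * F x = 1) → DependsOnlyOn T F → T.card ≤ d → IsPolyPhase d F
  | 0, F, T, hF, hT, hd => by
      refine ⟨F fun _ => false, ?_, fun x => hT _ _ fun j hj => ?_⟩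
      · have := hF fun _ => false
        rw [← abs_mul_abs_self] at this
        nlinarith [abs_nonneg (F fun _ => false)]
      · rw [Finset.card_eq_zero.1 (Nat.le_zero.1 hd)] at hj
        simp at hj
  | d + 1, F, T, hF, hT, hd => by
      intro y
      have hflip : ∀ j, IsPolyPhase d (fun x => F x * F (cubeXor x (indicatorString {j}))) := by
        intro j
        by_cases hj : j ∈ T
        · refine isPolyPhase_of_dependsOnlyOn (T := T.erase j) (fun x => ?_) ?_ ?_
          · rw [mul_mul_mul_comm, hF, hF, one_mul]
          · intro x z hxz
            rcases agree_or_agree_flip hxz with ⟨h1, h2⟩ | ⟨h1, h2⟩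
            · simp only [hT _ _ h1, hT _ _ h2]
            · simp only [hT _ _ h1, hT _ _ h2]
              ring
          · rw [Finset.card_erase_of_mem hj]; omega
        · have : ∀ x, F x * F (cubeXor x (indicatorString {j})) = 1 := by
            intro x
            rw [← hF x]
            congr 1
            refine hT _ _ fun i hi => ?_
            have : i ≠ j := fun h => hj (h ▸ hi)
            simp [cubeXor, indicatorString, this]
          simpa only [this] using isPolyPhase_one d
      have hall : ∀ Y : Finset (Fin m),
          IsPolyPhase d (fun x => F x * F (cubeXor x (indicatorString Y))) := by
        intro Y
        induction Y using Finset.induction_on with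
        | empty =>
          have : ∀ x : Fin m → Bool, cubeXor x (indicatorString ∅) = x := by
            intro x; funext i; simp [cubeXor, indicatorString]
          simpa only [this, hF] using isPolyPhase_one d
        | insert j Y hj ih =>
          have h := ih.mul ((hflip j).comp_cubeXor (indicatorString Y))
          convert h using 2 with x
          rw [cubeXor_indicatorString_insert hj]
          linear_combination -(F x * F (cubeXor (cubeXor x (indicatorString Y))
            (indicatorString {j}))) * hF (cubeXor x (indicatorString Y))
      have hy : y = indicatorString (Finset.univ.filter fun i => y i = true) := by
        funext i; simp [indicatorString]
      rw [hy]
      exact hall _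

lemma IsLocal.isPolyPhase {d : ℕ} {f : (Fin m → Bool) → (Fin n → Bool)} (hf : IsLocal d f)
    (K : Finset (Fin n)) : IsPolyPhase d (fun x => walsh K (f x)) := by
  refine IsPolyPhase.prod K fun i _ => ?_
  obtain ⟨T, hT, h⟩ := hf i
  exact isPolyPhase_of_dependsOnlyOn (fun x => boolSign_mul_self _)
    (fun x y hxy => by rw [h x y hxy]) hT

lemma IsLocal.comp_overwrite {d : ℕ} {f : (Fin m → Bool) → (Fin n → Bool)} (hf : IsLocal d f)
    (T : Finset (Fin m)) (σ : Fin m → Bool) : IsLocal d (fun x => f (overwrite T σ x)) := by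
  intro i
  obtain ⟨S, hS, h⟩ := hf i
  refine ⟨S \ T, (Finset.card_le_card Finset.sdiff_subset).trans hS, ?_⟩
  exact DependsOnlyOn.comp_overwrite (F := fun x => f x i) h T σ

lemma IsLocal.exists_dependsOnlyOn_walsh {d : ℕ} {f : (Fin m → Bool) → (Fin n → Bool)}
    (hf : IsLocal d f) : ∃ A : Finset (Fin n) → Finset (Fin m), ∀ K,
      (A K).card ≤ d * K.card ∧ DependsOnlyOn (A K) (fun x => walsh K (f x)) := by
  choose N hN h using hf
  refine ⟨fun K => K.biUnion N, fun K => ⟨?_, ?_⟩⟩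
  · rw [mul_comm]
    exact Finset.card_biUnion_le_card_mul _ _ _ fun i _ => hN i
  · intro x y hxy
    refine Finset.prod_congr rfl fun i hi => ?_
    rw [h i x y fun j hj => hxy j (Finset.mem_biUnion.2 ⟨i, hi, hj⟩)]

lemma exists_cubeAvg_eq_div_two_pow (A : Finset (Fin m)) : ∀ F : (Fin m → Bool) → ℤ,
    DependsOnlyOn A F → ∃ N : ℤ, cubeAvg (fun x => (F x : ℝ)) = N / 2 ^ A.card := by
  induction A using Finset.induction_on with
  | empty =>
    intro F hF
    refine ⟨F fun _ => false, ?_⟩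
    have : ∀ x, F x = F fun _ => false := fun x => hF _ _ (by simp)
    simp only [this, cubeAvg_const]
    simp
  | insert j A hj ih =>
    intro F hF
    obtain ⟨N, hN⟩ := ih (fun x => F x + F (cubeXor x (indicatorString {j}))) (by
      intro x y hxy
      rw [← Finset.erase_insert hj] at hxy
      rcases agree_or_agree_flip hxy with ⟨h1, h2⟩ | ⟨h1, h2⟩
      · simp only [hF _ _ h1, hF _ _ h2]
      · simp only [hF _ _ h1, hF _ _ h2]
        ring)
    refine ⟨N, ?_⟩
    push_cast at hN
    rw [cubeAvg_add, cubeAvg_comp_cubeXor _ (fun x => (F x : ℝ))] at hN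
    rw [Finset.card_insert_of_notMem hj, pow_succ]
    field_simp at hN ⊢
    linarith

lemma exists_walsh_eq_intCast (T : Finset (Fin n)) (x : Fin n → Bool) :
    ((∏ i ∈ T, (if x i then -1 else 1) : ℤ) : ℝ) = walsh T x := by
  push_cast
  simp only [walsh, boolSign]

lemma IsLocal.le_abs_cubeAvg_walsh {d : ℕ} {f : (Fin m → Bool) → (Fin n → Bool)}
    (hf : IsLocal d f) {K : Finset (Fin n)} (hK : cubeAvg (fun x => walsh K (f x)) ≠ 0) :
    ((2 : ℝ) ^ (d * K.card))⁻¹ ≤ |cubeAvg (fun x => walsh K (f x))| := by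
  obtain ⟨A, hA⟩ := hf.exists_dependsOnlyOn_walsh
  obtain ⟨hcard, hdep⟩ := hA K
  obtain ⟨N, hN⟩ := exists_cubeAvg_eq_div_two_pow (A K)
    (fun x => (∏ i ∈ K, (if f x i then -1 else 1) : ℤ)) (by
      intro x y hxy
      have h := hdep x y hxy
      simp only [← exists_walsh_eq_intCast] at h
      exact_mod_cast h)
  simp only [exists_walsh_eq_intCast] at hN
  rw [hN] at hK ⊢
  have hN0 : N ≠ 0 := by rintro rfl; simp at hK
  have hN1 : (1 : ℝ) ≤ |(N : ℝ)| := by exact_mod_cast Int.one_le_abs hN0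
  rw [abs_div, abs_of_pos (by positivity : (0 : ℝ) < 2 ^ (A K).card), inv_eq_one_div]
  gcongr
  norm_num

end LocalFunctions

section Rounds

variable {m n : ℕ}

lemma sq_cubeAvg_le_cubeAvg_overwrite (T : Finset (Fin m)) (F : (Fin m → Bool) → ℝ) :
    (cubeAvg F) ^ 2 ≤ cubeAvg (fun σ => (cubeAvg fun x => F (overwrite T σ x)) ^ 2) := by
  rw [← cubeAvg_overwrite T F]
  exact sq_cubeAvg_le _

lemma sq_add_sq_walshCoeff_le_cubeAvg_overwrite {T : Finset (Fin m)} (hT : T.Nonempty)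
    (F : (Fin m → Bool) → ℝ) :
    (cubeAvg F) ^ 2 + walshCoeff F T ^ 2 ≤
      cubeAvg (fun σ => (cubeAvg fun x => F (overwrite T σ x)) ^ 2) := by
  set G : (Fin m → Bool) → ℝ := fun σ => cubeAvg fun x => F (overwrite T σ x) with hG
  have h0 : walshCoeff G ∅ = cubeAvg F := by rw [walshCoeff_empty, hG, cubeAvg_overwrite]
  have h1 : walshCoeff G T = walshCoeff F T := by
    rw [walshCoeff, walshCoeff, ← cubeAvg_overwrite T (fun x => F x * walsh T x)]
    simp only [hG, ← cubeAvg_mul_const]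
    congr 1; funext σ; congr 1; funext x
    congr 1
    exact walsh_dependsOnlyOn T _ _ fun j hj => by simp [overwrite, hj]
  rw [cubeAvg_sq_eq_sum_walshCoeff, ← h0, ← h1, ← Finset.sum_pair (f := fun S => walshCoeff G S ^ 2) hT.ne_empty.symm]
  exact Finset.sum_le_sum_of_subset_of_nonneg (Finset.subset_univ _) fun _ _ _ => sq_nonneg _

/-- The average over `𝓕` of the Walsh characters with signs `s`. -/
def signedAvg (𝓕 : Finset (Finset (Fin n))) (s : Finset (Fin n) → ℝ) (y : Fin n → Bool) : ℝ :=
  (∑ K ∈ 𝓕, s K * walsh K y) / 𝓕.card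

lemma exists_junta_variance_le {ι : Type*} [DecidableEq ι] {D L : ℕ} (hL : 0 < L)
    {𝓕 : Finset ι} (h𝓕 : 𝓕.Nonempty)
    (z : ι → (Fin m → Bool) → ℝ) (hz : ∀ K x, |z K x| ≤ 1) (A : ι → Finset (Fin m))
    (hA : ∀ K ∈ 𝓕, (A K).card ≤ D) (hdep : ∀ K, DependsOnlyOn (A K) (z K)) :
    ∃ T : Finset (Fin m), T.card ≤ D * L ∧ ∀ σ,
      cubeAvg (fun x => ((∑ K ∈ 𝓕, z K (overwrite T σ x)) / 𝓕.card
        - cubeAvg (fun x => (∑ K ∈ 𝓕, z K (overwrite T σ x)) / 𝓕.card)) ^ 2) ≤ 2 * D / L := by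
  have hc : (0 : ℝ) < 𝓕.card := by exact_mod_cast h𝓕.card_pos
  set deg : Fin m → ℕ := fun j => (𝓕.filter fun K => j ∈ A K).card with hdeg
  have hsum : ∑ j, deg j ≤ 𝓕.card * D := by
    have : ∑ j, deg j = ∑ K ∈ 𝓕, (A K).card := by
      simp only [hdeg, Finset.card_filter]
      rw [Finset.sum_comm]
      exact Finset.sum_congr rfl fun K _ => by simp
    rw [this, ← smul_eq_mul]
    exact Finset.sum_le_card_nsmul _ _ _ hA
  set T : Finset (Fin m) := Finset.univ.filter fun j => 𝓕.card ≤ L * deg j with hT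
  refine ⟨T, ?_, fun σ => ?_⟩
  · have h1 : T.card * 𝓕.card ≤ ∑ j ∈ T, L * deg j := by
      rw [← smul_eq_mul]
      exact Finset.card_nsmul_le_sum _ _ _ fun j hj => (Finset.mem_filter.1 hj).2
    have h2 : ∑ j ∈ T, L * deg j ≤ L * (𝓕.card * D) := by
      rw [← Finset.mul_sum]
      exact Nat.mul_le_mul_left _ ((Finset.sum_le_univ_sum_of_nonneg fun _ => by simp).trans hsum)
    have h3 : T.card * 𝓕.card ≤ (D * L) * 𝓕.card := by nlinarith
    exact Nat.le_of_mul_le_mul_right h3 h𝓕.card_pos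
  · set u : ι → (Fin m → Bool) → ℝ := fun K x => z K (overwrite T σ x) with hu
    set v : ι → (Fin m → Bool) → ℝ := fun K x => u K x - cubeAvg (u K) with hv
    have hu1 : ∀ K, |cubeAvg (u K)| ≤ 1 := fun K => (abs_cubeAvg_le _).trans (by
      rw [← cubeAvg_const (m := m) (1 : ℝ)]
      exact cubeAvg_mono fun x => hz K _)
    have hcov : ∀ K K', cubeAvg (fun x => v K x * v K' x) =
        cubeAvg (fun x => u K x * u K' x) - cubeAvg (u K) * cubeAvg (u K') := by
      intro K K'
      have : ∀ x, v K x * v K' x = u K x * u K' x - cubeAvg (u K) * u K' x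
          - u K x * cubeAvg (u K') + cubeAvg (u K) * cubeAvg (u K') := by
        intro x; simp only [hv]; ring
      simp only [this, cubeAvg_add, cubeAvg_sub, cubeAvg_const_mul, cubeAvg_mul_const, cubeAvg_const]
      ring
    have hcov0 : ∀ K K', Disjoint (A K \ T) (A K' \ T) → cubeAvg (fun x => v K x * v K' x) = 0 := by
      intro K K' h
      rw [hcov, cubeAvg_mul_of_disjoint h ((hdep K).comp_overwrite T σ)
        ((hdep K').comp_overwrite T σ), sub_self]
    have hcov2 : ∀ K K', cubeAvg (fun x => v K x * v K' x) ≤ 2 := by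
      intro K K'
      rw [hcov]
      have h1 : cubeAvg (fun x => u K x * u K' x) ≤ 1 := by
        rw [← cubeAvg_const (m := m) (1 : ℝ)]
        refine cubeAvg_mono fun x => (le_abs_self _).trans ?_
        rw [abs_mul]
        exact mul_le_one₀ (hz _ _) (abs_nonneg _) (hz _ _)
      have h2 : |cubeAvg (u K) * cubeAvg (u K')| ≤ 1 := by
        rw [abs_mul]
        exact mul_le_one₀ (hu1 _) (abs_nonneg _) (hu1 _)
      linarith [neg_le_of_abs_le h2]
    have hrow : ∀ K ∈ 𝓕, ∑ K' ∈ 𝓕, cubeAvg (fun x => v K x * v K' x) ≤ 2 * (D * (𝓕.card / L)) := by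
      intro K hK
      calc ∑ K' ∈ 𝓕, cubeAvg (fun x => v K x * v K' x)
          ≤ ∑ K' ∈ 𝓕, ∑ j ∈ A K \ T, (if j ∈ A K' then (2 : ℝ) else 0) := by
            refine Finset.sum_le_sum fun K' _ => ?_
            by_cases hd : Disjoint (A K \ T) (A K' \ T)
            · rw [hcov0 K K' hd]
              exact Finset.sum_nonneg fun j _ => by split_ifs <;> norm_num
            · obtain ⟨j, hj, hj'⟩ := Finset.not_disjoint_iff.1 hd
              refine (hcov2 K K').trans ?_
              have := Finset.single_le_sum (f := fun j => if j ∈ A K' then (2 : ℝ) else 0)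
                (fun i _ => by split_ifs <;> norm_num) hj
              simpa [(Finset.mem_sdiff.1 hj').1] using this
        _ = ∑ j ∈ A K \ T, 2 * (deg j : ℝ) := by
            rw [Finset.sum_comm]
            refine Finset.sum_congr rfl fun j _ => ?_
            rw [← Finset.sum_filter, Finset.sum_const, nsmul_eq_mul, mul_comm]
        _ ≤ ∑ j ∈ A K \ T, 2 * ((𝓕.card : ℝ) / L) := by
            refine Finset.sum_le_sum fun j hj => ?_
            have hj2 : L * deg j ≤ 𝓕.card := by
              have := (Finset.mem_sdiff.1 hj).2
              simp only [hT, Finset.mem_filter, Finset.mem_univ, true_and, not_le] at this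
              exact this.le
            have hL0 : (0 : ℝ) < L := by exact_mod_cast hL
            have : (deg j : ℝ) ≤ 𝓕.card / L := by
              rw [le_div_iff₀ hL0, mul_comm]
              exact_mod_cast hj2
            linarith
        _ ≤ 2 * (D * (𝓕.card / L)) := by
            rw [Finset.sum_const, nsmul_eq_mul]
            have : ((A K \ T).card : ℝ) ≤ D := by
              exact_mod_cast (Finset.card_le_card Finset.sdiff_subset).trans (hA K hK)
            have h0 : (0 : ℝ) ≤ 𝓕.card / L := by positivity
            nlinarith
    have hexp : ∀ x, ((∑ K ∈ 𝓕, u K x) / 𝓕.card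
        - cubeAvg (fun x => (∑ K ∈ 𝓕, u K x) / 𝓕.card)) ^ 2
        = (∑ K ∈ 𝓕, ∑ K' ∈ 𝓕, v K x * v K' x) / (𝓕.card : ℝ) ^ 2 := by
      intro x
      have h1 : cubeAvg (fun x => (∑ K ∈ 𝓕, u K x) / (𝓕.card : ℝ))
          = (∑ K ∈ 𝓕, cubeAvg (u K)) / 𝓕.card := by
        simp only [div_eq_mul_inv, cubeAvg_mul_const, cubeAvg_sum]
      rw [h1, ← sub_div, ← Finset.sum_sub_distrib, div_pow, sq (∑ K ∈ 𝓕, _), Finset.sum_mul_sum]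
    change cubeAvg (fun x => ((∑ K ∈ 𝓕, u K x) / 𝓕.card
        - cubeAvg (fun x => (∑ K ∈ 𝓕, u K x) / 𝓕.card)) ^ 2) ≤ _
    simp only [hexp]
    simp only [div_eq_mul_inv, cubeAvg_mul_const, cubeAvg_sum]
    rw [← div_eq_mul_inv, ← div_eq_mul_inv, div_le_iff₀ (by positivity)]
    calc _ ≤ ∑ K ∈ 𝓕, 2 * (D * ((𝓕.card : ℝ) / L)) := Finset.sum_le_sum hrow
      _ = _ := by rw [Finset.sum_const, nsmul_eq_mul]; ring

/-- Markov's inequality for a squared deviation. -/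
lemma half_le_cubeAvg_of_variance {β : ℝ} (hβ : 0 < β) (W : (Fin m → Bool) → ℝ)
    (hmean : β ≤ cubeAvg W) (hvar : cubeAvg (fun x => (W x - cubeAvg W) ^ 2) ≤ β ^ 2 / 8) :
    1 / 2 ≤ cubeAvg (fun x => if β / 2 ≤ W x then (1 : ℝ) else 0) := by
  have h : ∀ x, 1 - (4 / β ^ 2) * (W x - cubeAvg W) ^ 2 ≤ if β / 2 ≤ W x then (1 : ℝ) else 0 := by
    intro x
    split_ifs with hx
    · have : 0 ≤ (4 / β ^ 2) * (W x - cubeAvg W) ^ 2 := by positivity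
      linarith
    · push Not at hx
      have h1 : (β / 2) ^ 2 ≤ (W x - cubeAvg W) ^ 2 := by nlinarith
      have h2 : (4 / β ^ 2) * (β / 2) ^ 2 = 1 := by field_simp; norm_num
      have h3 : (4 / β ^ 2) * (β / 2) ^ 2 ≤ (4 / β ^ 2) * (W x - cubeAvg W) ^ 2 := by gcongr
      linarith
  refine le_trans ?_ (cubeAvg_mono h)
  rw [cubeAvg_sub, cubeAvg_const, cubeAvg_const_mul]
  have h1 : (4 / β ^ 2) * cubeAvg (fun x => (W x - cubeAvg W) ^ 2) ≤ (4 / β ^ 2) * (β ^ 2 / 8) := by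
    gcongr
  have h2 : (4 / β ^ 2) * (β ^ 2 / 8) = 1 / 2 := by field_simp; norm_num
  linarith

/-- If many degree-`k` characters have nonzero bias under a local `f`, a bounded number of queries
exposes their biases simultaneously. -/
lemma IsLocal.exists_queries_of_bias {d k L : ℕ} {f : (Fin m → Bool) → (Fin n → Bool)}
    (hf : IsLocal d f) {𝓕 : Finset (Finset (Fin n))} (h𝓕 : 𝓕.Nonempty)
    (hk : ∀ K ∈ 𝓕, K.card = k) (hb : ∀ K ∈ 𝓕, cubeAvg (fun x => walsh K (f x)) ≠ 0)
    {β : ℝ} (hβ : 0 < β) (hβk : β ≤ ((2 : ℝ) ^ (d * k))⁻¹ / 2) (hL : 0 < L)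
    (hLβ : 2 * ((d * k : ℕ) : ℝ) / L ≤ β ^ 2 / 8) :
    ∃ (s : Finset (Fin n) → ℝ) (T : Finset (Fin m)), (∀ K, |s K| = 1) ∧ T.card ≤ d * k * L ∧
      β ≤ cubeAvg (fun σ => if β ≤ cubeAvg (fun x => signedAvg 𝓕 s (f (overwrite T σ x)))
        then (1 : ℝ) else 0) ∧
      ∀ σ, β ≤ cubeAvg (fun x => signedAvg 𝓕 s (f (overwrite T σ x))) →
        1 / 2 ≤ cubeAvg (fun x => if β / 2 ≤ signedAvg 𝓕 s (f (overwrite T σ x))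
          then (1 : ℝ) else 0) := by
  have hc : (0 : ℝ) < 𝓕.card := by exact_mod_cast h𝓕.card_pos
  obtain ⟨A, hA⟩ := hf.exists_dependsOnlyOn_walsh
  set s : Finset (Fin n) → ℝ := fun K => if 0 ≤ cubeAvg (fun x => walsh K (f x)) then 1 else -1
    with hs
  have hs1 : ∀ K, |s K| = 1 := by
    intro K; simp only [hs]; split_ifs <;> simp
  have hsabs : ∀ K, s K * cubeAvg (fun x => walsh K (f x)) = |cubeAvg (fun x => walsh K (f x))| := by
    intro K
    simp only [hs]
    split_ifs with h
    · rw [abs_of_nonneg h, one_mul]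
    · rw [abs_of_neg (not_le.1 h), neg_one_mul]
  obtain ⟨T, hT, hvar⟩ := exists_junta_variance_le (D := d * k) hL h𝓕
    (fun K x => s K * walsh K (f x)) (fun K x => by rw [abs_mul, hs1, abs_walsh, one_mul]) A
    (fun K hK => by rw [← hk K hK]; exact (hA K).1)
    (fun K x y hxy => by have := (hA K).2 x y hxy; simp only at this ⊢; rw [this])
  refine ⟨s, T, hs1, hT, ?_, fun σ hσ => ?_⟩
  · have hle1 : ∀ y, signedAvg 𝓕 s y ≤ 1 := by
      intro y
      rw [signedAvg, div_le_one hc]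
      calc ∑ K ∈ 𝓕, s K * walsh K y ≤ ∑ K ∈ 𝓕, (1 : ℝ) := Finset.sum_le_sum fun K _ =>
            (le_abs_self _).trans (by rw [abs_mul, hs1, abs_walsh, one_mul])
        _ = 𝓕.card := by simp
    have hmean : 2 * β ≤ cubeAvg (fun x => signedAvg 𝓕 s (f x)) := by
      simp only [signedAvg, div_eq_mul_inv, cubeAvg_mul_const, cubeAvg_sum, cubeAvg_const_mul, hsabs]
      rw [← div_eq_mul_inv, le_div_iff₀ hc]
      calc 2 * β * 𝓕.card = ∑ K ∈ 𝓕, 2 * β := by rw [Finset.sum_const, nsmul_eq_mul, mul_comm]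
        _ ≤ _ := Finset.sum_le_sum fun K hK => by
          have := hf.le_abs_cubeAvg_walsh (hb K hK)
          rw [hk K hK] at this
          linarith
    rw [← cubeAvg_overwrite T] at hmean
    have hmono : cubeAvg (fun σ => cubeAvg fun x => signedAvg 𝓕 s (f (overwrite T σ x)))
        ≤ cubeAvg (fun σ => (if β ≤ cubeAvg (fun x => signedAvg 𝓕 s (f (overwrite T σ x)))
          then (1 : ℝ) else 0) + β) := by
      refine cubeAvg_mono fun σ => ?_
      split_ifs with h
      · have : cubeAvg (fun x => signedAvg 𝓕 s (f (overwrite T σ x))) ≤ 1 := by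
          rw [← cubeAvg_const (m := m) (1 : ℝ)]
          exact cubeAvg_mono fun x => hle1 _
        linarith
      · linarith [not_le.1 h]
    rw [cubeAvg_add, cubeAvg_const] at hmono
    linarith
  · exact half_le_cubeAvg_of_variance hβ _ hσ ((hvar σ).trans (by exact_mod_cast hLβ))

end Rounds

/-- The sum of the signs of a Boolean string. -/
def signSum {n : ℕ} (y : Fin n → Bool) : ℝ := ∑ i, boolSign (y i)

/-- The elementary symmetric polynomial of degree `k` in the signs of a Boolean string. -/
def elemSym {n : ℕ} (k : ℕ) (y : Fin n → Bool) : ℝ :=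
  ∑ K ∈ Finset.powersetCard k Finset.univ, walsh K y

section Symmetric

variable {m n : ℕ}

lemma signSum_eq (y : Fin n → Bool) : signSum y = n - 2 * hw y := by
  have h : ∀ i, boolSign (y i) = 1 - 2 * (if y i = true then (1 : ℝ) else 0) := by
    intro i; cases y i <;> norm_num [boolSign]
  simp only [signSum, h, Finset.sum_sub_distrib, ← Finset.mul_sum, hw, Finset.card_filter]
  simp

lemma walsh_univ (y : Fin n → Bool) : walsh Finset.univ y = (-1) ^ hw y := by
  simp [walsh, boolSign, hw, Finset.prod_ite]

lemma sum_walsh_powersetCard_insert {s : Finset (Fin n)} {i : Fin n} (hi : i ∉ s) (k : ℕ)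
    (y : Fin n → Bool) :
    ∑ K ∈ Finset.powersetCard (k + 1) (insert i s), walsh K y =
      ∑ K ∈ Finset.powersetCard (k + 1) s, walsh K y +
        boolSign (y i) * ∑ K ∈ Finset.powersetCard k s, walsh K y := by
  have hnot : ∀ j, ∀ K ∈ Finset.powersetCard j s, i ∉ K := fun j K hK h =>
    hi ((Finset.mem_powersetCard.1 hK).1 h)
  rw [Finset.powersetCard_succ_insert hi, Finset.sum_union, Finset.sum_image, Finset.mul_sum]
  · congr 1
    refine Finset.sum_congr rfl fun K hK => ?_
    rw [walsh, Finset.prod_insert (hnot k K hK), walsh]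
  · intro K hK K' hK' h
    rw [← Finset.erase_insert (hnot k K hK), ← Finset.erase_insert (hnot k K' hK')]
    exact congrArg (fun S => Finset.erase S i) h
  · rw [Finset.disjoint_left]
    intro K hK hK'
    obtain ⟨K₀, _, rfl⟩ := Finset.mem_image.1 hK'
    exact hnot _ _ hK (Finset.mem_insert_self _ _)

lemma sum_boolSign_mul_sum_walsh (s : Finset (Fin n)) (y : Fin n → Bool) : ∀ k : ℕ,
    (∑ i ∈ s, boolSign (y i)) * ∑ K ∈ Finset.powersetCard (k + 1) s, walsh K y =
      (k + 2) * ∑ K ∈ Finset.powersetCard (k + 2) s, walsh K y +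
        (s.card - k) * ∑ K ∈ Finset.powersetCard k s, walsh K y := by
  induction s using Finset.induction_on with
  | empty =>
    intro k
    have h : ∀ j, Finset.powersetCard (j + 1) (∅ : Finset (Fin n)) = ∅ := fun j =>
      Finset.powersetCard_eq_empty.2 (by simp)
    rcases k with _ | k
    · simp only [h, Finset.sum_empty, Finset.card_empty]; simp
    · simp only [h, Finset.sum_empty]; simp
  | insert i s hi ih =>
    have hone : (∑ i ∈ s, boolSign (y i)) * ∑ K ∈ Finset.powersetCard 0 s, walsh K y
        = ∑ K ∈ Finset.powersetCard 1 s, walsh K y := by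
      rw [Finset.powersetCard_zero, Finset.sum_singleton, walsh_empty, mul_one,
        Finset.powersetCard_one, Finset.sum_map]
      exact Finset.sum_congr rfl fun j _ => by simp [walsh]
    intro k
    have hz := boolSign_mul_self (y i)
    rw [Finset.sum_insert hi, sum_walsh_powersetCard_insert hi k,
      sum_walsh_powersetCard_insert hi (k + 1), Finset.card_insert_of_notMem hi]
    have hk := ih k
    rcases k with _ | k
    · simp only [Finset.powersetCard_zero, Finset.sum_singleton] at *
      push_cast at *
      linear_combination hk + boolSign (y i) * hone + hz * walsh ∅ y
    · rw [sum_walsh_powersetCard_insert hi k]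
      have hk' := ih k
      push_cast at *
      linear_combination hk + boolSign (y i) * hk' +
        hz * ∑ K ∈ Finset.powersetCard (k + 1) s, walsh K y

lemma elemSym_zero (y : Fin n → Bool) : elemSym 0 y = 1 := by simp [elemSym, walsh_empty]

lemma elemSym_one (y : Fin n → Bool) : elemSym 1 y = signSum y := by
  rw [elemSym, Finset.powersetCard_one, Finset.sum_map, signSum]
  exact Finset.sum_congr rfl fun j _ => by simp [walsh]

lemma signSum_mul_elemSym (k : ℕ) (y : Fin n → Bool) :
    signSum y * elemSym (k + 1) y = (k + 2) * elemSym (k + 2) y + (n - k) * elemSym k y := by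
  have h := sum_boolSign_mul_sum_walsh Finset.univ y k
  rw [Finset.card_univ, Fintype.card_fin] at h
  exact h

lemma abs_elemSym_le (y : Fin n → Bool) : ∀ k : ℕ, |elemSym k y| ≤ (√n + |signSum y|) ^ k
  | 0 => by simp [elemSym_zero]
  | 1 => by rw [elemSym_one, pow_one]; linarith [Real.sqrt_nonneg (n : ℝ)]
  | k + 2 => by
      have ha := Real.sqrt_nonneg (n : ℝ)
      have ha2 := Real.sq_sqrt (Nat.cast_nonneg (α := ℝ) n)
      have hz := abs_nonneg (signSum y)
      by_cases hk : k ≤ n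
      · have h := signSum_mul_elemSym k y
        have h1 := abs_elemSym_le y k
        have h2 := abs_elemSym_le y (k + 1)
        have hkn : (k : ℝ) ≤ n := by exact_mod_cast hk
        have h3 : (k + 2) * |elemSym (k + 2) y| ≤
            |signSum y| * |elemSym (k + 1) y| + (n - k) * |elemSym k y| := by
          have : ((k : ℝ) + 2) * elemSym (k + 2) y =
              signSum y * elemSym (k + 1) y - (n - k) * elemSym k y := by linarith
          rw [← abs_of_pos (by positivity : (0 : ℝ) < k + 2), ← abs_mul, this]
          refine (abs_sub _ _).trans ?_
          rw [abs_mul, abs_mul, abs_of_nonneg (by linarith : (0 : ℝ) ≤ n - k)]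
        have h4 : |elemSym (k + 2) y| ≤ (k + 2) * |elemSym (k + 2) y| := by
          nlinarith [abs_nonneg (elemSym (k + 2) y), Nat.cast_nonneg (α := ℝ) k]
        set p := (√n + |signSum y|) ^ k with hp
        have hp0 : 0 ≤ p := by positivity
        rw [pow_succ, ← hp] at h2
        calc |elemSym (k + 2) y| ≤ |signSum y| * (p * (√n + |signSum y|)) + n * p := by
              refine h4.trans (h3.trans (add_le_add (mul_le_mul_of_nonneg_left h2 hz) ?_))
              exact mul_le_mul (by linarith [Nat.cast_nonneg (α := ℝ) k]) h1 (abs_nonneg _)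
                (by positivity)
          _ ≤ p * (√n + |signSum y|) ^ 2 := by
              have : 0 ≤ p * (√n * |signSum y|) := by positivity
              have h5 : (n : ℝ) * p = √n ^ 2 * p := by rw [ha2]
              rw [h5]
              nlinarith
          _ = (√n + |signSum y|) ^ (k + 2) := by rw [hp, pow_add]
      · rw [elemSym, Finset.powersetCard_eq_empty.2 (by simp; omega)]
        simp only [Finset.sum_empty, abs_zero]
        positivity

lemma abs_elemSym_le_choose (k : ℕ) (y : Fin n → Bool) : |elemSym k y| ≤ n.choose k := by
  refine (Finset.abs_sum_le_sum_abs _ _).trans ?_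
  simp [abs_walsh]

lemma card_hw_eq (k : ℕ) :
    (Finset.univ.filter fun y : Fin n → Bool => hw y = k).card = n.choose k := by
  have : (Finset.powersetCard k (Finset.univ : Finset (Fin n))).card = n.choose k := by simp
  rw [← this]
  refine Finset.card_bij' (fun y _ => Finset.univ.filter fun i => y i = true)
    (fun S _ => indicatorString S) ?_ ?_ ?_ ?_
  · intro y hy
    exact Finset.mem_powersetCard.2 ⟨Finset.subset_univ _, (Finset.mem_filter.1 hy).2⟩
  · intro S hS
    refine Finset.mem_filter.2 ⟨Finset.mem_univ _, ?_⟩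
    rw [← (Finset.mem_powersetCard.1 hS).2]
    simp [hw, indicatorString]
  · intro y _; funext i; simp [indicatorString]
  · intro S _; ext i; simp [indicatorString]

lemma hw_comp_perm (e : Equiv.Perm (Fin n)) (y : Fin n → Bool) : hw (fun i => y (e i)) = hw y := by
  unfold hw
  refine Finset.card_bij (fun i _ => e i) ?_ ?_ ?_
  · intro i hi; simpa using hi
  · intro i _ j _ h; exact e.injective h
  · intro j hj; exact ⟨e.symm j, by simpa using hj, by simp⟩

lemma sum_walsh_eq_of_card_eq (Ψ : Finset ℕ) {S T : Finset (Fin n)} (h : S.card = T.card) :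
    ∑ y ∈ Finset.univ.filter (fun y : Fin n → Bool => hw y ∈ Ψ), walsh S y =
      ∑ y ∈ Finset.univ.filter (fun y : Fin n → Bool => hw y ∈ Ψ), walsh T y := by
  let e : Equiv.Perm (Fin n) := (Finset.equivOfCardEq h).extendSubtype
  have he : ∀ i, e i ∈ T ↔ i ∈ S := fun i =>
    ⟨fun hi => by_contra fun hc => (Finset.equivOfCardEq h).extendSubtype_not_mem i hc hi,
      fun hi => (Finset.equivOfCardEq h).extendSubtype_mem i hi⟩
  refine Finset.sum_bij' (fun y _ => fun i => y (e.symm i)) (fun y _ => fun i => y (e i)) ?_ ?_ ?_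
    ?_ ?_
  · intro y hy
    have := hw_comp_perm e.symm y
    simpa [this] using hy
  · intro y hy
    have := hw_comp_perm e y
    simpa [this] using hy
  · intro y _; funext i; simp
  · intro y _; funext i; simp
  · intro y _
    refine Finset.prod_bij (fun i _ => e i) ?_ ?_ ?_ ?_
    · intro i hi; exact (he i).2 hi
    · intro i _ j _ h; exact e.injective h
    · intro j hj; exact ⟨e.symm j, (he _).1 (by simpa using hj), by simp⟩
    · intro i _; simp

lemma choose_mul_sum_walsh (Ψ : Finset ℕ) (T : Finset (Fin n)) :
    (n.choose T.card : ℝ) * ∑ y ∈ Finset.univ.filter (fun y : Fin n → Bool => hw y ∈ Ψ), walsh T y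
      = ∑ y ∈ Finset.univ.filter (fun y : Fin n → Bool => hw y ∈ Ψ), elemSym T.card y := by
  simp only [elemSym]
  rw [Finset.sum_comm, Finset.sum_congr rfl fun K hK =>
    sum_walsh_eq_of_card_eq Ψ (Finset.mem_powersetCard.1 hK).2]
  simp

lemma cubeAvg_exp_signSum (t : ℝ) :
    cubeAvg (fun y : Fin n → Bool => Real.exp (t * signSum y)) = Real.cosh t ^ n := by
  have h : ∀ y : Fin n → Bool, Real.exp (t * signSum y) = ∏ i, Real.exp (t * boolSign (y i)) := by
    intro y
    rw [signSum, Finset.mul_sum, Real.exp_sum]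
  simp only [cubeAvg, h]
  rw [← Fintype.sum_pow (fun b => Real.exp (t * boolSign b)) n, ← div_pow]
  congr 1
  rw [Fintype.sum_bool, Real.cosh_eq]
  simp [boolSign, add_comm]

lemma cubeAvg_exp_signSum_le (t : ℝ) :
    cubeAvg (fun y : Fin n → Bool => Real.exp (t * signSum y)) ≤ Real.exp (n * (t ^ 2 / 2)) := by
  rw [cubeAvg_exp_signSum, Real.exp_nat_mul]
  exact pow_le_pow_left₀ (Real.cosh_pos t).le (Real.cosh_le_exp_half_sq t) n

/-- Hoeffding's bound for the uniform distribution. -/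
lemma card_lt_abs_signSum_le {t : ℝ} (ht : 0 ≤ t) :
    ((Finset.univ.filter fun y : Fin n → Bool => t * n < |signSum y|).card : ℝ) ≤
      2 ^ n * (2 * Real.exp (-(n * (t ^ 2 / 2)))) := by
  have h : ∀ y : Fin n → Bool, (if t * n < |signSum y| then (1 : ℝ) else 0) ≤
      Real.exp (-(n * t ^ 2)) * (Real.exp (t * signSum y) + Real.exp ((-t) * signSum y)) := by
    intro y
    split_ifs with hy
    · rw [mul_add, ← Real.exp_add, ← Real.exp_add]
      rcases abs_cases (signSum y) with ⟨h1, _⟩ | ⟨h1, _⟩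
      · have : 1 ≤ Real.exp (-(n * t ^ 2) + t * signSum y) := Real.one_le_exp (by rw [h1] at hy; nlinarith)
        linarith [Real.exp_pos (-(n * t ^ 2) + -t * signSum y)]
      · have : 1 ≤ Real.exp (-(n * t ^ 2) + -t * signSum y) := Real.one_le_exp (by rw [h1] at hy; nlinarith)
        linarith [Real.exp_pos (-(n * t ^ 2) + t * signSum y)]
    · positivity
  have h1 := cubeAvg_mono h
  rw [cubeAvg_const_mul, cubeAvg_add] at h1
  have h2 := cubeAvg_exp_signSum_le (n := n) t
  have h3 := cubeAvg_exp_signSum_le (n := n) (-t)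
  rw [neg_sq] at h3
  have h4 : Real.exp (-(n * t ^ 2)) * Real.exp (n * (t ^ 2 / 2)) = Real.exp (-(n * (t ^ 2 / 2))) := by
    rw [← Real.exp_add]; congr 1; ring
  have h5 : cubeAvg (fun y : Fin n → Bool => if t * n < |signSum y| then (1 : ℝ) else 0) ≤
      2 * Real.exp (-(n * (t ^ 2 / 2))) := by
    refine h1.trans ?_
    rw [← h4]
    nlinarith [Real.exp_pos (-(n * t ^ 2))]
  rw [cubeAvg, div_le_iff₀ (by positivity), Finset.sum_boole] at h5
  linarith

lemma choose_half_le_two_pow_mul_choose (n : ℕ) : ∀ j s : ℕ, s + j = n / 2 → n ≤ 3 * s + 2 →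
    n.choose (n / 2) ≤ 2 ^ j * n.choose s
  | 0, s, hs, _ => by simp [← hs]
  | j + 1, s, hs, hn => by
      have h := choose_half_le_two_pow_mul_choose n j (s + 1) (by omega) (by omega)
      have h1 := Nat.choose_succ_right_eq n s
      have h2 : n.choose (s + 1) ≤ 2 * n.choose s := by
        have h3 : n - s ≤ 2 * (s + 1) := by omega
        have h4 : n.choose (s + 1) * (s + 1) ≤ (2 * n.choose s) * (s + 1) := by
          rw [h1]
          calc n.choose s * (n - s) ≤ n.choose s * (2 * (s + 1)) := Nat.mul_le_mul_left _ h3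
            _ = _ := by ring
        exact Nat.le_of_mul_le_mul_right h4 (by omega)
      calc n.choose (n / 2) ≤ 2 ^ j * n.choose (s + 1) := h
        _ ≤ 2 ^ j * (2 * n.choose s) := Nat.mul_le_mul_left _ h2
        _ = _ := by rw [pow_succ]; ring

lemma two_pow_le_mul_choose {n s : ℕ} {c : ℝ} (hc : c ≤ 1 / 8) (hsn : s ≤ n)
    (hs : |(s : ℝ) - n / 2| ≤ c * n) :
    (2 : ℝ) ^ n ≤ (n + 1) * (Real.exp (c * n) * n.choose s) := by
  have h1 : 2 ^ n ≤ (n + 1) * n.choose (n / 2) := by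
    rw [← Nat.sum_range_choose]
    calc _ ≤ ∑ _k ∈ Finset.range (n + 1), n.choose (n / 2) :=
          Finset.sum_le_sum fun k _ => Nat.choose_le_middle k n
      _ = _ := by simp
  have key : ∀ s : ℕ, s ≤ n / 2 → |(s : ℝ) - n / 2| ≤ c * n →
      (n.choose (n / 2) : ℝ) ≤ Real.exp (c * n) * n.choose s := by
    intro s hs2 hs
    have hs3 := neg_le_of_abs_le hs
    have hn0 := Nat.cast_nonneg (α := ℝ) n
    have h2 : n ≤ 3 * s + 2 := by
      have : (n : ℝ) ≤ 3 * s + 2 := by nlinarith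
      exact_mod_cast this
    have h3 := choose_half_le_two_pow_mul_choose n (n / 2 - s) s (by omega) h2
    have h4 : ((n / 2 - s : ℕ) : ℝ) ≤ c * n := by
      rw [Nat.cast_sub hs2]
      have : ((n / 2 : ℕ) : ℝ) ≤ n / 2 := Nat.cast_div_le
      linarith
    have h5 : (2 : ℝ) ^ (n / 2 - s) ≤ Real.exp (c * n) := by
      refine le_trans ?_ (Real.exp_le_exp.2 h4)
      rw [← mul_one ((n / 2 - s : ℕ) : ℝ), Real.exp_nat_mul]
      refine pow_le_pow_left₀ (by norm_num) ?_ _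
      linarith [Real.add_one_le_exp (1 : ℝ)]
    calc (n.choose (n / 2) : ℝ) ≤ 2 ^ (n / 2 - s) * n.choose s := by exact_mod_cast h3
      _ ≤ _ := by gcongr
  have h6 : (n.choose (n / 2) : ℝ) ≤ Real.exp (c * n) * n.choose s := by
    rcases le_or_gt s (n / 2) with h | h
    · exact key s h hs
    · rw [← Nat.choose_symm hsn]
      refine key (n - s) (by omega) ?_
      rw [Nat.cast_sub hsn, abs_sub_comm]
      convert hs using 2
      ring
  calc (2 : ℝ) ^ n ≤ (n + 1) * n.choose (n / 2) := by exact_mod_cast h1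
    _ ≤ _ := by gcongr

end Symmetric

section WeightDistribution

variable {n : ℕ}

lemma DPsi_nonneg (Ψ : Finset ℕ) (y : Fin n → Bool) : 0 ≤ DPsi n Ψ y := by
  unfold DPsi unifOn
  split_ifs <;> positivity

lemma sum_DPsi_mul (Ψ : Finset ℕ) (F : (Fin n → Bool) → ℝ) :
    ∑ y, DPsi n Ψ y * F y =
      (((Finset.univ.filter fun y : Fin n → Bool => hw y ∈ Ψ).card : ℝ))⁻¹ *
        ∑ y ∈ Finset.univ.filter (fun y : Fin n → Bool => hw y ∈ Ψ), F y := by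
  rw [Finset.mul_sum, Finset.sum_filter]
  refine Finset.sum_congr rfl fun y _ => ?_
  simp only [DPsi, unifOn, Finset.mem_filter, Finset.mem_univ, true_and]
  split_ifs <;> simp

lemma choose_le_card_hw_mem {Ψ : Finset ℕ} {s : ℕ} (hs : s ∈ Ψ) :
    n.choose s ≤ (Finset.univ.filter fun y : Fin n → Bool => hw y ∈ Ψ).card := by
  rw [← card_hw_eq]
  refine Finset.card_le_card fun y hy => ?_
  simp only [Finset.mem_filter, Finset.mem_univ, true_and] at hy ⊢
  rwa [hy]

lemma abs_elemSym_div_choose_le {r j : ℕ} (hj : j ≠ 0) (hjr : j ≤ r) {t : ℝ} (ht : 0 < t)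
    (htr : 4 * t * r ≤ 1) (hn : 2 * r ≤ n) (hnt : √n ≤ t * n) {y : Fin n → Bool}
    (hy : |signSum y| ≤ t * n) : |elemSym j y| ≤ (4 * t * r) * n.choose j := by
  have h1 : |elemSym j y| ≤ (2 * t * n) ^ j := (abs_elemSym_le y j).trans
    (pow_le_pow_left₀ (by positivity) (by linarith) _)
  have h2 : ((n + 1 - j : ℕ) ^ j : ℝ) / j.factorial ≤ n.choose j := Nat.pow_le_choose j n
  have hr0 : 0 < r := by omega
  have hn0 : (0 : ℝ) < n := by
    have : 0 < n := by omega
    exact_mod_cast this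
  have hr0' : (0 : ℝ) < r := by exact_mod_cast hr0
  have h3 : ((n : ℝ) / (2 * r)) ^ j ≤ n.choose j := by
    refine le_trans ?_ h2
    have h4 : (j.factorial : ℝ) ≤ r ^ j := by
      have : j.factorial ≤ r ^ j := (Nat.factorial_le_pow j).trans (Nat.pow_le_pow_left hjr j)
      exact_mod_cast this
    have h5 : (n : ℝ) / 2 ≤ (n + 1 - j : ℕ) := by
      rw [Nat.cast_sub (by omega)]
      have : (j : ℝ) ≤ r := by exact_mod_cast hjr
      have : (2 : ℝ) * r ≤ n := by exact_mod_cast hn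
      push_cast
      linarith
    rw [← div_div, div_pow]
    gcongr
  have h6 : (4 * t * r) ^ j ≤ 4 * t * r := pow_le_of_le_one (by positivity) htr hj
  calc |elemSym j y| ≤ (2 * t * n) ^ j := h1
    _ = (4 * t * r) ^ j * (n / (2 * r)) ^ j := by
        rw [← mul_pow]; congr 1; field_simp; norm_num
    _ ≤ _ := by gcongr

/-- Bounded-degree characters have small bias under the uniform distribution on a union of weight
levels that includes a central one. -/
theorem exists_abs_sum_DPsi_mul_walsh_le (r : ℕ) (ε : ℝ) (hε : 0 < ε) :
    ∃ c : ℝ, 0 < c ∧ ∃ N : ℕ, ∀ n : ℕ, N ≤ n → ∀ Ψ : Finset ℕ, Ψ ⊆ Finset.range (n + 1) →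
      (∃ s ∈ Ψ, |(s : ℝ) - n / 2| ≤ c * n) →
      ∀ T : Finset (Fin n), T.Nonempty → T.card ≤ r → |∑ y, DPsi n Ψ y * walsh T y| ≤ ε := by
  obtain ⟨t, ht0, ht1, ht2⟩ : ∃ t : ℝ, 0 < t ∧ 4 * t * r ≤ 1 ∧ 4 * t * r ≤ ε / 2 := by
    refine ⟨min 1 (ε / 2) / (4 * r + 1), by positivity, ?_, ?_⟩
    all_goals
      have h0 : (0 : ℝ) ≤ min 1 (ε / 2) := by positivity
      have h1 : 4 * (min 1 (ε / 2) / (4 * r + 1)) * r ≤ min 1 (ε / 2) := by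
        have : (4 * (r : ℝ)) / (4 * r + 1) ≤ 1 := by
          rw [div_le_one (by positivity)]; linarith
        calc 4 * (min 1 (ε / 2) / (4 * r + 1)) * r
            = min 1 (ε / 2) * ((4 * (r : ℝ)) / (4 * r + 1)) := by ring
          _ ≤ _ := mul_le_of_le_one_right h0 this
    · exact h1.trans (min_le_left _ _)
    · exact h1.trans (min_le_right _ _)
  set c : ℝ := min (1 / 8) (t ^ 2 / 4) with hc
  have hc0 : 0 < c := by positivity
  have hlim : Filter.Tendsto (fun n : ℕ => ((n : ℝ) + 1) * (2 * Real.exp (-(t ^ 2 / 4 * n))))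
      Filter.atTop (nhds 0) := by
    have hb : 0 < t ^ 2 / 4 := by positivity
    have h0 : Filter.Tendsto (fun n : ℕ => t ^ 2 / 4 * (n : ℝ)) Filter.atTop Filter.atTop :=
      Filter.Tendsto.const_mul_atTop hb tendsto_natCast_atTop_atTop
    have h1 := (Real.tendsto_pow_mul_exp_neg_atTop_nhds_zero 1).comp h0
    have h2 := (Real.tendsto_pow_mul_exp_neg_atTop_nhds_zero 0).comp h0
    have h3 := (h1.const_mul (2 / (t ^ 2 / 4))).add (h2.const_mul 2)
    simp only [mul_zero, add_zero] at h3
    refine h3.congr fun n => ?_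
    simp only [Function.comp, pow_one, pow_zero]
    field_simp
  have hev : ∀ᶠ n : ℕ in Filter.atTop,
      ((n : ℝ) + 1) * (2 * Real.exp (-(t ^ 2 / 4 * n))) < ε / 2 :=
    hlim.eventually_lt_const (by positivity)
  obtain ⟨N₁, hN₁⟩ := Filter.eventually_atTop.1 hev
  obtain ⟨N₂, hN₂⟩ := exists_nat_ge (1 / t ^ 2)
  refine ⟨c, hc0, max N₁ (max N₂ (2 * r)), fun n hn Ψ hΨ hs T hT hTr => ?_⟩
  obtain ⟨s, hsΨ, hs⟩ := hs
  have hsn : s ≤ n := by have := Finset.mem_range.1 (hΨ hsΨ); omega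
  have hn1 := hN₁ n (by omega)
  have hn2 : 1 / t ^ 2 ≤ n := hN₂.trans (by exact_mod_cast (by omega : N₂ ≤ n))
  have hn3 : 2 * r ≤ n := by omega
  have hnt : √n ≤ t * n := by
    rw [Real.sqrt_le_left (by positivity)]
    rw [div_le_iff₀ (by positivity)] at hn2
    nlinarith [Nat.cast_nonneg (α := ℝ) n]
  set A := Finset.univ.filter fun y : Fin n → Bool => hw y ∈ Ψ with hA
  have hchs : (0 : ℝ) < n.choose s := by exact_mod_cast Nat.choose_pos hsn
  have hAs : (n.choose s : ℝ) ≤ A.card := by exact_mod_cast choose_le_card_hw_mem hsΨ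
  have hA0 : (0 : ℝ) < A.card := hchs.trans_le hAs
  have hTn : T.card ≤ n := by simpa using Finset.card_le_univ T
  have hch : (0 : ℝ) < n.choose T.card := by exact_mod_cast Nat.choose_pos hTn
  have hpt : ∀ y : Fin n → Bool, |elemSym T.card y| ≤
      (ε / 2 + if t * n < |signSum y| then 1 else 0) * n.choose T.card := by
    intro y
    split_ifs with hy
    · have := abs_elemSym_le_choose T.card y
      nlinarith
    · rw [add_zero]
      refine (abs_elemSym_div_choose_le hT.card_pos.ne' hTr ht0 ht1 hn3 hnt (not_lt.1 hy)).trans ?_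
      gcongr
  have hsum : |∑ y ∈ A, elemSym T.card y| ≤ (ε / 2 * A.card + (Finset.univ.filter
      fun y : Fin n → Bool => t * n < |signSum y|).card) * n.choose T.card := by
    refine (Finset.abs_sum_le_sum_abs _ _).trans ((Finset.sum_le_sum fun y _ => hpt y).trans ?_)
    rw [← Finset.sum_mul, Finset.sum_add_distrib, Finset.sum_const, nsmul_eq_mul, Finset.sum_boole]
    have : ((A.filter fun y => t * n < |signSum y|).card : ℝ) ≤
        (Finset.univ.filter fun y : Fin n → Bool => t * n < |signSum y|).card := by
      exact_mod_cast Finset.card_le_card (Finset.filter_subset_filter _ (Finset.subset_univ _))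
    rw [mul_comm (A.card : ℝ)]
    gcongr
  have htail : ((Finset.univ.filter fun y : Fin n → Bool => t * n < |signSum y|).card : ℝ) ≤
      ε / 2 * A.card := by
    refine (card_lt_abs_signSum_le ht0.le).trans ?_
    have h1 := two_pow_le_mul_choose (min_le_left _ _ : c ≤ 1 / 8) hsn hs
    have hexp : Real.exp (c * n) * Real.exp (-(n * (t ^ 2 / 2))) ≤ Real.exp (-(t ^ 2 / 4 * n)) := by
      rw [← Real.exp_add, Real.exp_le_exp]
      have : c * n ≤ t ^ 2 / 4 * n := by gcongr; exact min_le_right _ _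
      linarith
    calc (2 : ℝ) ^ n * (2 * Real.exp (-(n * (t ^ 2 / 2))))
        ≤ ((n + 1) * (Real.exp (c * n) * n.choose s)) * (2 * Real.exp (-(n * (t ^ 2 / 2)))) := by
          gcongr
      _ = ((n + 1) * n.choose s * 2) * (Real.exp (c * n) * Real.exp (-(n * (t ^ 2 / 2)))) := by ring
      _ ≤ ((n + 1) * n.choose s * 2) * Real.exp (-(t ^ 2 / 4 * n)) := by gcongr
      _ = ((n + 1) * (2 * Real.exp (-(t ^ 2 / 4 * n)))) * n.choose s := by ring
      _ ≤ ε / 2 * A.card := by gcongr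
  rw [← choose_mul_sum_walsh, abs_mul, abs_of_pos hch, mul_comm] at hsum
  have hfin := le_of_mul_le_mul_right hsum hch
  rw [sum_DPsi_mul, abs_mul, abs_of_pos (inv_pos.2 hA0), inv_mul_le_iff₀ hA0]
  linarith

lemma sum_DPsi {Ψ : Finset ℕ} {s : ℕ} (hs : s ∈ Ψ) (hsn : s ≤ n) : ∑ y, DPsi n Ψ y = 1 := by
  have h := sum_DPsi_mul Ψ (fun _ : Fin n → Bool => 1)
  simp only [mul_one, Finset.sum_const, nsmul_eq_mul] at h
  rw [h, inv_mul_cancel₀]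
  have := (Nat.choose_pos hsn).trans_le (choose_le_card_hw_mem (n := n) hs)
  exact_mod_cast this.ne'

end WeightDistribution

/-- The mass function of `f` applied to a uniform input. -/
def law {m n : ℕ} (f : (Fin m → Bool) → (Fin n → Bool)) (y : Fin n → Bool) : ℝ :=
  cubeAvg fun x => if f x = y then 1 else 0

/-- The normalized sign sum. -/
def normSum {n : ℕ} (y : Fin n → Bool) : ℝ := signSum y / √n

/-- Few characters of each degree `1 ≤ k ≤ q` have nonzero bias under `f`. -/
def HasFewBiases {m n : ℕ} (q : ℕ) (δ : ℝ) (f : (Fin m → Bool) → (Fin n → Bool)) : Prop :=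
  ∀ k, 1 ≤ k → k ≤ q → (((Finset.powersetCard k Finset.univ).filter
    fun K : Finset (Fin n) => cubeAvg (fun x => walsh K (f x)) ≠ 0).card : ℝ) ≤ δ * √n ^ k

/-- The low-degree Fourier coefficients of the output parity of `f` are small. -/
def HasSmallParity {m n : ℕ} (r : ℕ) (ε : ℝ) (f : (Fin m → Bool) → (Fin n → Bool)) : Prop :=
  ∀ T : Finset (Fin m), T.Nonempty → T.card ≤ r →
    |walshCoeff (fun x => walsh Finset.univ (f x)) T| ≤ ε

section Moments

variable {m n : ℕ}

lemma law_nonneg (f : (Fin m → Bool) → (Fin n → Bool)) (y : Fin n → Bool) : 0 ≤ law f y :=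
  cubeAvg_nonneg fun x => by split_ifs <;> norm_num

lemma sum_law_mul (f : (Fin m → Bool) → (Fin n → Bool)) (H : (Fin n → Bool) → ℝ) :
    ∑ y, law f y * H y = cubeAvg fun x => H (f x) := by
  simp only [law, ← cubeAvg_mul_const, ← cubeAvg_sum]
  congr 1; funext x
  simp

lemma sum_law (f : (Fin m → Bool) → (Fin n → Bool)) : ∑ y, law f y = 1 := by
  simpa [cubeAvg_const] using sum_law_mul f fun _ => 1

lemma sum_const_mul_eq_cubeAvg (H : (Fin n → Bool) → ℝ) :
    ∑ y, ((2 : ℝ) ^ n)⁻¹ * H y = cubeAvg H := by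
  rw [← Finset.mul_sum, cubeAvg, div_eq_inv_mul]

lemma cubeAvg_normSum_pow_le (hn : 0 < n) (j : ℕ) {t : ℝ} (ht : 0 < t) :
    cubeAvg (fun y : Fin n → Bool => normSum y ^ (2 * j)) ≤
      2 * (2 * j).factorial * Real.exp (t ^ 2 / 2) / t ^ (2 * j) := by
  have hn0 : (0 : ℝ) < n := by exact_mod_cast hn
  have hpt : ∀ y : Fin n → Bool, normSum y ^ (2 * j) ≤ ((2 * j).factorial / t ^ (2 * j)) *
      (Real.exp ((t / √n) * signSum y) + Real.exp ((-(t / √n)) * signSum y)) := by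
    intro y
    have h1 := Real.pow_div_factorial_le_exp _ (abs_nonneg (t * normSum y)) (2 * j)
    have h2 : Real.exp |t * normSum y| ≤
        Real.exp ((t / √n) * signSum y) + Real.exp ((-(t / √n)) * signSum y) := by
      have e1 : (t / √n) * signSum y = t * normSum y := by rw [normSum]; ring
      have e2 : -(t / √n) * signSum y = -(t * normSum y) := by rw [normSum]; ring
      rw [e1, e2]
      rcases abs_cases (t * normSum y) with ⟨h, _⟩ | ⟨h, _⟩
      · rw [h]; linarith [Real.exp_pos (-(t * normSum y))]
      · rw [h]; linarith [Real.exp_pos (t * normSum y)]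
    rw [Even.pow_abs (even_two_mul j), mul_pow] at h1
    have h3 := h1.trans h2
    rw [div_le_iff₀ (by positivity)] at h3
    rw [div_mul_eq_mul_div, le_div_iff₀ (by positivity)]
    linarith
  refine (cubeAvg_mono hpt).trans ?_
  rw [cubeAvg_const_mul, cubeAvg_add]
  have h1 := cubeAvg_exp_signSum_le (n := n) (t / √n)
  have h2 := cubeAvg_exp_signSum_le (n := n) (-(t / √n))
  have h3 : (n : ℝ) * ((t / √n) ^ 2 / 2) = t ^ 2 / 2 := by
    rw [div_pow, Real.sq_sqrt hn0.le]; field_simp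
  rw [neg_sq, h3] at h2
  rw [h3] at h1
  calc _ ≤ ((2 * j).factorial / t ^ (2 * j)) * (Real.exp (t ^ 2 / 2) + Real.exp (t ^ 2 / 2)) := by
        gcongr
    _ = _ := by ring

lemma normSum_mul_elemSym (hn : 0 < n) (k : ℕ) (y : Fin n → Bool) :
    normSum y * (elemSym (k + 1) y / √n ^ (k + 1)) =
      (k + 2) * (elemSym (k + 2) y / √n ^ (k + 2)) + (1 - k / n) * (elemSym k y / √n ^ k) := by
  have hn0 : (0 : ℝ) < n := by exact_mod_cast hn
  have h := signSum_mul_elemSym k y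
  have hs : 0 < √(n : ℝ) := Real.sqrt_pos.2 hn0
  have hs2 : √(n : ℝ) ^ 2 = n := Real.sq_sqrt hn0.le
  have h1 : normSum y * (elemSym (k + 1) y / √n ^ (k + 1)) =
      (signSum y * elemSym (k + 1) y) / √n ^ (k + 2) := by
    rw [normSum, div_mul_div_comm, pow_succ' (√(n : ℝ)) (k + 1)]
  have h2 : (1 - (k : ℝ) / n) * (elemSym k y / √n ^ k) = (n - k) * elemSym k y / √n ^ (k + 2) := by
    rw [pow_add, hs2]; field_simp
  rw [h1, h2, h]
  ring

/-- Control of the elementary symmetric moments of a signed measure gives control of its power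
moments. -/
lemma abs_sum_normSum_pow_le (hn : 0 < n) {q : ℕ} (hqn : q ≤ n) {δ : ℝ} (hδ : 0 ≤ δ)
    (μ : (Fin n → Bool) → ℝ)
    (hμ : ∀ k ≤ q, |∑ y, μ y * (elemSym k y / √n ^ k)| ≤ δ) : ∀ j k : ℕ, j + k ≤ q →
    |∑ y, μ y * (normSum y ^ j * (elemSym k y / √n ^ k))| ≤ (q + 2) ^ j * δ
  | 0, k, hk => by simpa using hμ k (by omega)
  | j + 1, 0, hk => by
      have h := abs_sum_normSum_pow_le hn hqn hδ μ hμ j 1 (by omega)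
      have he : ∀ y : Fin n → Bool, normSum y ^ (j + 1) * (elemSym 0 y / √n ^ 0) =
          normSum y ^ j * (elemSym 1 y / √n ^ 1) := by
        intro y
        rw [elemSym_zero, elemSym_one, pow_zero, pow_one, pow_succ, normSum]
        ring
      simp only [he]
      refine h.trans ?_
      have : ((q : ℝ) + 2) ^ j ≤ (q + 2) ^ (j + 1) :=
        pow_le_pow_right₀ (by linarith [Nat.cast_nonneg (α := ℝ) q]) (by omega)
      gcongr
  | j + 1, k + 1, hk => by
      have h1 := abs_sum_normSum_pow_le hn hqn hδ μ hμ j k (by omega)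
      have h2 := abs_sum_normSum_pow_le hn hqn hδ μ hμ j (k + 2) (by omega)
      have he : ∀ y, μ y * (normSum y ^ (j + 1) * (elemSym (k + 1) y / √n ^ (k + 1))) =
          (k + 2) * (μ y * (normSum y ^ j * (elemSym (k + 2) y / √n ^ (k + 2)))) +
          (1 - k / n) * (μ y * (normSum y ^ j * (elemSym k y / √n ^ k))) := by
        intro y
        have := normSum_mul_elemSym hn k y
        rw [pow_succ, mul_assoc (normSum y ^ j), this]
        ring
      simp only [he, Finset.sum_add_distrib, ← Finset.mul_sum]
      have hn0 : (0 : ℝ) < n := by exact_mod_cast hn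
      have hkn : (k : ℝ) / n ≤ 1 := by
        rw [div_le_one hn0]; exact_mod_cast (by omega : k ≤ n)
      have hkn0 : 0 ≤ (k : ℝ) / n := by positivity
      have hkq : (k : ℝ) + 2 ≤ q := by exact_mod_cast (by omega : k + 2 ≤ q)
      refine (abs_add_le _ _).trans ?_
      rw [abs_mul, abs_mul, abs_of_nonneg (by linarith : (0 : ℝ) ≤ 1 - k / n),
        abs_of_nonneg (by positivity : (0 : ℝ) ≤ (k : ℝ) + 2)]
      set p := ((q : ℝ) + 2) ^ j * δ with hp
      have hp0 : 0 ≤ p := by positivity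
      have h3 : (1 - (k : ℝ) / n) * |∑ y, μ y * (normSum y ^ j * (elemSym k y / √n ^ k))| ≤ 1 * p :=
        mul_le_mul (by linarith) h1 (abs_nonneg _) (by norm_num)
      have h4 : ((k : ℝ) + 2) * |∑ y, μ y * (normSum y ^ j * (elemSym (k + 2) y / √n ^ (k + 2)))| ≤
          (k + 2) * p := by gcongr
      have h5 : ((q : ℝ) + 2) ^ (j + 1) * δ = (q + 2) * p := by rw [hp]; ring
      rw [h5]
      nlinarith

lemma cubeAvg_elemSym_succ (k : ℕ) : cubeAvg (elemSym (n := n) (k + 1)) = 0 := by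
  unfold elemSym
  rw [cubeAvg_sum]
  refine Finset.sum_eq_zero fun K hK => cubeAvg_walsh (Finset.card_pos.1 ?_)
  rw [(Finset.mem_powersetCard.1 hK).2]
  omega

lemma HasFewBiases.abs_cubeAvg_elemSym_le {q : ℕ} {δ : ℝ} {f : (Fin m → Bool) → (Fin n → Bool)}
    (hf : HasFewBiases q δ f) (hn : 0 < n) {k : ℕ} (hk : 1 ≤ k) (hkq : k ≤ q) :
    |cubeAvg (fun x => elemSym k (f x) / √n ^ k)| ≤ δ := by
  have hn0 : (0 : ℝ) < n := by exact_mod_cast hn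
  have hs : 0 < √(n : ℝ) := Real.sqrt_pos.2 hn0
  simp only [div_eq_mul_inv, cubeAvg_mul_const, elemSym, cubeAvg_sum]
  rw [← div_eq_mul_inv, abs_div, abs_of_pos (by positivity : 0 < √(n : ℝ) ^ k),
    div_le_iff₀ (by positivity)]
  refine le_trans ?_ (hf k hk hkq)
  rw [← Finset.sum_filter_ne_zero]
  refine (Finset.abs_sum_le_sum_abs _ _).trans ?_
  rw [← nsmul_one, ← Finset.sum_const]
  refine Finset.sum_le_sum fun K _ => (abs_cubeAvg_le _).trans ?_
  simp [abs_walsh, cubeAvg_const]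

lemma abs_sum_law_sub_uniform_normSum_pow_le {q : ℕ} {δ : ℝ} (hδ : 0 ≤ δ)
    {f : (Fin m → Bool) → (Fin n → Bool)} (hf : HasFewBiases q δ f) (hn : 0 < n) (hqn : q ≤ n)
    {j : ℕ} (hj : j ≤ q) :
    |∑ y, (law f y - ((2 : ℝ) ^ n)⁻¹) * normSum y ^ j| ≤ (q + 2) ^ j * δ := by
  have h := abs_sum_normSum_pow_le hn hqn hδ (fun y => law f y - ((2 : ℝ) ^ n)⁻¹) (by
    intro k hk
    simp only [sub_mul, Finset.sum_sub_distrib, sum_law_mul, sum_const_mul_eq_cubeAvg]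
    rcases k with _ | k
    · simpa [elemSym_zero, cubeAvg_const] using hδ
    · have : cubeAvg (fun y : Fin n → Bool => elemSym (k + 1) y / √n ^ (k + 1)) = 0 := by
        simp only [div_eq_mul_inv, cubeAvg_mul_const]
        rw [cubeAvg_elemSym_succ, zero_mul]
      rw [this, sub_zero]
      exact hf.abs_cubeAvg_elemSym_le hn (by omega) hk) j 0 (by omega)
  simpa [elemSym_zero] using h

lemma sum_law_add_uniform_normSum_pow_le {q : ℕ} {δ : ℝ} (hδ : 0 ≤ δ)
    {f : (Fin m → Bool) → (Fin n → Bool)} (hf : HasFewBiases q δ f) (hn : 0 < n) (hqn : q ≤ n)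
    (hδq : (q + 2) ^ q * δ ≤ 1) {j : ℕ} (hj : 2 * j ≤ q) {t : ℝ} (ht : 0 < t) :
    ∑ y, (law f y + ((2 : ℝ) ^ n)⁻¹) * normSum y ^ (2 * j) ≤
      1 + 4 * (2 * j).factorial * Real.exp (t ^ 2 / 2) / t ^ (2 * j) := by
  have h1 := le_of_abs_le (abs_sum_law_sub_uniform_normSum_pow_le hδ hf hn hqn hj)
  have h2 := cubeAvg_normSum_pow_le hn j ht
  have h3 : ((q : ℝ) + 2) ^ (2 * j) * δ ≤ 1 := by
    refine le_trans ?_ hδq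
    have : ((q : ℝ) + 2) ^ (2 * j) ≤ (q + 2) ^ q :=
      pow_le_pow_right₀ (by linarith [Nat.cast_nonneg (α := ℝ) q]) hj
    gcongr
  simp only [sub_mul, add_mul, Finset.sum_sub_distrib, Finset.sum_add_distrib,
    sum_const_mul_eq_cubeAvg] at h1 ⊢
  have h4 : 4 * ((2 * j).factorial : ℝ) * Real.exp (t ^ 2 / 2) / t ^ (2 * j) =
      2 * (2 * (2 * j).factorial * Real.exp (t ^ 2 / 2) / t ^ (2 * j)) := by ring
  rw [h4]
  linarith

lemma IsLocal.abs_cubeAvg_parity_mul_elemSym_le {d r k : ℕ} {ε₁ W B : ℝ}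
    {f : (Fin m → Bool) → (Fin n → Bool)} (hf : IsLocal d f) (hkr : d * k ≤ r)
    (hW : ∑ T ∈ Finset.univ.filter (fun T : Finset (Fin m) => T.Nonempty ∧ T.card ≤ r),
        walshCoeff (fun x => walsh Finset.univ (f x)) T ^ 2 ≤ W)
    (hmean : |cubeAvg (fun x => elemSym k (f x) / √n ^ k)| ≤ ε₁)
    (hB : cubeAvg (fun x => (elemSym k (f x) / √n ^ k) ^ 2) ≤ B) :
    |cubeAvg (fun x => walsh Finset.univ (f x) * (elemSym k (f x) / √n ^ k))| ≤ ε₁ + √(W * B) := by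
  set χ : (Fin m → Bool) → ℝ := fun x => walsh Finset.univ (f x) with hχ
  set G : (Fin m → Bool) → ℝ := fun x => elemSym k (f x) / √n ^ k with hG
  set V := Finset.univ.filter (fun T : Finset (Fin m) => T.Nonempty ∧ T.card ≤ r) with hV
  have hdeg : ∀ T : Finset (Fin m), r < T.card → walshCoeff G T = 0 := by
    intro T hT
    obtain ⟨A, hA⟩ := hf.exists_dependsOnlyOn_walsh
    simp only [walshCoeff, hG, elemSym, Finset.sum_div, Finset.sum_mul, cubeAvg_sum]
    refine Finset.sum_eq_zero fun K hK => ?_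
    have hK' := (Finset.mem_powersetCard.1 hK).2
    have h0 : walshCoeff (fun x => walsh K (f x)) T = 0 := by
      refine walshCoeff_eq_zero_of_dependsOnlyOn (hA K).2 fun hsub => ?_
      have := Finset.card_le_card hsub
      have h2 := (hA K).1
      rw [hK'] at h2
      omega
    have h1 : ∀ x, walsh K (f x) / √n ^ k * walsh T x =
        (√n ^ k)⁻¹ * (walsh K (f x) * walsh T x) := fun x => by ring
    simp only [h1, cubeAvg_const_mul]
    rw [walshCoeff] at h0
    rw [h0, mul_zero]
  have hsplit : cubeAvg (fun x => χ x * G x) =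
      cubeAvg χ * cubeAvg G + ∑ T ∈ V, walshCoeff χ T * walshCoeff G T := by
    rw [cubeAvg_mul_eq_sum_walshCoeff, ← walshCoeff_empty χ, ← walshCoeff_empty G,
      ← Finset.add_sum_erase _ _ (Finset.mem_univ ∅)]
    congr 1
    symm
    refine Finset.sum_subset (fun T hT => ?_) fun T hT hTV => ?_
    · have := (Finset.mem_filter.1 hT).2.1
      exact Finset.mem_erase.2 ⟨this.ne_empty, Finset.mem_univ _⟩
    · have h1 := (Finset.mem_erase.1 hT).1
      rw [hdeg T, mul_zero]
      by_contra hc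
      exact hTV (Finset.mem_filter.2 ⟨Finset.mem_univ _, Finset.nonempty_iff_ne_empty.2 h1, by omega⟩)
  have hχ1 : |cubeAvg χ| ≤ 1 := (abs_cubeAvg_le _).trans (by simp [hχ, abs_walsh, cubeAvg_const])
  have hcs : |∑ T ∈ V, walshCoeff χ T * walshCoeff G T| ≤ √(W * B) := by
    rw [← Real.sqrt_sq_eq_abs]
    refine Real.sqrt_le_sqrt ((Finset.sum_mul_sq_le_sq_mul_sq _ _ _).trans ?_)
    have h1 : ∑ T ∈ V, walshCoeff G T ^ 2 ≤ B := by
      refine le_trans ?_ hB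
      rw [cubeAvg_sq_eq_sum_walshCoeff]
      exact Finset.sum_le_sum_of_subset_of_nonneg (Finset.subset_univ _) fun _ _ _ => sq_nonneg _
    have h2 : 0 ≤ ∑ T ∈ V, walshCoeff χ T ^ 2 := Finset.sum_nonneg fun _ _ => sq_nonneg _
    have h3 : 0 ≤ ∑ T ∈ V, walshCoeff G T ^ 2 := Finset.sum_nonneg fun _ _ => sq_nonneg _
    exact mul_le_mul hW h1 h3 (h2.trans hW)
  rw [hsplit]
  refine (abs_add_le _ _).trans (add_le_add ?_ hcs)
  rw [abs_mul]
  calc |cubeAvg χ| * |cubeAvg G| ≤ 1 * ε₁ := mul_le_mul hχ1 hmean (abs_nonneg _) (by norm_num)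
    _ = ε₁ := one_mul _

/-- Every moment of bounded order of the output weight of a good local function, also when twisted
by the output parity, is close to the corresponding moment of the uniform distribution. -/
theorem exists_moments_close (d q : ℕ) (δ : ℝ) (hδ : 0 < δ) :
    ∃ (Q : ℕ) (δ₁ : ℝ) (r : ℕ) (ε : ℝ), 0 < δ₁ ∧ 0 < ε ∧
      ∀ n, Q + 1 ≤ n → ∀ m (f : (Fin m → Bool) → (Fin n → Bool)), IsLocal d f →
      HasFewBiases Q δ₁ f → HasSmallParity r ε f →
      (∀ j ≤ q, |∑ y, (law f y - ((2 : ℝ) ^ n)⁻¹) * normSum y ^ j| ≤ δ) ∧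
      (∀ j ≤ q, |∑ y, (law f y * walsh Finset.univ y -
        cubeAvg (fun x => walsh Finset.univ (f x)) * ((2 : ℝ) ^ n)⁻¹) * normSum y ^ j| ≤ δ) ∧
      (∀ j ≤ q, ∀ t : ℝ, 0 < t → ∑ y, (law f y + ((2 : ℝ) ^ n)⁻¹) * normSum y ^ (2 * j) ≤
        1 + 4 * (2 * j).factorial * Real.exp (t ^ 2 / 2) / t ^ (2 * j)) := by
  set B : ℝ := 4 ^ q * (1 + (1 + 4 * (2 * q).factorial * Real.exp (1 / 2))) with hB
  have hB0 : 0 < B := by positivity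
  set M : ℝ := ((2 * q : ℕ) + 2 : ℝ) ^ (2 * q) with hM
  have hM1 : 1 ≤ M := one_le_pow₀ (by linarith [Nat.cast_nonneg (α := ℝ) (2 * q)])
  set η : ℝ := min 1 δ / (2 * M) with hη
  have hη0 : 0 < η := by positivity
  have hMη : M * (2 * η) = min 1 δ := by rw [hη]; field_simp
  obtain ⟨ε, hε, hpar⟩ := exists_sum_sq_walshCoeff_polyPhase_le d (d * q) (η ^ 2 / B) (by positivity)
  refine ⟨2 * q, η, d * q, ε, hη0, hε, fun n hn m f hf hfew hsmall => ?_⟩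
  have hn0 : 0 < n := by omega
  have hMη1 : M * η ≤ 1 := by nlinarith [min_le_left 1 δ]
  have hMηδ : M * (2 * η) ≤ δ := hMη.le.trans (min_le_right _ _)
  have hmom : ∀ j ≤ q, ∀ t : ℝ, 0 < t → ∑ y, (law f y + ((2 : ℝ) ^ n)⁻¹) * normSum y ^ (2 * j) ≤
        1 + 4 * (2 * j).factorial * Real.exp (t ^ 2 / 2) / t ^ (2 * j) := fun j hj t ht =>
    sum_law_add_uniform_normSum_pow_le hη0.le hfew hn0 (by omega) hMη1 (by omega) ht
  refine ⟨fun j hj => ?_, fun j hj => ?_, hmom⟩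
  · refine (abs_sum_law_sub_uniform_normSum_pow_le hη0.le hfew hn0 (by omega)
      (by omega : j ≤ 2 * q)).trans ?_
    have h1 : (((2 * q : ℕ) : ℝ) + 2) ^ j ≤ M :=
      pow_le_pow_right₀ (by linarith [Nat.cast_nonneg (α := ℝ) (2 * q)]) (by omega)
    nlinarith
  · set χ := cubeAvg (fun x => walsh Finset.univ (f x)) with hχ
    have hsecond : ∀ k ≤ q, cubeAvg (fun x => (elemSym k (f x) / √n ^ k) ^ 2) ≤ B := by
      intro k hk
      have hpt : ∀ y : Fin n → Bool,
          (elemSym k y / √n ^ k) ^ 2 ≤ 4 ^ k * (1 + normSum y ^ (2 * k)) := by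
        intro y
        have hs : 0 < √(n : ℝ) := Real.sqrt_pos.2 (by exact_mod_cast hn0)
        have h1 : |elemSym k y / √n ^ k| ≤ (1 + |normSum y|) ^ k := by
          rw [abs_div, abs_of_pos (by positivity : 0 < √(n : ℝ) ^ k), div_le_iff₀ (by positivity),
            ← mul_pow]
          have h2 : (1 + |normSum y|) * √(n : ℝ) = √n + |signSum y| := by
            unfold normSum
            rw [abs_div, abs_of_pos hs]
            field_simp
          rw [h2]
          exact abs_elemSym_le y k
        calc (elemSym k y / √n ^ k) ^ 2 = |elemSym k y / √n ^ k| ^ 2 := (sq_abs _).symm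
          _ ≤ ((1 + |normSum y|) ^ k) ^ 2 := by gcongr
          _ = ((1 + |normSum y|) ^ 2) ^ k := by rw [← pow_mul, ← pow_mul, mul_comm]
          _ ≤ (4 * max 1 (normSum y ^ 2)) ^ k := by
              gcongr
              rcases le_total (|normSum y|) 1 with h | h
              · nlinarith [le_max_left 1 (normSum y ^ 2), abs_nonneg (normSum y)]
              · have := le_max_right 1 (normSum y ^ 2)
                have h2 : normSum y ^ 2 = |normSum y| ^ 2 := (sq_abs _).symm
                nlinarith
          _ = 4 ^ k * (max 1 (normSum y ^ 2)) ^ k := mul_pow _ _ _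
          _ ≤ _ := by
              have h2 : 0 ≤ normSum y ^ (2 * k) := Even.pow_nonneg (even_two_mul k) _
              gcongr
              rcases max_cases 1 (normSum y ^ 2) with ⟨h, _⟩ | ⟨h, _⟩
              · rw [h, one_pow]; linarith
              · rw [h, ← pow_mul]; linarith
      refine (cubeAvg_mono fun x => hpt (f x)).trans ?_
      rw [cubeAvg_const_mul, cubeAvg_add, cubeAvg_const]
      have h1 := hmom k hk 1 one_pos
      simp only [add_mul, Finset.sum_add_distrib, sum_law_mul, sum_const_mul_eq_cubeAvg,
        one_pow, div_one] at h1
      have h2 : 0 ≤ cubeAvg (fun y : Fin n → Bool => normSum y ^ (2 * k)) :=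
        cubeAvg_nonneg fun y => Even.pow_nonneg (even_two_mul k) _
      have h3 : ((2 * k).factorial : ℝ) ≤ (2 * q).factorial := by
        exact_mod_cast Nat.factorial_le (by omega)
      have h4 : cubeAvg (fun x => normSum (f x) ^ (2 * k)) ≤
          1 + 4 * (2 * q).factorial * Real.exp (1 / 2) := by
        have : 4 * ((2 * k).factorial : ℝ) * Real.exp (1 / 2) ≤
            4 * (2 * q).factorial * Real.exp (1 / 2) := by gcongr
        linarith
      have h5 : 0 ≤ cubeAvg (fun x => normSum (f x) ^ (2 * k)) :=
        cubeAvg_nonneg fun y => Even.pow_nonneg (even_two_mul k) _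
      rw [hB]
      gcongr
      norm_num
    have hW := hpar m _ (hf.isPolyPhase Finset.univ) hsmall
    have hsym : ∀ k ≤ q, |∑ y, (law f y * walsh Finset.univ y - χ * ((2 : ℝ) ^ n)⁻¹) *
        (elemSym k y / √n ^ k)| ≤ 2 * η := by
      intro k hk
      simp only [sub_mul, Finset.sum_sub_distrib, mul_assoc, sum_law_mul]
      rw [← Finset.mul_sum, sum_const_mul_eq_cubeAvg]
      rcases k with _ | k
      · simp only [elemSym_zero, pow_zero, div_one, mul_one, cubeAvg_const]
        rw [← hχ, sub_self, abs_zero]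
        positivity
      · have h0 : cubeAvg (fun y : Fin n → Bool => elemSym (k + 1) y / √n ^ (k + 1)) = 0 := by
          simp only [div_eq_mul_inv, cubeAvg_mul_const]
          rw [cubeAvg_elemSym_succ, zero_mul]
        rw [h0, mul_zero, sub_zero]
        have h1 := hf.abs_cubeAvg_parity_mul_elemSym_le (Nat.mul_le_mul_left d hk) hW
          (hfew.abs_cubeAvg_elemSym_le hn0 (by omega) (by omega)) (hsecond _ hk)
        rw [div_mul_cancel₀ _ hB0.ne', Real.sqrt_sq hη0.le] at h1
        linarith
    have h := abs_sum_normSum_pow_le hn0 (by omega : q ≤ n) (by positivity) _ hsym j 0 (by omega)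
    simp only [elemSym_zero, pow_zero, div_one, mul_one] at h
    refine h.trans ?_
    have h1 : ((q : ℝ) + 2) ^ j ≤ M := by
      have h2 : ((q : ℝ) + 2) ^ j ≤ (((2 * q : ℕ) : ℝ) + 2) ^ j := by
        gcongr; omega
      exact h2.trans (pow_le_pow_right₀ (by linarith [Nat.cast_nonneg (α := ℝ) (2 * q)]) (by omega))
    nlinarith

end Moments

lemma abs_cos_add_sub_taylor_le_of_nonneg (q : ℕ) : ∀ (φ : ℝ) {x : ℝ}, 0 ≤ x →
    |Real.cos (x + φ) - ∑ j ∈ Finset.range q, Real.cos (φ + j * (Real.pi / 2)) / j.factorial * x ^ j|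
      ≤ x ^ q / q.factorial := by
  induction q with
  | zero => intro φ x _; simpa using Real.abs_cos_le_one (x + φ)
  | succ q ih =>
    intro φ x hx
    set R : ℝ → ℝ := fun u => Real.cos (u + φ) -
      ∑ j ∈ Finset.range (q + 1), Real.cos (φ + j * (Real.pi / 2)) / j.factorial * u ^ j with hR
    set R' : ℝ → ℝ := fun u => Real.cos (u + (φ + Real.pi / 2)) -
      ∑ j ∈ Finset.range q,
        Real.cos ((φ + Real.pi / 2) + j * (Real.pi / 2)) / j.factorial * u ^ j with hR'
    have hderiv : ∀ u, HasDerivAt R (R' u) u := by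
      intro u
      have h1 : HasDerivAt (fun u : ℝ => Real.cos (u + φ)) (-Real.sin (u + φ) * 1) u :=
        ((hasDerivAt_id u).add_const φ).cos
      have h2 : HasDerivAt (fun u : ℝ => ∑ j ∈ Finset.range (q + 1),
          Real.cos (φ + j * (Real.pi / 2)) / j.factorial * u ^ j)
          (∑ j ∈ Finset.range (q + 1),
            Real.cos (φ + j * (Real.pi / 2)) / j.factorial * (j * u ^ (j - 1))) u :=
        HasDerivAt.fun_sum fun j _ => (hasDerivAt_pow j u).const_mul _
      refine HasDerivAt.congr_deriv (f := R) (h1.sub h2) ?_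
      rw [hR']
      simp only
      congr 1
      · rw [← add_assoc, Real.cos_add_pi_div_two]; ring
      · rw [Finset.sum_range_succ']
        simp only [Nat.cast_zero, zero_mul, mul_zero, add_zero]
        refine Finset.sum_congr rfl fun j _ => ?_
        rw [Nat.factorial_succ, Nat.add_sub_cancel]
        push_cast
        have : (j.factorial : ℝ) ≠ 0 := by positivity
        have h3 : (j : ℝ) + 1 ≠ 0 := by positivity
        rw [show φ + Real.pi / 2 + j * (Real.pi / 2) = φ + (j + 1) * (Real.pi / 2) by ring]
        field_simp
    have hB : ∀ u : ℝ, HasDerivAt (fun u : ℝ => u ^ (q + 1) / (q + 1).factorial)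
        (u ^ q / q.factorial) u := by
      intro u
      refine ((hasDerivAt_pow (q + 1) u).div_const ((q + 1).factorial : ℝ)).congr_deriv ?_
      rw [Nat.factorial_succ, Nat.add_sub_cancel]
      push_cast
      have h3 : (q : ℝ) + 1 ≠ 0 := by positivity
      field_simp
    have h0 : R 0 = 0 := by
      rw [hR]
      simp only [zero_add]
      rw [Finset.sum_range_succ']
      simp
    have := image_norm_le_of_norm_deriv_right_le_deriv_boundary (f := R) (f' := R') (a := 0) (b := x)
      (B := fun u : ℝ => u ^ (q + 1) / (q + 1).factorial) (B' := fun u => u ^ q / q.factorial)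
      (fun u _ => (hderiv u).continuousAt.continuousWithinAt)
      (fun u _ => (hderiv u).hasDerivWithinAt)
      (by simp [h0]) hB
      (fun u hu => by rw [Real.norm_eq_abs]; exact ih _ hu.1)
      (Set.right_mem_Icc.2 hx)
    rwa [Real.norm_eq_abs] at this

lemma abs_cos_add_sub_taylor_le (q : ℕ) (φ x : ℝ) :
    |Real.cos (x + φ) - ∑ j ∈ Finset.range q, Real.cos (φ + j * (Real.pi / 2)) / j.factorial * x ^ j|
      ≤ |x| ^ q / q.factorial := by
  rcases le_total 0 x with hx | hx
  · rw [abs_of_nonneg hx]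
    exact abs_cos_add_sub_taylor_le_of_nonneg q φ hx
  · have h := abs_cos_add_sub_taylor_le_of_nonneg q (-φ) (neg_nonneg.2 hx)
    rw [abs_of_nonpos hx]
    convert h using 3
    · rw [← Real.cos_neg]; congr 1; ring
    · refine Finset.sum_congr rfl fun j _ => ?_
      have h1 := Real.cos_sub_nat_mul_pi (φ + j * (Real.pi / 2)) j
      rw [show φ + j * (Real.pi / 2) - j * Real.pi = -(-φ + j * (Real.pi / 2)) by ring,
        Real.cos_neg] at h1
      have h2 : ((-1 : ℝ) ^ j) * (-1) ^ j = 1 := by rw [← mul_pow]; norm_num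
      rw [h1, neg_pow x]
      linear_combination (-Real.cos (φ + j * (Real.pi / 2)) / j.factorial * x ^ j) * h2

/-- The weights `μ`, dominated by `ν`, have nearly vanishing moments up to order `q` at the
points `w`, and `ν` has moments of Gaussian growth. -/
def HasSmallMoments (q : ℕ) (δ : ℝ) {ι : Type} [Fintype ι] (w μ ν : ι → ℝ) : Prop :=
  (∀ i, |μ i| ≤ ν i) ∧ (∀ j ≤ q, |∑ i, μ i * w i ^ j| ≤ δ) ∧
    ∀ j ≤ q, ∀ t : ℝ, 0 < t →
      ∑ i, ν i * w i ^ (2 * j) ≤ 1 + 4 * (2 * j).factorial * Real.exp (t ^ 2 / 2) / t ^ (2 * j)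

lemma HasSmallMoments.mono {q q' : ℕ} {δ δ' : ℝ} {ι : Type} [Fintype ι] {w μ ν : ι → ℝ}
    (h : HasSmallMoments q δ w μ ν) (hq : q' ≤ q) (hδ : δ ≤ δ') : HasSmallMoments q' δ' w μ ν :=
  ⟨h.1, fun j hj => (h.2.1 j (hj.trans hq)).trans hδ, fun j hj => h.2.2 j (hj.trans hq)⟩

lemma HasSmallMoments.sum_le {q : ℕ} {δ : ℝ} {ι : Type} [Fintype ι] {w μ ν : ι → ℝ}
    (h : HasSmallMoments q δ w μ ν) : ∑ i, ν i ≤ 13 := by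
  have h0 := h.2.2 0 (Nat.zero_le _) 1 one_pos
  have h1 : Real.exp (1 / 2) ≤ Real.exp 1 := Real.exp_le_exp.2 (by norm_num)
  have h2 := Real.exp_one_lt_d9
  norm_num at h0
  linarith

/-- The integral of every translate of `h` is small against measures with small moments. -/
def MomentControlled (h : ℝ → ℝ) : Prop :=
  ∀ δ : ℝ, 0 < δ → ∃ q : ℕ, ∃ δ' : ℝ, 0 < δ' ∧ ∀ (ι : Type) [Fintype ι] (w μ ν : ι → ℝ),
    HasSmallMoments q δ' w μ ν → ∀ τ : ℝ, |∑ i, μ i * h (w i - τ)| ≤ δ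

lemma MomentControlled.add {g h : ℝ → ℝ} (hg : MomentControlled g) (hh : MomentControlled h) :
    MomentControlled fun u => g u + h u := by
  intro δ hδ
  obtain ⟨q₁, δ₁, h1, H1⟩ := hg (δ / 2) (by positivity)
  obtain ⟨q₂, δ₂, h2, H2⟩ := hh (δ / 2) (by positivity)
  refine ⟨max q₁ q₂, min δ₁ δ₂, lt_min h1 h2, fun ι _ w μ ν hm τ => ?_⟩
  have e1 := H1 ι w μ ν (hm.mono (le_max_left _ _) (min_le_left _ _)) τ
  have e2 := H2 ι w μ ν (hm.mono (le_max_right _ _) (min_le_right _ _)) τ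
  simp only [mul_add, Finset.sum_add_distrib]
  exact (abs_add_le _ _).trans (by linarith)

lemma MomentControlled.const_mul {g : ℝ → ℝ} (hg : MomentControlled g) (c : ℝ) :
    MomentControlled fun u => c * g u := by
  intro δ hδ
  obtain ⟨q₁, δ₁, h1, H1⟩ := hg (δ / (|c| + 1)) (by positivity)
  refine ⟨q₁, δ₁, h1, fun ι _ w μ ν hm τ => ?_⟩
  have e1 := H1 ι w μ ν hm τ
  have : ∑ i, μ i * (c * g (w i - τ)) = c * ∑ i, μ i * g (w i - τ) := by
    rw [Finset.mul_sum]; exact Finset.sum_congr rfl fun _ _ => by ring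
  rw [this, abs_mul]
  rw [le_div_iff₀ (by positivity)] at e1
  nlinarith [abs_nonneg c, abs_nonneg (∑ i, μ i * g (w i - τ))]

lemma momentControlled_cos (θ φ : ℝ) : MomentControlled fun u => Real.cos (θ * u + φ) := by
  intro δ hδ
  set t : ℝ := 2 * |θ| + 1 with ht
  have ht0 : 0 < t := by positivity
  have hlim : Filter.Tendsto (fun J : ℕ => |θ| ^ (2 * J) / (2 * J).factorial +
      4 * Real.exp (t ^ 2 / 2) * (1 / 4 : ℝ) ^ J) Filter.atTop (nhds 0) := by
    have h1 := (FloorSemiring.tendsto_pow_div_factorial_atTop (|θ|)).comp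
      (Filter.tendsto_id.const_mul_atTop' (by norm_num : 0 < 2))
    have h2 := (tendsto_pow_atTop_nhds_zero_of_lt_one (by norm_num : (0 : ℝ) ≤ 1 / 4)
      (by norm_num)).const_mul (4 * Real.exp (t ^ 2 / 2))
    simpa using h1.add h2
  obtain ⟨J, hJ⟩ := (hlim.eventually (gt_mem_nhds (half_pos hδ))).exists
  refine ⟨2 * J, δ / (2 * Real.exp |θ|), by positivity, fun ι _ w μ ν hm τ => ?_⟩
  set ψ := φ - θ * τ with hψ
  set R : ι → ℝ := fun i => Real.cos (θ * w i + ψ) -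
    ∑ j ∈ Finset.range (2 * J), Real.cos (ψ + j * (Real.pi / 2)) / j.factorial * (θ * w i) ^ j
    with hR
  have hsplit : ∑ i, μ i * Real.cos (θ * (w i - τ) + φ) = (∑ i, μ i * R i) +
      ∑ j ∈ Finset.range (2 * J),
        (Real.cos (ψ + j * (Real.pi / 2)) / j.factorial * θ ^ j) * ∑ i, μ i * w i ^ j := by
    simp only [Finset.mul_sum]
    rw [Finset.sum_comm, ← Finset.sum_add_distrib]
    refine Finset.sum_congr rfl fun i _ => ?_
    have : ∑ j ∈ Finset.range (2 * J),
        Real.cos (ψ + j * (Real.pi / 2)) / j.factorial * θ ^ j * (μ i * w i ^ j) =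
        μ i * ∑ j ∈ Finset.range (2 * J),
          Real.cos (ψ + j * (Real.pi / 2)) / j.factorial * (θ * w i) ^ j := by
      rw [Finset.mul_sum]; exact Finset.sum_congr rfl fun j _ => by rw [mul_pow]; ring
    rw [this, hR, ← mul_add, sub_add_cancel, hψ]
    congr 2
    ring
  have hmain : |∑ j ∈ Finset.range (2 * J),
      (Real.cos (ψ + j * (Real.pi / 2)) / j.factorial * θ ^ j) * ∑ i, μ i * w i ^ j| ≤ δ / 2 := by
    have hexp := Real.exp_pos |θ|
    calc _ ≤ ∑ j ∈ Finset.range (2 * J), (|θ| ^ j / j.factorial) * (δ / (2 * Real.exp |θ|)) := by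
          refine (Finset.abs_sum_le_sum_abs _ _).trans (Finset.sum_le_sum fun j hj => ?_)
          rw [abs_mul]
          refine mul_le_mul ?_ (hm.2.1 j (Finset.mem_range.1 hj).le) (abs_nonneg _) (by positivity)
          rw [abs_mul, abs_div, abs_pow, Nat.abs_cast, div_mul_eq_mul_div]
          have := Real.abs_cos_le_one (ψ + j * (Real.pi / 2))
          gcongr
          nlinarith [pow_nonneg (abs_nonneg θ) j]
      _ = (∑ j ∈ Finset.range (2 * J), |θ| ^ j / j.factorial) * (δ / (2 * Real.exp |θ|)) := by
          rw [Finset.sum_mul]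
      _ ≤ Real.exp |θ| * (δ / (2 * Real.exp |θ|)) := by
          gcongr
          exact Real.sum_le_exp_of_nonneg (abs_nonneg _) _
      _ = δ / 2 := by field_simp
  have hrem : |∑ i, μ i * R i| ≤ δ / 2 := by
    have hν := hm.2.2 J (by omega) t ht0
    have hfac : (0 : ℝ) < (2 * J).factorial := by positivity
    calc |∑ i, μ i * R i| ≤ ∑ i, ν i * (|θ| ^ (2 * J) / (2 * J).factorial * w i ^ (2 * J)) := by
          refine (Finset.abs_sum_le_sum_abs _ _).trans (Finset.sum_le_sum fun i _ => ?_)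
          rw [abs_mul]
          refine mul_le_mul (hm.1 i) ?_ (abs_nonneg _) ((abs_nonneg _).trans (hm.1 i))
          refine (abs_cos_add_sub_taylor_le (2 * J) ψ (θ * w i)).trans (le_of_eq ?_)
          rw [abs_mul, mul_pow, Even.pow_abs (even_two_mul J) (w i)]
          ring
      _ = |θ| ^ (2 * J) / (2 * J).factorial * ∑ i, ν i * w i ^ (2 * J) := by
          rw [Finset.mul_sum]; exact Finset.sum_congr rfl fun _ _ => by ring
      _ ≤ |θ| ^ (2 * J) / (2 * J).factorial *
            (1 + 4 * (2 * J).factorial * Real.exp (t ^ 2 / 2) / t ^ (2 * J)) := by gcongr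
      _ = |θ| ^ (2 * J) / (2 * J).factorial +
            4 * Real.exp (t ^ 2 / 2) * ((|θ| / t) ^ 2) ^ J := by
          rw [← pow_mul, div_pow]; field_simp
      _ ≤ |θ| ^ (2 * J) / (2 * J).factorial + 4 * Real.exp (t ^ 2 / 2) * (1 / 4 : ℝ) ^ J := by
          have h1 : |θ| / t ≤ 1 / 2 := by
            rw [div_le_iff₀ ht0, ht]; linarith
          have h2 : (|θ| / t) ^ 2 ≤ 1 / 4 := by
            have : 0 ≤ |θ| / t := by positivity
            nlinarith
          gcongr
      _ ≤ δ / 2 := hJ.le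
  rw [hsplit]
  exact (abs_add_le _ _).trans (by linarith)

lemma momentControlled_cos_mul_sin_pow (ω : ℝ) (j : ℕ) : ∀ θ φ : ℝ,
    MomentControlled fun u => Real.cos (θ * u + φ) * Real.sin (ω * u) ^ j := by
  induction j with
  | zero => intro θ φ; simpa using momentControlled_cos θ φ
  | succ j ih =>
    intro θ φ
    have h1 := (ih (θ + ω) (φ - Real.pi / 2)).const_mul (1 / 2)
    have h2 := (ih (θ - ω) (φ - Real.pi / 2)).const_mul (-1 / 2)
    convert h1.add h2 using 2 with u
    have e1 : Real.cos ((θ + ω) * u + (φ - Real.pi / 2)) =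
        Real.sin ((θ * u + φ) + ω * u) := by
      rw [← Real.cos_sub_pi_div_two]; congr 1; ring
    have e2 : Real.cos ((θ - ω) * u + (φ - Real.pi / 2)) =
        Real.sin ((θ * u + φ) - ω * u) := by
      rw [← Real.cos_sub_pi_div_two]; congr 1; ring
    rw [e1, e2, Real.sin_add, Real.sin_sub]
    ring

lemma momentControlled_polynomial_sin (ω : ℝ) (p : Polynomial ℝ) :
    MomentControlled fun u => p.eval (Real.sin (ω * u)) := by
  induction p using Polynomial.induction_on' with
  | add p q hp hq => simpa using hp.add hq
  | monomial j a =>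
    simpa using (momentControlled_cos_mul_sin_pow ω j 0 0).const_mul a

lemma momentControlled_continuous_sin (ω : ℝ) {Φ : ℝ → ℝ} (hΦ : Continuous Φ) :
    MomentControlled fun u => Φ (Real.sin (ω * u)) := by
  intro δ hδ
  obtain ⟨p, hp⟩ := exists_polynomial_near_of_continuousOn (-1) 1 Φ hΦ.continuousOn (δ / 26)
    (by positivity)
  obtain ⟨q, δ', hδ', H⟩ := momentControlled_polynomial_sin ω p (δ / 2) (by positivity)
  refine ⟨q, δ', hδ', fun ι _ w μ ν hm τ => ?_⟩
  have h1 := H ι w μ ν hm τ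
  have h2 : |∑ i, μ i * (Φ (Real.sin (ω * (w i - τ))) - p.eval (Real.sin (ω * (w i - τ))))| ≤
      δ / 2 := by
    calc _ ≤ ∑ i, ν i * (δ / 26) := by
          refine (Finset.abs_sum_le_sum_abs _ _).trans (Finset.sum_le_sum fun i _ => ?_)
          rw [abs_mul]
          refine mul_le_mul (hm.1 i) ?_ (abs_nonneg _) ((abs_nonneg _).trans (hm.1 i))
          rw [abs_sub_comm]
          exact (hp _ ⟨Real.neg_one_le_sin _, Real.sin_le_one _⟩).le
      _ = (∑ i, ν i) * (δ / 26) := by rw [Finset.sum_mul]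
      _ ≤ 13 * (δ / 26) := by gcongr; exact hm.sum_le
      _ = δ / 2 := by ring
  have h3 : ∑ i, μ i * Φ (Real.sin (ω * (w i - τ))) =
      (∑ i, μ i * (Φ (Real.sin (ω * (w i - τ))) - p.eval (Real.sin (ω * (w i - τ))))) +
        ∑ i, μ i * p.eval (Real.sin (ω * (w i - τ))) := by
    rw [← Finset.sum_add_distrib]; exact Finset.sum_congr rfl fun _ _ => by ring
  rw [h3]
  exact (abs_add_le _ _).trans (by linarith)

/-- A continuous function of `sin (π u / (2 P))` that is `1` on `[-2P, 0]` and `0` on `[h, P]`. -/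
def sineStep (P h u : ℝ) : ℝ := max 0 (min 1 (1 - P / h * Real.sin (Real.pi / (2 * P) * u)))

lemma sineStep_nonneg (P h u : ℝ) : 0 ≤ sineStep P h u := le_max_left _ _

lemma sineStep_le_one (P h u : ℝ) : sineStep P h u ≤ 1 := max_le zero_le_one (min_le_left _ _)

lemma sineStep_eq_one {P h u : ℝ} (hP : 0 < P) (hh : 0 < h) (h1 : -(2 * P) ≤ u) (h2 : u ≤ 0) :
    sineStep P h u = 1 := by
  have hs : Real.sin (Real.pi / (2 * P) * u) ≤ 0 := by
    refine Real.sin_nonpos_of_nonpos_of_neg_pi_le ?_ ?_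
    · exact mul_nonpos_of_nonneg_of_nonpos (by positivity) h2
    · have : Real.pi / (2 * P) * (-(2 * P)) ≤ Real.pi / (2 * P) * u := by gcongr
      have h3 : Real.pi / (2 * P) * (-(2 * P)) = -Real.pi := by field_simp
      linarith
  have : P / h * Real.sin (Real.pi / (2 * P) * u) ≤ 0 :=
    mul_nonpos_of_nonneg_of_nonpos (by positivity) hs
  rw [sineStep, min_eq_left (by linarith), max_eq_right zero_le_one]

lemma sineStep_eq_zero {P h u : ℝ} (hP : 0 < P) (hh : 0 < h) (h1 : h ≤ u) (h2 : u ≤ P) :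
    sineStep P h u = 0 := by
  have hs : u / P ≤ Real.sin (Real.pi / (2 * P) * u) := by
    have := Real.mul_le_sin (x := Real.pi / (2 * P) * u)
      (mul_nonneg (by positivity) (by linarith)) (by
        have : Real.pi / (2 * P) * u ≤ Real.pi / (2 * P) * P := by gcongr
        refine this.trans (le_of_eq ?_)
        field_simp)
    refine le_trans (le_of_eq ?_) this
    field_simp
  have h3 : 1 ≤ P / h * Real.sin (Real.pi / (2 * P) * u) := by
    have : P / h * (u / P) ≤ P / h * Real.sin (Real.pi / (2 * P) * u) := by gcongr
    have e : P / h * (u / P) = u / h := by field_simp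
    have : 1 ≤ u / h := by rw [le_div_iff₀ hh]; linarith
    linarith
  rw [sineStep]
  exact max_eq_left ((min_le_right _ _).trans (by linarith))

lemma momentControlled_sineStep (P h : ℝ) : MomentControlled (sineStep P h) :=
  momentControlled_continuous_sin (Real.pi / (2 * P))
    (Φ := fun s => max 0 (min 1 (1 - P / h * s))) (by fun_prop)

lemma HasSmallMoments.sum_tail_le {q : ℕ} (hq : 1 ≤ q) {δ : ℝ} {ι : Type} [Fintype ι]
    {w μ ν : ι → ℝ} (h : HasSmallMoments q δ w μ ν) {P : ℝ} (hP : 0 < P) :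
    ∑ i, ν i * (if P / 4 < |w i| then 1 else 0) ≤ 368 / P ^ 2 := by
  have h2 := h.2.2 1 hq 1 one_pos
  have h3 : Real.exp (1 / 2) ≤ Real.exp 1 := Real.exp_le_exp.2 (by norm_num)
  have h4 := Real.exp_one_lt_d9
  norm_num at h2
  have h5 : ∑ i, ν i * w i ^ 2 ≤ 23 := by linarith
  calc ∑ i, ν i * (if P / 4 < |w i| then 1 else 0) ≤ ∑ i, (16 / P ^ 2) * (ν i * w i ^ 2) := by
        refine Finset.sum_le_sum fun i _ => ?_
        have hν : 0 ≤ ν i := (abs_nonneg _).trans (h.1 i)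
        split_ifs with hc
        · have : 1 ≤ 16 / P ^ 2 * w i ^ 2 := by
            rw [div_mul_eq_mul_div, le_div_iff₀ (by positivity), ← sq_abs (w i)]
            nlinarith
          nlinarith
        · rw [mul_zero]; positivity
    _ = (16 / P ^ 2) * ∑ i, ν i * w i ^ 2 := by rw [Finset.mul_sum]
    _ ≤ (16 / P ^ 2) * 23 := by gcongr
    _ = 368 / P ^ 2 := by ring

/-- Smallness of low moments implies Kolmogorov closeness to an anticoncentrated measure. -/
lemma exists_kolmogorov_of_hasSmallMoments {δ h : ℝ} (hδ : 0 < δ) (hh : 0 < h) (hh2 : h ≤ 1 / 2) :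
    ∃ q : ℕ, ∃ δ' : ℝ, 0 < δ' ∧ ∀ (ι : Type) [Fintype ι] (w ρ υ ν : ι → ℝ),
      (∀ i, 0 ≤ ρ i) → (∀ i, 0 ≤ υ i) → (∀ i, ρ i + υ i ≤ ν i) →
      HasSmallMoments q δ' w (fun i => ρ i - υ i) ν →
      (∀ a, ∑ i, υ i * (if a ≤ w i ∧ w i < a + h then 1 else 0) ≤ δ) →
      ∀ τ, |(∑ i, ρ i * (if w i < τ then 1 else 0)) - ∑ i, υ i * (if w i < τ then 1 else 0)| ≤
        4 * δ := by
  set P : ℝ := max 1 (368 / δ) with hPdef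
  have hP1 : 1 ≤ P := le_max_left _ _
  have hP0 : 0 < P := by linarith
  have hPδ : 368 / P ^ 2 ≤ δ := by
    have h1 : 368 / δ ≤ P := le_max_right _ _
    rw [div_le_iff₀ hδ] at h1
    rw [div_le_iff₀ (by positivity)]
    nlinarith
  obtain ⟨q, δ', hδ', H⟩ := momentControlled_sineStep P h δ hδ
  refine ⟨max q 1, min δ' δ, lt_min hδ' hδ, fun ι _ w ρ υ ν hρ hυ hν hm hac τ => ?_⟩
  have hstep := H ι w _ ν (hm.mono (le_max_left _ _) (min_le_left _ _))
  have htail := (hm.sum_tail_le (le_max_right _ _) hP0).trans hPδ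
  set I : ι → ℝ := fun i => if P / 4 < |w i| then 1 else 0 with hI
  have hI0 : ∀ i, 0 ≤ I i := fun i => by rw [hI]; dsimp only; split_ifs <;> norm_num
  have hρI : ∑ i, ρ i * I i ≤ δ := le_trans (Finset.sum_le_sum fun i _ => by
    have := hυ i; have := hν i; have := hI0 i; nlinarith) htail
  have hυI : ∑ i, υ i * I i ≤ δ := le_trans (Finset.sum_le_sum fun i _ => by
    have := hρ i; have := hν i; have := hI0 i; nlinarith) htail
  have hdiff : ∀ g : ι → ℝ, ∑ i, (ρ i - υ i) * g i = ∑ i, ρ i * g i - ∑ i, υ i * g i := by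
    intro g; rw [← Finset.sum_sub_distrib]; exact Finset.sum_congr rfl fun _ _ => sub_mul _ _ _
  have hw1 : ∀ i, w i < τ ∨ τ ≤ w i := fun i => lt_or_ge _ _
  rcases lt_or_ge (P / 4) τ with hτ | hτ
  · have h0 := hm.2.1 0 (Nat.zero_le _)
    simp only [pow_zero] at h0
    have h0' : |∑ i, (ρ i - υ i) * 1| ≤ δ := h0.trans (min_le_right _ _)
    rw [hdiff] at h0'
    have key : ∀ g : ι → ℝ, (∀ i, 0 ≤ g i) → ∑ i, g i * I i ≤ δ →
        ∑ i, g i * 1 - δ ≤ ∑ i, g i * (if w i < τ then 1 else 0) ∧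
        ∑ i, g i * (if w i < τ then 1 else 0) ≤ ∑ i, g i * 1 := by
      intro g hg hgI
      constructor
      · have : ∑ i, g i * 1 ≤ ∑ i, (g i * (if w i < τ then 1 else 0) + g i * I i) := by
          refine Finset.sum_le_sum fun i _ => ?_
          have h1 := hg i
          rw [hI]; dsimp only
          split_ifs with c1 c2 c2
          · linarith
          · linarith
          · linarith
          · exact absurd (le_abs_self (w i)) (by push Not at *; linarith)
        rw [Finset.sum_add_distrib] at this
        linarith
      · refine Finset.sum_le_sum fun i _ => ?_
        have h1 := hg i
        split_ifs <;> linarith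
    obtain ⟨a1, a2⟩ := key ρ hρ hρI
    obtain ⟨b1, b2⟩ := key υ hυ hυI
    rw [abs_le] at h0' ⊢
    constructor <;> linarith [h0'.1, h0'.2]
  rcases lt_or_ge τ (-(P / 4)) with hτ' | hτ'
  · have key : ∀ g : ι → ℝ, (∀ i, 0 ≤ g i) → ∑ i, g i * I i ≤ δ →
        0 ≤ ∑ i, g i * (if w i < τ then 1 else 0) ∧
        ∑ i, g i * (if w i < τ then 1 else 0) ≤ δ := by
      intro g hg hgI
      constructor
      · refine Finset.sum_nonneg fun i _ => ?_
        have := hg i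
        split_ifs <;> linarith
      · refine (Finset.sum_le_sum fun i _ => ?_).trans hgI
        have h1 := hg i
        rw [hI]; dsimp only
        split_ifs with c1 c2 c2
        · linarith
        · exact absurd (neg_le_abs (w i)) (by push Not at *; linarith)
        · linarith
        · linarith
    obtain ⟨a1, a2⟩ := key ρ hρ hρI
    obtain ⟨b1, b2⟩ := key υ hυ hυI
    rw [abs_le]
    constructor <;> linarith
  · have lower : ∀ i, (if w i < τ then 1 else 0) ≤ sineStep P h (w i - τ) + I i := by
      intro i
      have h1 := sineStep_nonneg P h (w i - τ)
      have h2 := hI0 i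
      split_ifs with c
      · by_cases c2 : P / 4 < |w i|
        · have : I i = 1 := if_pos c2
          linarith
        · push Not at c2
          have := (abs_le.1 c2).1
          rw [sineStep_eq_one hP0 hh (by linarith) (by linarith)]
          linarith
      · linarith
    have upper : ∀ i (σ : ℝ), -(P / 4) - h ≤ σ → sineStep P h (w i - σ) ≤
        (if w i < σ + h then 1 else 0) + I i := by
      intro i σ hσ
      have h1 := sineStep_le_one P h (w i - σ)
      have h2 := hI0 i
      split_ifs with c
      · linarith
      · by_cases c2 : P / 4 < |w i|
        · have : I i = 1 := if_pos c2
          linarith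
        · push Not at c2 c
          have := (abs_le.1 c2).2
          rw [sineStep_eq_zero hP0 hh (by linarith) (by linarith)]
          linarith
    have lower' : ∀ i, (if w i < τ - h then 1 else 0) ≤ sineStep P h (w i - (τ - h)) + I i := by
      intro i
      have h1 := sineStep_nonneg P h (w i - (τ - h))
      have h2 := hI0 i
      split_ifs with c
      · by_cases c2 : P / 4 < |w i|
        · have : I i = 1 := if_pos c2
          linarith
        · push Not at c2
          have := (abs_le.1 c2).1
          rw [sineStep_eq_one hP0 hh (by linarith) (by linarith)]
          linarith
      · linarith
    have mono : ∀ (g u v : ι → ℝ), (∀ i, 0 ≤ g i) → ∑ i, g i * I i ≤ δ → (∀ i, u i ≤ v i + I i) →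
        ∑ i, g i * u i ≤ ∑ i, g i * v i + δ := by
      intro g u v hg hgI huv
      have : ∑ i, g i * u i ≤ ∑ i, (g i * v i + g i * I i) :=
        Finset.sum_le_sum fun i _ => by rw [← mul_add]; exact mul_le_mul_of_nonneg_left (huv i) (hg i)
      rw [Finset.sum_add_distrib] at this
      linarith
    have window : ∀ a, ∑ i, υ i * (if w i < a + h then 1 else 0) ≤
        ∑ i, υ i * (if w i < a then 1 else 0) + δ := by
      intro a
      have : ∑ i, υ i * (if w i < a + h then 1 else 0) ≤ ∑ i, (υ i * (if w i < a then 1 else 0) +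
          υ i * (if a ≤ w i ∧ w i < a + h then 1 else 0)) := by
        refine Finset.sum_le_sum fun i _ => ?_
        have h1 := hυ i
        by_cases c1 : w i < a + h <;> by_cases c2 : w i < a <;>
          simp [c1, c2, not_lt.1, not_le.2, h1]
      rw [Finset.sum_add_distrib] at this
      linarith [hac a]
    have s1 := hstep τ
    have s2 := hstep (τ - h)
    rw [hdiff, abs_le] at s1 s2
    have a1 := mono ρ _ _ hρ hρI lower
    have a2 := mono υ _ _ hυ hυI (fun i => upper i τ (by linarith))
    have a3 := window τ
    have b1 := mono ρ _ _ hρ hρI (fun i => upper i (τ - h) (by linarith))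
    have b2 := mono υ _ _ hυ hυI lower'
    have b3 := window (τ - h)
    rw [sub_add_cancel] at b3 b1
    rw [abs_le]
    constructor <;> linarith [s1.1, s1.2, s2.1, s2.2]

lemma centralBinom_sq_mul_le (k : ℕ) : k.centralBinom ^ 2 * (3 * k + 1) ≤ 16 ^ k := by
  induction k with
  | zero => simp
  | succ k ih =>
    have h := Nat.succ_mul_centralBinom_succ k
    refine Nat.le_of_mul_le_mul_left ?_ (by positivity : 0 < (k + 1) ^ 2 * (3 * k + 1))
    calc (k + 1) ^ 2 * (3 * k + 1) * ((k + 1).centralBinom ^ 2 * (3 * (k + 1) + 1))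
        = ((k + 1) * (k + 1).centralBinom) ^ 2 * ((3 * k + 1) * (3 * k + 4)) := by ring
      _ = (k.centralBinom ^ 2 * (3 * k + 1)) * (4 * (2 * k + 1) ^ 2 * (3 * k + 4)) := by
          rw [h]; ring
      _ ≤ 16 ^ k * (16 * (k + 1) ^ 2 * (3 * k + 1)) := by
          refine Nat.mul_le_mul ih ?_
          nlinarith
      _ = (k + 1) ^ 2 * (3 * k + 1) * 16 ^ (k + 1) := by ring

lemma mul_choose_half_sq_le (n : ℕ) : n * n.choose (n / 2) ^ 2 ≤ 4 ^ n := by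
  rcases Nat.even_or_odd' n with ⟨k, rfl | rfl⟩
  · rw [Nat.mul_div_cancel_left k two_pos, ← Nat.centralBinom_eq_two_mul_choose, pow_mul]
    have := centralBinom_sq_mul_le k
    norm_num
    nlinarith [Nat.zero_le (k.centralBinom ^ 2)]
  · have h1 := centralBinom_sq_mul_le (k + 1)
    have h2 : (k + 1).centralBinom = 2 * (2 * k + 1).choose k := by
      rw [Nat.centralBinom_eq_two_mul_choose, show 2 * (k + 1) = 2 * k + 1 + 1 by ring,
        Nat.choose_succ_succ, Nat.choose_symm_half]
      ring
    rw [h2] at h1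
    rw [show (2 * k + 1) / 2 = k by omega]
    have h3 : (16 : ℕ) ^ (k + 1) = 4 * 4 ^ (2 * k + 1) := by
      rw [show (16 : ℕ) = 4 ^ 2 by norm_num, ← pow_mul]; ring
    rw [h3] at h1
    nlinarith [Nat.zero_le ((2 * k + 1).choose k ^ 2)]

section Kolmogorov

variable {m n : ℕ}

lemma choose_half_div_le (hn : 0 < n) : (n.choose (n / 2) : ℝ) / 2 ^ n ≤ 1 / √n := by
  have hs : 0 < √(n : ℝ) := Real.sqrt_pos.2 (by exact_mod_cast hn)
  have h : (n : ℝ) * (n.choose (n / 2) : ℝ) ^ 2 ≤ 4 ^ n := by exact_mod_cast mul_choose_half_sq_le n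
  rw [div_le_div_iff₀ (by positivity) hs, one_mul]
  refine (sq_le_sq₀ (by positivity) (by positivity)).1 ?_
  rw [mul_pow, Real.sq_sqrt (Nat.cast_nonneg n), ← pow_mul, mul_comm n 2, pow_mul]
  norm_num
  linarith

lemma cubeAvg_window_normSum_le (hn : 0 < n) {h : ℝ} (hh : 0 ≤ h) (a : ℝ) :
    cubeAvg (fun y : Fin n → Bool => if a ≤ normSum y ∧ normSum y < a + h then (1 : ℝ) else 0) ≤
      h / 2 + 1 / √n := by
  have hs : 0 < √(n : ℝ) := Real.sqrt_pos.2 (by exact_mod_cast hn)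
  set S := Finset.univ.filter fun y : Fin n → Bool => a ≤ normSum y ∧ normSum y < a + h with hS
  set u : ℝ := (n - (a + h) * √n) / 2 with hu
  set v : ℝ := (n - a * √n) / 2 with hv
  have huv : v - u = h * √n / 2 := by rw [hu, hv]; ring
  have hmaps : ∀ y ∈ S, (hw y : ℤ) ∈ Finset.Ioc ⌊u⌋ ⌊v⌋ := by
    intro y hy
    obtain ⟨h1, h2⟩ := (Finset.mem_filter.1 hy).2
    rw [normSum, le_div_iff₀ hs, signSum_eq] at h1
    rw [normSum, div_lt_iff₀ hs, signSum_eq] at h2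
    rw [Finset.mem_Ioc, Int.floor_lt, Int.le_floor]
    push_cast
    constructor
    · rw [hu]; linarith
    · rw [hv]; linarith
  have hcard : S.card ≤ n.choose (n / 2) * (Finset.Ioc ⌊u⌋ ⌊v⌋).card := by
    refine Finset.card_le_mul_card_image_of_maps_to hmaps _ fun k _ => ?_
    rcases lt_or_ge k 0 with hk | hk
    · rw [Finset.filter_false_of_mem (fun y _ => by omega)]; simp
    · lift k to ℕ using hk
      refine (Finset.card_le_card (t := Finset.univ.filter fun y : Fin n → Bool => hw y = k) ?_).trans
        ((card_hw_eq k).le.trans (Nat.choose_le_middle k n))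
      intro y hy
      exact Finset.mem_filter.2 ⟨Finset.mem_univ _, by exact_mod_cast (Finset.mem_filter.1 hy).2⟩
  have hIoc : ((Finset.Ioc ⌊u⌋ ⌊v⌋).card : ℝ) ≤ h * √n / 2 + 1 := by
    have h0 : ⌊u⌋ ≤ ⌊v⌋ := Int.floor_mono (by rw [← sub_nonneg, huv]; positivity)
    rw [Int.card_Ioc]
    have : (((⌊v⌋ - ⌊u⌋).toNat : ℤ) : ℝ) = ((⌊v⌋ - ⌊u⌋ : ℤ) : ℝ) := by
      rw [Int.toNat_of_nonneg (by omega)]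
    rw [Int.cast_natCast] at this
    rw [this]
    push_cast
    linarith [Int.floor_le v, Int.lt_floor_add_one u]
  have hc := choose_half_div_le hn
  have e : cubeAvg (fun y : Fin n → Bool => if a ≤ normSum y ∧ normSum y < a + h then (1 : ℝ) else 0)
      = S.card / 2 ^ n := by
    rw [cubeAvg, hS, Finset.sum_boole]
  rw [e]
  calc (S.card : ℝ) / 2 ^ n ≤ (n.choose (n / 2) * (Finset.Ioc ⌊u⌋ ⌊v⌋).card : ℝ) / 2 ^ n := by
        gcongr; exact_mod_cast hcard
    _ = (n.choose (n / 2) : ℝ) / 2 ^ n * (Finset.Ioc ⌊u⌋ ⌊v⌋).card := by ring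
    _ ≤ 1 / √n * (h * √n / 2 + 1) := by gcongr
    _ = h / 2 + 1 / √n := by field_simp

/-- The fraction of strings of weight above `t`. -/
def unifTail (n : ℕ) (t : ℝ) : ℝ :=
  ((Finset.univ.filter fun y : Fin n → Bool => t < (hw y : ℝ)).card : ℝ) / 2 ^ n

/-- The mass of even weight strings of weight above `t`. -/
def evenTail (g : (Fin n → Bool) → ℝ) (t : ℝ) : ℝ :=
  ∑ y ∈ Finset.univ.filter (fun y : Fin n → Bool => t < (hw y : ℝ) ∧ Even (hw y)), g y

/-- The mass of odd weight strings of weight above `t`. -/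
def oddTail (g : (Fin n → Bool) → ℝ) (t : ℝ) : ℝ :=
  ∑ y ∈ Finset.univ.filter (fun y : Fin n → Bool => t < (hw y : ℝ) ∧ Odd (hw y)), g y

lemma lt_hw_iff (hn : 0 < n) (t : ℝ) (y : Fin n → Bool) :
    t < (hw y : ℝ) ↔ normSum y < (n - 2 * t) / √n := by
  have hs : 0 < √(n : ℝ) := Real.sqrt_pos.2 (by exact_mod_cast hn)
  rw [normSum, div_lt_div_iff_of_pos_right hs, signSum_eq]
  constructor <;> intro h <;> linarith

lemma unifTail_eq (t : ℝ) :
    unifTail n t = ∑ y : Fin n → Bool, ((2 : ℝ) ^ n)⁻¹ * (if t < (hw y : ℝ) then 1 else 0) := by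
  rw [unifTail, ← Finset.mul_sum, Finset.sum_boole, div_eq_inv_mul]

lemma evenTail_eq (g : (Fin n → Bool) → ℝ) (t : ℝ) :
    evenTail g t = ∑ y, g y * (1 + walsh Finset.univ y) / 2 * (if t < (hw y : ℝ) then 1 else 0) := by
  rw [evenTail, Finset.sum_filter]
  refine Finset.sum_congr rfl fun y _ => ?_
  rw [walsh_univ]
  rcases Nat.even_or_odd (hw y) with h | h
  · simp [h, h.neg_one_pow]; split_ifs <;> ring
  · simp [h.neg_one_pow, Nat.not_even_iff_odd.2 h]

lemma oddTail_eq (g : (Fin n → Bool) → ℝ) (t : ℝ) :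
    oddTail g t = ∑ y, g y * (1 - walsh Finset.univ y) / 2 * (if t < (hw y : ℝ) then 1 else 0) := by
  rw [oddTail, Finset.sum_filter]
  refine Finset.sum_congr rfl fun y _ => ?_
  rw [walsh_univ]
  rcases Nat.even_or_odd (hw y) with h | h
  · simp [h.neg_one_pow, Nat.not_odd_iff_even.2 h]
  · simp [h, h.neg_one_pow]; split_ifs <;> ring

/-- The tails of `f(U)`, split by parity, are close to mixtures of the uniform tail when `f` has
few biased characters and its output parity is nearly uncorrelated with low-degree characters. -/
theorem exists_kolmogorov_of_hasFewBiases (d : ℕ) {δ : ℝ} (hδ : 0 < δ) :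
    ∃ Q : ℕ, ∃ δ₁ : ℝ, ∃ r : ℕ, ∃ ε : ℝ, ∃ N : ℕ, 0 < δ₁ ∧ 0 < ε ∧ ∀ n, N ≤ n → ∀ m,
      ∀ f : (Fin m → Bool) → (Fin n → Bool), IsLocal d f → HasFewBiases Q δ₁ f →
      HasSmallParity r ε f → ∃ η : ℝ, 0 ≤ η ∧ η ≤ 1 ∧
        ∀ t, |evenTail (law f) t - η * unifTail n t| ≤ δ ∧
          |oddTail (law f) t - (1 - η) * unifTail n t| ≤ δ := by
  set h : ℝ := min (1 / 2) (δ / 4) with hh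
  have hh0 : 0 < h := by positivity
  obtain ⟨q, δ', hδ', H⟩ := exists_kolmogorov_of_hasSmallMoments (δ := δ / 4) (by positivity) hh0
    (min_le_left _ _)
  obtain ⟨Q, δ₁, r, ε, hδ₁, hε, HM⟩ := exists_moments_close d q δ' hδ'
  obtain ⟨N₀, hN₀⟩ := exists_nat_gt ((8 / δ) ^ 2)
  refine ⟨Q, δ₁, r, ε, max (Q + 1) (N₀ + 1), hδ₁, hε, fun n hn m f hf hfew hpar => ?_⟩
  have hn0 : 0 < n := by have := le_max_left (Q + 1) (N₀ + 1); omega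
  obtain ⟨m1, m2, m3⟩ := HM n ((le_max_left _ _).trans hn) m f hf hfew hpar
  set χ := cubeAvg (fun x => walsh Finset.univ (f x)) with hχ
  have hχ1 : |χ| ≤ 1 :=
    (abs_cubeAvg_le _).trans_eq (by simp only [abs_walsh, cubeAvg_const])
  rw [abs_le] at hχ1
  have hs : 0 < √(n : ℝ) := Real.sqrt_pos.2 (by exact_mod_cast hn0)
  have hwin : h / 2 + 1 / √n ≤ δ / 4 := by
    have h1 : h ≤ δ / 4 := min_le_right _ _
    have h2 : 8 / δ ≤ √n := by
      refine Real.le_sqrt_of_sq_le (hN₀.le.trans ?_)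
      exact_mod_cast (by have := le_max_right (Q + 1) (N₀ + 1); omega : N₀ ≤ n)
    have h3 : 1 / √(n : ℝ) ≤ δ / 8 := by
      rw [div_le_iff₀ hδ] at h2
      rw [div_le_iff₀ hs]
      linarith
    linarith
  have hu : (0 : ℝ) < ((2 : ℝ) ^ n)⁻¹ := by positivity
  have hwalsh : ∀ y : Fin n → Bool, -1 ≤ walsh Finset.univ y ∧ walsh Finset.univ y ≤ 1 := fun y =>
    abs_le.1 (abs_walsh _ _).le
  have key : ∀ s : ℝ, (s = 1 ∨ s = -1) → ∀ τ : ℝ,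
      |(∑ y : Fin n → Bool, law f y * (1 + s * walsh Finset.univ y) / 2 *
        (if normSum y < τ then 1 else 0)) - ∑ y : Fin n → Bool, ((1 + s * χ) / 2 * ((2 : ℝ) ^ n)⁻¹) *
        (if normSum y < τ then 1 else 0)| ≤ δ := by
    intro s hs' τ
    have hsχ : 0 ≤ (1 + s * χ) / 2 ∧ (1 + s * χ) / 2 ≤ 1 := by
      rcases hs' with rfl | rfl <;> constructor <;> linarith [hχ1.1, hχ1.2]
    have hsw : ∀ y : Fin n → Bool,
        0 ≤ (1 + s * walsh Finset.univ y) / 2 ∧ (1 + s * walsh Finset.univ y) / 2 ≤ 1 := by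
      intro y
      rcases hs' with rfl | rfl <;> constructor <;> linarith [(hwalsh y).1, (hwalsh y).2]
    have hρ : ∀ y, 0 ≤ law f y * (1 + s * walsh Finset.univ y) / 2 := fun y => by
      rw [mul_div_assoc]; exact mul_nonneg (law_nonneg f y) (hsw y).1
    have hυ : 0 ≤ (1 + s * χ) / 2 * ((2 : ℝ) ^ n)⁻¹ := mul_nonneg hsχ.1 hu.le
    have hsum : ∀ y, law f y * (1 + s * walsh Finset.univ y) / 2 +
        (1 + s * χ) / 2 * ((2 : ℝ) ^ n)⁻¹ ≤ law f y + ((2 : ℝ) ^ n)⁻¹ := fun y => by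
      have h1 := mul_le_mul_of_nonneg_left (hsw y).2 (law_nonneg f y)
      have h2 := mul_le_mul_of_nonneg_right hsχ.2 hu.le
      linarith
    refine (H (Fin n → Bool) normSum _ _ (fun y => law f y + ((2 : ℝ) ^ n)⁻¹) hρ (fun _ => hυ) hsum
      ⟨fun y => ?_, fun j hj => ?_, fun j hj t ht => m3 j hj t ht⟩ (fun a => ?_) τ).trans (by linarith)
    · have := hsum y; have := hρ y
      rw [abs_le]; constructor <;> linarith
    · have e : ∑ y : Fin n → Bool, (law f y * (1 + s * walsh Finset.univ y) / 2 -
          (1 + s * χ) / 2 * ((2 : ℝ) ^ n)⁻¹) * normSum y ^ j =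
          1 / 2 * (∑ y, (law f y - ((2 : ℝ) ^ n)⁻¹) * normSum y ^ j) +
          s / 2 * (∑ y, (law f y * walsh Finset.univ y - χ * ((2 : ℝ) ^ n)⁻¹) * normSum y ^ j) := by
        rw [Finset.mul_sum, Finset.mul_sum, ← Finset.sum_add_distrib]
        exact Finset.sum_congr rfl fun _ _ => by ring
      rw [e]
      have a1 := abs_le.1 (m1 j hj)
      have a2 := abs_le.1 (m2 j hj)
      rw [abs_le]
      rcases hs' with rfl | rfl <;> constructor <;> linarith [a1.1, a1.2, a2.1, a2.2]
    · calc _ ≤ ∑ y : Fin n → Bool, ((2 : ℝ) ^ n)⁻¹ *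
            (if a ≤ normSum y ∧ normSum y < a + h then 1 else 0) := by
            refine Finset.sum_le_sum fun y _ => mul_le_mul_of_nonneg_right ?_ (by split_ifs <;> norm_num)
            have h2 := mul_le_mul_of_nonneg_right hsχ.2 hu.le
            linarith
        _ ≤ δ / 4 := by
            rw [sum_const_mul_eq_cubeAvg]
            exact (cubeAvg_window_normSum_le hn0 hh0.le a).trans hwin
  refine ⟨(1 + χ) / 2, by linarith [hχ1.1], by linarith [hχ1.2], fun t => ⟨?_, ?_⟩⟩
  · have := key 1 (Or.inl rfl) ((n - 2 * t) / √n)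
    simp only [← lt_hw_iff hn0, one_mul, mul_assoc, ← Finset.mul_sum] at this
    rw [evenTail_eq, unifTail_eq, ← Finset.mul_sum]
    simpa only [mul_assoc] using this
  · have := key (-1) (Or.inr rfl) ((n - 2 * t) / √n)
    simp only [← lt_hw_iff hn0, mul_assoc, ← Finset.mul_sum] at this
    rw [oddTail_eq, unifTail_eq, ← Finset.mul_sum]
    convert this using 3
    · refine Finset.sum_congr rfl fun y _ => ?_
      ring
    · ring

end Kolmogorov

section Splitting

variable {m n : ℕ}

lemma sum_union_le_add {α : Type*} [DecidableEq α] {D : α → ℝ} (hD : ∀ y, 0 ≤ D y) (s t : Finset α) :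
    ∑ y ∈ s ∪ t, D y ≤ ∑ y ∈ s, D y + ∑ y ∈ t, D y := by
  rw [← Finset.sum_union_inter]
  linarith [Finset.sum_nonneg (s := s ∩ t) fun y _ => hD y]

lemma sum_biUnion_le_card_mul {α ι : Type*} [DecidableEq α] [DecidableEq ι] {D : α → ℝ}
    (hD : ∀ y, 0 ≤ D y) (s : Finset ι) (A : ι → Finset α) {κ : ℝ}
    (hA : ∀ i, ∑ y ∈ A i, D y ≤ κ) : ∑ y ∈ s.biUnion A, D y ≤ s.card * κ := by
  induction s using Finset.induction_on with
  | empty => simp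
  | insert i s hi ih =>
    rw [Finset.biUnion_insert, Finset.card_insert_of_notMem hi]
    refine (sum_union_le_add hD _ _).trans ?_
    push_cast
    linarith [hA i]

/-- The tails of `g`, split by parity, are close to a mixture of multiples of the uniform tail. -/
def IsGoodPart (δ : ℝ) (g : (Fin n → Bool) → ℝ) : Prop :=
  (∀ y, 0 ≤ g y) ∧ ∃ η : ℝ, 0 ≤ η ∧ η ≤ ∑ y, g y ∧
    ∀ t, |evenTail g t - η * unifTail n t| ≤ δ * ∑ y, g y ∧
      |oddTail g t - (∑ y, g y - η) * unifTail n t| ≤ δ * ∑ y, g y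

lemma isGoodPart_zero (δ : ℝ) : IsGoodPart δ (fun _ : Fin n → Bool => (0 : ℝ)) :=
  ⟨fun _ => le_rfl, 0, le_rfl, by simp, fun t => by simp [evenTail, oddTail]⟩

lemma IsGoodPart.cubeAvg {δ : ℝ} {g : (Fin m → Bool) → (Fin n → Bool) → ℝ}
    (hg : ∀ σ, IsGoodPart δ (g σ)) : IsGoodPart δ (fun y => cubeAvg fun σ => g σ y) := by
  choose h0 η hη0 hη1 H using hg
  have hsum : ∑ y, _root_.cubeAvg (fun σ => g σ y) = _root_.cubeAvg fun σ => ∑ y, g σ y :=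
    (cubeAvg_sum Finset.univ fun y σ => g σ y).symm
  have heven : ∀ t, evenTail (fun y => _root_.cubeAvg fun σ => g σ y) t =
      _root_.cubeAvg fun σ => evenTail (g σ) t := fun t =>
    (cubeAvg_sum _ fun y σ => g σ y).symm
  have hodd : ∀ t, oddTail (fun y => _root_.cubeAvg fun σ => g σ y) t =
      _root_.cubeAvg fun σ => oddTail (g σ) t := fun t =>
    (cubeAvg_sum _ fun y σ => g σ y).symm
  refine ⟨fun y => cubeAvg_nonneg fun σ => h0 σ y, _root_.cubeAvg η, cubeAvg_nonneg hη0, ?_, fun t => ?_⟩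
  · rw [hsum]; exact cubeAvg_mono hη1
  · rw [hsum, heven, hodd, ← cubeAvg_mul_const, ← cubeAvg_sub, ← cubeAvg_sub, ← cubeAvg_mul_const,
      ← cubeAvg_sub, ← cubeAvg_const_mul]
    exact ⟨(abs_cubeAvg_le _).trans (cubeAvg_mono fun σ => (H σ t).1),
      (abs_cubeAvg_le _).trans (cubeAvg_mono fun σ => (H σ t).2)⟩

/-- A splitting of `p` into a good part, a part detected by a test of `D`-mass at most `κ`, and a
remainder whose mass is controlled by the potential inequality. -/
def HasSplitting (D : (Fin n → Bool) → ℝ) (δ κ ρ e : ℝ) (p : (Fin n → Bool) → ℝ) : Prop :=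
  ∃ g b r : (Fin n → Bool) → ℝ, IsGoodPart δ g ∧ (∀ y, 0 ≤ b y) ∧ (∀ y, 0 ≤ r y) ∧
    (∀ y, p y = g y + b y + r y) ∧
    (∃ A : Finset (Fin n → Bool), ∑ y ∈ A, D y ≤ κ ∧ ∑ y, b y ≤ 2 * ∑ y ∈ A, b y) ∧
    ρ * ∑ y, r y + e ≤ 1 + ∑ y, b y

lemma law_eq_cubeAvg_law_overwrite (f : (Fin m → Bool) → (Fin n → Bool)) (T : Finset (Fin m))
    (y : Fin n → Bool) : law f y = cubeAvg fun σ => law (fun x => f (overwrite T σ x)) y :=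
  (cubeAvg_overwrite T fun x => if f x = y then (1 : ℝ) else 0).symm

lemma sum_mem_law (f : (Fin m → Bool) → (Fin n → Bool)) (A : Finset (Fin n → Bool)) :
    ∑ y ∈ A, law f y = cubeAvg fun x => if f x ∈ A then (1 : ℝ) else 0 := by
  rw [← sum_law_mul f fun y => if y ∈ A then (1 : ℝ) else 0]
  simp [Finset.sum_ite_mem]

/-- The squared bias of the output parity. -/
def sqParityBias (f : (Fin m → Bool) → (Fin n → Bool)) : ℝ :=
  (cubeAvg fun x => walsh Finset.univ (f x)) ^ 2

lemma sqParityBias_nonneg (f : (Fin m → Bool) → (Fin n → Bool)) : 0 ≤ sqParityBias f := sq_nonneg _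

lemma sqParityBias_le_one (f : (Fin m → Bool) → (Fin n → Bool)) : sqParityBias f ≤ 1 := by
  rw [sqParityBias, sq_le_one_iff_abs_le_one]
  exact (abs_cubeAvg_le _).trans_eq (by simp only [abs_walsh, cubeAvg_const])

open scoped Classical in
/-- Splittings of the restrictions of `f` combine to a splitting of `f`, where restrictions
satisfying `bad` are detected by a common test. -/
lemma HasSplitting.of_overwrite {D : (Fin n → Bool) → ℝ} (hD : ∀ y, 0 ≤ D y) {δ κ κ₀ ρ c : ℝ}
    (hκ : 0 ≤ κ) (hc : 0 ≤ c) (f : (Fin m → Bool) → (Fin n → Bool)) (T : Finset (Fin m))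
    (bad : ((Fin m → Bool) → (Fin n → Bool)) → Prop) (A₀ : Finset (Fin n → Bool))
    (hA₀ : ∑ y ∈ A₀, D y ≤ κ₀)
    (hbad : ∀ σ, bad (fun x => f (overwrite T σ x)) →
      1 / 2 ≤ ∑ y ∈ A₀, law (fun x => f (overwrite T σ x)) y)
    (hsplit : ∀ σ, HasSplitting D δ κ ρ (sqParityBias fun x => f (overwrite T σ x))
      (law fun x => f (overwrite T σ x)))
    (hpot : c + sqParityBias f ≤
      cubeAvg (fun σ => if bad (fun x => f (overwrite T σ x)) then (1 : ℝ) else 0) +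
      cubeAvg (fun σ => sqParityBias fun x => f (overwrite T σ x))) :
    HasSplitting D δ (κ₀ + 2 ^ T.card * κ) (ρ + c) (sqParityBias f) (law f) := by
  set F : (Fin m → Bool) → (Fin m → Bool) → (Fin n → Bool) := fun σ x => f (overwrite T σ x) with hF
  set res : (Fin m → Bool) → (Fin m → Bool) :=
    fun σ => indicatorString (T.filter fun i => σ i = true) with hres
  have hFres : ∀ σ, F (res σ) = F σ := by
    intro σ
    funext x
    simp only [hF]
    congr 1
    funext i
    by_cases hi : i ∈ T <;> simp [overwrite, hres, indicatorString, hi]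
  have H : ∀ σ, ∃ g b r : (Fin n → Bool) → ℝ, IsGoodPart δ g ∧ (∀ y, 0 ≤ b y) ∧ (∀ y, 0 ≤ r y) ∧
      (∀ y, law (F σ) y = g y + b y + r y) ∧
      (∃ A : Finset (Fin n → Bool), ∑ y ∈ A, D y ≤ κ ∧ ∑ y, b y ≤ 2 * ∑ y ∈ A₀ ∪ A, b y) ∧
      ρ * ∑ y, r y + sqParityBias (F σ) + (if bad (F σ) then 1 else 0) ≤ 1 + ∑ y, b y := by
    intro σ
    by_cases hb : bad (F σ)
    · refine ⟨fun _ => 0, law (F σ), fun _ => 0, isGoodPart_zero δ, law_nonneg _, fun _ => le_rfl,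
        fun y => by ring, ⟨∅, by simpa using hκ, ?_⟩, ?_⟩
      · rw [Finset.union_empty, sum_law]
        linarith [hbad σ hb]
      · rw [if_pos hb, sum_law]
        simp only [Finset.sum_const_zero, mul_zero]
        linarith [sqParityBias_le_one (F σ)]
    · obtain ⟨g, b, r, hg, hb0, hr0, hp, ⟨A, hA, hAb⟩, hρ⟩ := hsplit σ
      refine ⟨g, b, r, hg, hb0, hr0, hp, ⟨A, hA, hAb.trans ?_⟩, by rw [if_neg hb]; linarith⟩
      have := Finset.sum_le_sum_of_subset_of_nonneg (Finset.subset_union_right (s₁ := A₀) (s₂ := A))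
        fun y _ _ => hb0 y
      linarith
  choose g b r hg hb0 hr0 hp hA hρ using H
  choose A hA hAb using hA
  have hsum : ∀ (u : (Fin m → Bool) → (Fin n → Bool) → ℝ) (S : Finset (Fin n → Bool)),
      ∑ y ∈ S, cubeAvg (fun σ => u (res σ) y) = cubeAvg fun σ => ∑ y ∈ S, u (res σ) y := fun u S =>
    (cubeAvg_sum S fun y σ => u (res σ) y).symm
  have hlaw : ∀ y, law f y = cubeAvg (fun σ => g (res σ) y) + cubeAvg (fun σ => b (res σ) y) +
      cubeAvg (fun σ => r (res σ) y) := by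
    intro y
    rw [law_eq_cubeAvg_law_overwrite f T y, ← cubeAvg_add, ← cubeAvg_add]
    congr 1
    funext σ
    rw [← hp, hFres]
  refine ⟨fun y => cubeAvg fun σ => g (res σ) y, fun y => cubeAvg fun σ => b (res σ) y,
    fun y => cubeAvg fun σ => r (res σ) y, IsGoodPart.cubeAvg fun σ => hg _,
    fun y => cubeAvg_nonneg fun σ => hb0 _ y, fun y => cubeAvg_nonneg fun σ => hr0 _ y, hlaw,
    ⟨A₀ ∪ T.powerset.biUnion fun Y => A (indicatorString Y), ?_, ?_⟩, ?_⟩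
  · refine (sum_union_le_add hD _ _).trans (add_le_add hA₀ ?_)
    refine (sum_biUnion_le_card_mul hD _ _ fun Y => hA _).trans (le_of_eq ?_)
    rw [Finset.card_powerset]
    push_cast
    ring
  · rw [hsum, hsum, ← cubeAvg_const_mul]
    refine cubeAvg_mono fun σ => (hAb (res σ)).trans ?_
    have hsub : A₀ ∪ A (res σ) ⊆ A₀ ∪ T.powerset.biUnion fun Y => A (indicatorString Y) := by
      refine Finset.union_subset_union_right ?_
      exact Finset.subset_biUnion_of_mem (fun Y => A (indicatorString Y))
        (Finset.mem_powerset.2 (Finset.filter_subset _ _))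
    have := Finset.sum_le_sum_of_subset_of_nonneg hsub fun y _ _ => hb0 (res σ) y
    linarith
  · rw [hsum, hsum]
    have h1 : cubeAvg (fun σ => ρ * ∑ y, r (res σ) y + sqParityBias (F σ) +
        (if bad (F σ) then 1 else 0)) ≤ cubeAvg (fun σ => 1 + ∑ y, b (res σ) y) := by
      refine cubeAvg_mono fun σ => ?_
      have := hρ (res σ)
      rwa [hFres] at this
    rw [cubeAvg_add, cubeAvg_add, cubeAvg_const_mul, cubeAvg_add, cubeAvg_const] at h1
    have h2 : cubeAvg (fun σ => ∑ y, r (res σ) y) ≤ 1 := by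
      rw [← cubeAvg_const (m := m) 1]
      refine cubeAvg_mono fun σ => ?_
      rw [← sum_law (F (res σ))]
      refine Finset.sum_le_sum fun y _ => ?_
      rw [hp]
      linarith [(hg (res σ)).1 y, hb0 (res σ) y]
    nlinarith

lemma HasSplitting.mono {D : (Fin n → Bool) → ℝ} {δ κ κ' ρ e : ℝ} {p : (Fin n → Bool) → ℝ}
    (h : HasSplitting D δ κ ρ e p) (hκ : κ ≤ κ') : HasSplitting D δ κ' ρ e p := by
  obtain ⟨g, b, r, hg, hb, hr, hp, ⟨A, hA, hAb⟩, hρ⟩ := h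
  exact ⟨g, b, r, hg, hb, hr, hp, ⟨A, hA.trans hκ, hAb⟩, hρ⟩

/-- A signed average of many characters is rarely large under a distribution with small biases. -/
lemma sum_signedAvg_le {D : (Fin n → Bool) → ℝ} (hD : ∀ y, 0 ≤ D y) (hD1 : ∑ y, D y = 1)
    {Q k : ℕ} (hkQ : k ≤ Q) {ε β : ℝ} (hε : 0 ≤ ε)
    (hβ : 0 < β)
    (hDw : ∀ T : Finset (Fin n), T.Nonempty → T.card ≤ 2 * Q → |∑ y, D y * walsh T y| ≤ ε)
    {𝓕 : Finset (Finset (Fin n))} (h𝓕 : 𝓕.Nonempty) (hk : ∀ K ∈ 𝓕, K.card = k)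
    {s : Finset (Fin n) → ℝ} (hs : ∀ K, |s K| = 1) :
    ∑ y ∈ Finset.univ.filter (fun y => β / 2 ≤ signedAvg 𝓕 s y), D y ≤
      4 / β ^ 2 * (1 / 𝓕.card + ε) := by
  have hc : (0 : ℝ) < 𝓕.card := by exact_mod_cast h𝓕.card_pos
  have hpair : ∀ K ∈ 𝓕, ∀ K' ∈ 𝓕, s K * s K' * ∑ y, D y * (walsh K y * walsh K' y) ≤
      (if K = K' then 1 else 0) + ε := by
    intro K hK K' hK'
    refine (le_abs_self _).trans ?_
    rw [abs_mul, abs_mul, hs, hs, one_mul, one_mul]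
    split_ifs with h
    · subst h
      simp only [walsh_mul_self, mul_one, hD1, abs_one]
      linarith
    · rw [zero_add]
      simp only [walsh_mul_walsh]
      refine hDw _ (Finset.nonempty_iff_ne_empty.2 fun h' => h (symmDiff_eq_bot.1 h')) ?_
      refine (Finset.card_le_card Finset.symmDiff_subset_union).trans
        ((Finset.card_union_le _ _).trans ?_)
      rw [hk K hK, hk K' hK']
      omega
  have hsecond : ∑ y, D y * signedAvg 𝓕 s y ^ 2 ≤ 1 / 𝓕.card + ε := by
    have e : ∑ y, D y * signedAvg 𝓕 s y ^ 2 =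
        (∑ K ∈ 𝓕, ∑ K' ∈ 𝓕, s K * s K' * ∑ y, D y * (walsh K y * walsh K' y)) / 𝓕.card ^ 2 := by
      simp only [Finset.mul_sum]
      rw [Finset.sum_congr rfl fun K _ => Finset.sum_comm, Finset.sum_comm, Finset.sum_div]
      refine Finset.sum_congr rfl fun y _ => ?_
      rw [signedAvg, div_pow, sq (∑ K ∈ 𝓕, s K * walsh K y), Finset.sum_mul_sum, ← mul_div_assoc,
        Finset.mul_sum]
      congr 1
      refine Finset.sum_congr rfl fun K _ => ?_
      rw [Finset.mul_sum]
      exact Finset.sum_congr rfl fun K' _ => by ring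
    have h1 : ∑ K ∈ 𝓕, ∑ K' ∈ 𝓕, s K * s K' * ∑ y, D y * (walsh K y * walsh K' y) ≤
        𝓕.card + 𝓕.card ^ 2 * ε := by
      refine (Finset.sum_le_sum fun K hK => Finset.sum_le_sum fun K' hK' =>
        hpair K hK K' hK').trans (le_of_eq ?_)
      simp only [Finset.sum_add_distrib, Finset.sum_const, nsmul_eq_mul]
      rw [Finset.sum_congr rfl fun K hK => Finset.sum_ite_eq 𝓕 K fun _ => (1 : ℝ),
        Finset.sum_congr rfl fun K hK => if_pos hK]
      simp
      ring
    rw [e, div_le_iff₀ (by positivity)]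
    refine h1.trans (le_of_eq ?_)
    field_simp
  calc ∑ y ∈ Finset.univ.filter (fun y => β / 2 ≤ signedAvg 𝓕 s y), D y
      ≤ ∑ y, 4 / β ^ 2 * (D y * signedAvg 𝓕 s y ^ 2) := by
        rw [Finset.sum_filter]
        refine Finset.sum_le_sum fun y _ => ?_
        have h0 := hD y
        split_ifs with h
        · have : 1 ≤ 4 / β ^ 2 * signedAvg 𝓕 s y ^ 2 := by
            rw [div_mul_eq_mul_div, le_div_iff₀ (by positivity)]
            nlinarith
          nlinarith
        · positivity
    _ ≤ 4 / β ^ 2 * (1 / 𝓕.card + ε) := by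
        rw [← Finset.mul_sum]
        gcongr

end Splitting

section Decomposition

variable {m n : ℕ}

/-- The law of a local function splits into a part with binomial-like tails, a part detected by a
test of small `D`-mass, and a small remainder. -/
theorem exists_hasSplitting (d : ℕ) {δ : ℝ} (hδ : 0 < δ) :
    ∃ ε₀ : ℝ, ∃ r₀ N : ℕ, 0 < ε₀ ∧ ∀ n, N ≤ n → ∀ m, ∀ f : (Fin m → Bool) → (Fin n → Bool),
      IsLocal d f → ∀ D : (Fin n → Bool) → ℝ, (∀ y, 0 ≤ D y) → ∑ y, D y = 1 →
      (∀ T : Finset (Fin n), T.Nonempty → T.card ≤ r₀ → |∑ y, D y * walsh T y| ≤ ε₀) →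
      ∃ ρ, 2 ≤ ρ * δ ∧ HasSplitting D δ δ ρ (sqParityBias f) (law f) := by
  obtain ⟨Q, δ₁, r, ε, N, hδ₁, hε, HK⟩ := exists_kolmogorov_of_hasFewBiases d hδ
  set β : ℝ := ((2 : ℝ) ^ (d * Q))⁻¹ / 2 with hβdef
  have hβ : 0 < β := by positivity
  obtain ⟨L₀, hL₀⟩ := exists_nat_gt (16 * ((d * Q : ℕ) : ℝ) / β ^ 2)
  set L := L₀ + 1 with hLdef
  have hL : 0 < L := Nat.succ_pos _
  have hL0 : (0 : ℝ) < L := by exact_mod_cast hL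
  have hLβ : 2 * ((d * Q : ℕ) : ℝ) / L ≤ β ^ 2 / 8 := by
    rw [div_lt_iff₀ (by positivity)] at hL₀
    rw [div_le_iff₀ hL0, hLdef]
    push_cast at hL₀ ⊢
    nlinarith [sq_nonneg β]
  set c : ℝ := min β (ε ^ 2) with hcdef
  have hc : 0 < c := lt_min hβ (by positivity)
  obtain ⟨R, hR⟩ := exists_nat_gt (2 / (δ * c))
  set t₀ := max (d * Q * L) r with ht₀
  set B : ℝ := 2 ^ t₀ + 1 with hB
  have hB0 : 1 ≤ B := by have : (0 : ℝ) < 2 ^ t₀ := by positivity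
                         linarith
  set κ₀ : ℝ := δ / B ^ R with hκ₀
  have hκ₀0 : 0 < κ₀ := by positivity
  set ε₀ : ℝ := β ^ 2 * κ₀ / 8 with hε₀
  have hε₀0 : 0 < ε₀ := by positivity
  obtain ⟨N₁, hN₁⟩ := exists_nat_gt ((1 / (δ₁ * ε₀)) ^ 2)
  refine ⟨ε₀, 2 * Q, max N (N₁ + 1), hε₀0, fun n hn m f hf D hD hD1 hDw => ?_⟩
  have hnN : N ≤ n := (le_max_left _ _).trans hn
  have hnN₁ : N₁ + 1 ≤ n := (le_max_right _ _).trans hn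
  have hn1 : (1 : ℝ) ≤ √n := Real.one_le_sqrt.2 (by exact_mod_cast (by omega : 1 ≤ n))
  have hsqrt : 1 / ε₀ ≤ δ₁ * √n := by
    have h1 : 1 / (δ₁ * ε₀) ≤ √n := by
      refine Real.le_sqrt_of_sq_le (hN₁.le.trans ?_)
      exact_mod_cast (by omega : N₁ ≤ n)
    rw [div_le_iff₀ (by positivity)] at h1 ⊢
    linarith
  have hsplit : ∀ R : ℕ, ∀ f : (Fin m → Bool) → (Fin n → Bool), IsLocal d f →
      HasSplitting D δ (B ^ R * κ₀) (R * c) (sqParityBias f) (law f) := by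
    intro R
    induction R with
    | zero =>
      intro f _
      refine ⟨fun _ => 0, fun _ => 0, law f, isGoodPart_zero δ, fun _ => le_rfl,
        law_nonneg f, fun y => by simp, ⟨∅, by simpa using hκ₀0.le, by simp⟩, ?_⟩
      simpa using sqParityBias_le_one f
    | succ R ih =>
      intro f hf
      have hκR : 0 ≤ B ^ R * κ₀ := by positivity
      have hκle : ∀ {T : Finset (Fin m)}, T.card ≤ t₀ →
          κ₀ + 2 ^ T.card * (B ^ R * κ₀) ≤ B ^ (R + 1) * κ₀ := by
        intro T hT
        have h1 : (2 : ℝ) ^ T.card ≤ 2 ^ t₀ := pow_le_pow_right₀ (by norm_num) hT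
        have h2 : 1 * κ₀ ≤ B ^ R * κ₀ := by gcongr; exact one_le_pow₀ hB0
        have h3 : B ^ (R + 1) * κ₀ = 2 ^ t₀ * (B ^ R * κ₀) + B ^ R * κ₀ := by rw [hB]; ring
        have h4 : (2 : ℝ) ^ T.card * (B ^ R * κ₀) ≤ 2 ^ t₀ * (B ^ R * κ₀) := by gcongr
        linarith
      have hρ : ((R + 1 : ℕ) : ℝ) * c = R * c + c := by push_cast; ring
      rw [hρ]
      by_cases hfew : HasFewBiases Q δ₁ f
      · by_cases hpar : HasSmallParity r ε f
        · obtain ⟨η, hη0, hη1, H⟩ := HK n hnN m f hf hfew hpar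
          refine ⟨law f, fun _ => 0, fun _ => 0, ⟨law_nonneg f, η, hη0, ?_, fun t => ?_⟩,
            fun _ => le_rfl, fun _ => le_rfl, fun y => by ring,
            ⟨∅, by simpa using by positivity, by simp⟩, ?_⟩
          · rwa [sum_law]
          · rw [sum_law, mul_one]; exact H t
          · simpa using sqParityBias_le_one f
        · unfold HasSmallParity at hpar
          push Not at hpar
          obtain ⟨T, hT, hTr, hTε⟩ := hpar
          refine (HasSplitting.of_overwrite hD hκR hc.le f T (fun _ => False) ∅ (κ₀ := κ₀)
            (by simpa using hκ₀0.le) (fun _ h => h.elim) (fun σ => ih _ (hf.comp_overwrite T σ)) ?_).mono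
            (hκle (hTr.trans (le_max_right _ _)))
          have h1 := sq_add_sq_walshCoeff_le_cubeAvg_overwrite hT fun x => walsh Finset.univ (f x)
          have h2 : ε ^ 2 ≤ walshCoeff (fun x => walsh Finset.univ (f x)) T ^ 2 := by
            rw [← sq_abs (walshCoeff _ _)]; gcongr
          have h3 : c ≤ ε ^ 2 := min_le_right _ _
          simp only [if_false, cubeAvg_const, zero_add]
          unfold sqParityBias
          linarith
      · unfold HasFewBiases at hfew
        push Not at hfew
        obtain ⟨k, hk1, hkQ, hk⟩ := hfew
        set 𝓕 := (Finset.powersetCard k Finset.univ).filter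
          fun K : Finset (Fin n) => cubeAvg (fun x => walsh K (f x)) ≠ 0 with h𝓕def
        have hcard : 1 / ε₀ ≤ 𝓕.card := by
          refine hsqrt.trans (le_trans ?_ hk.le)
          gcongr
          exact le_self_pow₀ hn1 (by omega)
        have hc0 : (0 : ℝ) < 𝓕.card := lt_of_lt_of_le (by positivity) hcard
        have h𝓕 : 𝓕.Nonempty := Finset.card_pos.1 (by exact_mod_cast hc0)
        have hdk : d * k ≤ d * Q := Nat.mul_le_mul_left d hkQ
        have hKk : ∀ K ∈ 𝓕, K.card = k := fun K hK =>
          (Finset.mem_powersetCard.1 (Finset.mem_filter.1 hK).1).2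
        obtain ⟨s, T, hs, hT, hP, hbad⟩ := hf.exists_queries_of_bias h𝓕 hKk
          (fun K hK => (Finset.mem_filter.1 hK).2) hβ
          (by rw [hβdef]; gcongr; norm_num) hL
          (le_trans (by gcongr) hLβ)
        have hTt : T.card ≤ t₀ :=
          hT.trans ((Nat.mul_le_mul_right L hdk).trans (le_max_left _ _))
        refine (HasSplitting.of_overwrite hD hκR hc.le f T
          (fun f' => β ≤ cubeAvg fun x => signedAvg 𝓕 s (f' x))
          (Finset.univ.filter fun y => β / 2 ≤ signedAvg 𝓕 s y) (κ₀ := κ₀)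
          ?_ (fun σ h => ?_) (fun σ => ih _ (hf.comp_overwrite T σ)) ?_).mono (hκle hTt)
        · refine (sum_signedAvg_le hD hD1 hkQ hε₀0.le hβ hDw h𝓕 hKk hs).trans ?_
          have h1 : 1 / (𝓕.card : ℝ) ≤ ε₀ := by
            rw [div_le_iff₀ hc0]
            rw [div_le_iff₀ hε₀0] at hcard
            linarith
          calc 4 / β ^ 2 * (1 / (𝓕.card : ℝ) + ε₀) ≤ 4 / β ^ 2 * (ε₀ + ε₀) := by gcongr
            _ = κ₀ := by rw [hε₀]; field_simp; ring
        · rw [sum_mem_law]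
          convert hbad σ h using 4
          simp
        · have h1 := sq_cubeAvg_le_cubeAvg_overwrite T fun x => walsh Finset.univ (f x)
          have h3 : c ≤ β := min_le_left _ _
          unfold sqParityBias
          have h4 : β ≤ cubeAvg (fun σ =>
              if β ≤ cubeAvg (fun x => signedAvg 𝓕 s (f (overwrite T σ x))) then (1 : ℝ) else 0) := hP
          convert add_le_add (h3.trans h4) h1 using 1
  refine ⟨R * c, ?_, (hsplit R f hf).mono (le_of_eq ?_)⟩
  · rw [div_lt_iff₀ (by positivity)] at hR
    linarith
  · rw [hκ₀]; field_simp

lemma sum_sub_le_tvd {p D : (Fin n → Bool) → ℝ} (hp : ∑ y, p y = ∑ y, D y)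
    (A : Finset (Fin n → Bool)) : ∑ y ∈ A, p y - ∑ y ∈ A, D y ≤ tvd p D := by
  have h1 := Finset.sum_add_sum_compl A p
  have h2 := Finset.sum_add_sum_compl A D
  have h3 := Finset.sum_add_sum_compl A fun y => |p y - D y|
  have h4 : ∑ y ∈ A, p y - ∑ y ∈ A, D y ≤ ∑ y ∈ A, |p y - D y| := by
    rw [← Finset.sum_sub_distrib]
    exact Finset.sum_le_sum fun y _ => le_abs_self _
  have h5 : ∑ y ∈ Aᶜ, D y - ∑ y ∈ Aᶜ, p y ≤ ∑ y ∈ Aᶜ, |p y - D y| := by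
    rw [← Finset.sum_sub_distrib]
    exact Finset.sum_le_sum fun y _ => (by rw [abs_sub_comm]; exact le_abs_self _)
  unfold tvd
  linarith

lemma pushf_unifOn_univ (f : (Fin m → Bool) → (Fin n → Bool)) :
    pushf f (unifOn (Finset.univ : Finset (Fin m → Bool))) = law f := by
  funext y
  unfold pushf unifOn law cubeAvg
  rw [Finset.sum_boole]
  simp [Finset.card_univ, div_eq_mul_inv]

/-- The two parity tails of `X` are `ε`-close to `η` and `1 - η` times the uniform tail. -/
def HasBinomialTails (ε : ℝ) (X : (Fin n → Bool) → ℝ) : Prop :=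
  ∃ η : ℝ, 0 ≤ η ∧ η ≤ 1 ∧ ∀ t, |evenTail X t - η * unifTail n t| ≤ ε ∧
    |oddTail X t - (1 - η) * unifTail n t| ≤ ε

lemma unifTail_nonneg (t : ℝ) : 0 ≤ unifTail n t := by unfold unifTail; positivity

lemma unifTail_le_one (t : ℝ) : unifTail n t ≤ 1 := by
  unfold unifTail
  rw [div_le_one (by positivity)]
  refine le_trans (Nat.cast_le.2 (Finset.card_filter_le _ _)) ?_
  simp [Finset.card_univ]

lemma evenTail_add (g h : (Fin n → Bool) → ℝ) (t : ℝ) :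
    evenTail (fun y => g y + h y) t = evenTail g t + evenTail h t := Finset.sum_add_distrib

lemma oddTail_add (g h : (Fin n → Bool) → ℝ) (t : ℝ) :
    oddTail (fun y => g y + h y) t = oddTail g t + oddTail h t := Finset.sum_add_distrib

lemma evenTail_nonneg_le {g : (Fin n → Bool) → ℝ} (hg : ∀ y, 0 ≤ g y) (t : ℝ) :
    0 ≤ evenTail g t ∧ evenTail g t ≤ ∑ y, g y :=
  ⟨Finset.sum_nonneg fun y _ => hg y,
    Finset.sum_le_sum_of_subset_of_nonneg (Finset.filter_subset _ _) fun y _ _ => hg y⟩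

lemma oddTail_nonneg_le {g : (Fin n → Bool) → ℝ} (hg : ∀ y, 0 ≤ g y) (t : ℝ) :
    0 ≤ oddTail g t ∧ oddTail g t ≤ ∑ y, g y :=
  ⟨Finset.sum_nonneg fun y _ => hg y,
    Finset.sum_le_sum_of_subset_of_nonneg (Finset.filter_subset _ _) fun y _ _ => hg y⟩

/-- A distribution that is a good part up to a small remainder has binomial tails after
normalization. -/
lemma IsGoodPart.hasBinomialTails {δ γ M : ℝ} (hδ : 0 ≤ δ) {g r : (Fin n → Bool) → ℝ}
    (hg : IsGoodPart δ g) (hr : ∀ y, 0 ≤ r y) (hrγ : ∑ y, r y ≤ γ)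
    (hM : ∑ y, g y + ∑ y, r y = M) (hM0 : 1 / 2 ≤ M) (hM1 : M ≤ 1) :
    HasBinomialTails (2 * (δ + γ)) (fun y => (g y + r y) / M) := by
  obtain ⟨hg0, η, hη0, hη1, H⟩ := hg
  have hMpos : 0 < M := by linarith
  have hr0 : 0 ≤ ∑ y, r y := Finset.sum_nonneg fun y _ => hr y
  refine ⟨η / M, by positivity, by rw [div_le_one hMpos]; linarith, fun t => ?_⟩
  obtain ⟨h1, h2⟩ := H t
  have hU0 := unifTail_nonneg (n := n) t
  have hU1 := unifTail_le_one (n := n) t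
  have he := evenTail_nonneg_le hr t
  have ho := oddTail_nonneg_le hr t
  have hgδ : δ * ∑ y, g y ≤ δ := by nlinarith
  have e1 : evenTail (fun y => (g y + r y) / M) t = (evenTail g t + evenTail r t) / M := by
    rw [← evenTail_add]; exact (Finset.sum_div _ _ _).symm
  have e2 : oddTail (fun y => (g y + r y) / M) t = (oddTail g t + oddTail r t) / M := by
    rw [← oddTail_add]; exact (Finset.sum_div _ _ _).symm
  rw [abs_le] at h1 h2
  have scale : ∀ u : ℝ, |u| ≤ δ + γ → |u / M| ≤ 2 * (δ + γ) := by
    intro u hu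
    rw [abs_div, abs_of_pos hMpos, div_le_iff₀ hMpos]
    nlinarith [abs_nonneg u]
  rw [e1, e2]
  constructor
  · have : (evenTail g t + evenTail r t) / M - η / M * unifTail n t =
        (evenTail g t + evenTail r t - η * unifTail n t) / M := by ring
    rw [this]
    refine scale _ (abs_le.2 ⟨?_, ?_⟩) <;> linarith [h1.1, h1.2, he.1, he.2]
  · have : (oddTail g t + oddTail r t) / M - (1 - η / M) * unifTail n t =
        (oddTail g t + oddTail r t - (M - η) * unifTail n t) / M := by field_simp
    rw [this]
    have h3 : (M - η) * unifTail n t = (∑ y, g y - η) * unifTail n t + (∑ y, r y) * unifTail n t := by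
      rw [← hM]; ring
    have h4 : 0 ≤ (∑ y, r y) * unifTail n t := by positivity
    have h5 : (∑ y, r y) * unifTail n t ≤ ∑ y, r y := mul_le_of_le_one_right hr0 hU1
    rw [h3]
    refine scale _ (abs_le.2 ⟨?_, ?_⟩) <;> linarith [h2.1, h2.2, ho.1, ho.2]

/-- The uniform distribution has binomial tails. -/
lemma exists_hasBinomialTails_law_id {δ : ℝ} (hδ : 0 < δ) :
    ∃ N : ℕ, ∀ n, N ≤ n → HasBinomialTails δ (law fun x : Fin n → Bool => x) := by
  obtain ⟨Q, δ₁, r, ε, N, hδ₁, hε, HK⟩ := exists_kolmogorov_of_hasFewBiases 1 hδ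
  refine ⟨max N (r + 1), fun n hn => HK n ((le_max_left _ _).trans hn) n _ ?_ ?_ ?_⟩
  · exact fun i => ⟨{i}, by simp, fun x y h => h i (Finset.mem_singleton_self i)⟩
  · intro k hk _
    rw [Finset.filter_false_of_mem]
    · simp only [Finset.card_empty, Nat.cast_zero]; positivity
    · intro K hK
      rw [not_not]
      refine cubeAvg_walsh (Finset.card_pos.1 ?_)
      rw [(Finset.mem_powersetCard.1 hK).2]
      exact hk
  · intro T _ hT
    have hne : (symmDiff (Finset.univ : Finset (Fin n)) T).Nonempty := by
      refine Finset.nonempty_iff_ne_empty.2 fun h => ?_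
      have h1 : Finset.univ = T := symmDiff_eq_bot.1 h
      rw [← h1, Finset.card_univ, Fintype.card_fin] at hT
      have := (le_max_right N (r + 1)).trans hn
      omega
    have : walshCoeff (fun x : Fin n → Bool => walsh Finset.univ x) T = 0 := by
      unfold walshCoeff
      simp only [walsh_mul_walsh]
      exact cubeAvg_walsh hne
    rw [this, abs_zero]
    exact hε.le

/-- The decomposition of the law of a local function into an error part of mass bounded by the
distance to `D` and a part with binomial tails. -/
theorem exists_decomposition_of_hasSplitting {δ ρ e : ℝ} (hδ : 0 < δ) (he : 0 ≤ e)
    (hρ : 2 ≤ ρ * δ) {p D : (Fin n → Bool) → ℝ} (hp : ∀ y, 0 ≤ p y) (hp1 : ∑ y, p y = 1)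
    (hD1 : ∑ y, D y = 1) (h : HasSplitting D δ δ ρ e p)
    {u : (Fin n → Bool) → ℝ} (hu : ∀ y, 0 ≤ u y) (hu1 : ∑ y, u y = 1)
    (hut : HasBinomialTails δ u) :
    ∃ a : ℝ, 0 ≤ a ∧ a ≤ 1 ∧ a ≤ 12 * tvd p D ∧ ∃ E X : (Fin n → Bool) → ℝ,
      (∀ y, 0 ≤ E y) ∧ (∑ y, E y = 1) ∧ (∀ y, 0 ≤ X y) ∧ (∑ y, X y = 1) ∧
      (∀ y, p y = a * E y + (1 - a) * X y) ∧ HasBinomialTails (12 * δ) X := by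
  obtain ⟨g, b, r, hg, hb, hr, hpy, ⟨A, hA, hAb⟩, hpot⟩ := h
  have hb0 : 0 ≤ ∑ y, b y := Finset.sum_nonneg fun y _ => hb y
  have hr0 : 0 ≤ ∑ y, r y := Finset.sum_nonneg fun y _ => hr y
  have hg0 : 0 ≤ ∑ y, g y := Finset.sum_nonneg fun y _ => hg.1 y
  have hsum : ∑ y, g y + ∑ y, b y + ∑ y, r y = 1 := by
    rw [← hp1, ← Finset.sum_add_distrib, ← Finset.sum_add_distrib]
    exact Finset.sum_congr rfl fun y _ => (hpy y).symm
  have hρ0 : 0 < ρ := by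
    by_contra hneg
    nlinarith
  have hrδ : ∑ y, r y ≤ δ := by
    have h1 : ρ * ∑ y, r y ≤ ρ * δ := by linarith
    exact le_of_mul_le_mul_left h1 hρ0
  have htv := sum_sub_le_tvd (hp1.trans hD1.symm) A
  have hAp : ∑ y ∈ A, b y ≤ ∑ y ∈ A, p y :=
    Finset.sum_le_sum fun y _ => by rw [hpy]; linarith [hg.1 y, hr y]
  have htv0 : 0 ≤ tvd p D := by unfold tvd; positivity
  have weaken : ∀ {γ : ℝ} {X : (Fin n → Bool) → ℝ}, γ ≤ 12 * δ → HasBinomialTails γ X →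
      HasBinomialTails (12 * δ) X := by
    rintro γ X hγ ⟨η, h0, h1, H⟩
    exact ⟨η, h0, h1, fun t => ⟨(H t).1.trans hγ, (H t).2.trans hγ⟩⟩
  rcases le_or_gt (∑ y, b y) (4 * δ) with hsmall | hlarge
  · refine ⟨0, le_rfl, zero_le_one, by positivity, p, p, hp, hp1, hp, hp1, fun y => by ring, ?_⟩
    have := hg.hasBinomialTails (r := fun y => b y + r y) (M := 1) (γ := 5 * δ) hδ.le
      (fun y => add_nonneg (hb y) (hr y)) (by rw [Finset.sum_add_distrib]; linarith)
      (by rw [Finset.sum_add_distrib]; linarith) (by norm_num) le_rfl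
    refine weaken (by linarith) (γ := 2 * (δ + 5 * δ)) ?_
    convert this using 2 with y
    rw [hpy]; ring
  · have htvb : (∑ y, b y) / 4 ≤ tvd p D := by linarith
    rcases le_or_gt (1 / 2) (∑ y, b y) with hhalf | hhalf
    · exact ⟨1, zero_le_one, le_rfl, by linarith, p, u, hp, hp1, hu, hu1, fun y => by ring,
        weaken (by linarith) hut⟩
    · have hbpos : 0 < ∑ y, b y := by linarith
      set M := 1 - ∑ y, b y with hM
      have hMpos : 0 < M := by rw [hM]; linarith
      refine ⟨∑ y, b y, hb0, by linarith, by linarith, fun y => b y / ∑ y, b y,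
        fun y => (g y + r y) / M, fun y => div_nonneg (hb y) hb0, ?_,
        fun y => div_nonneg (add_nonneg (hg.1 y) (hr y)) hMpos.le, ?_, fun y => ?_, ?_⟩
      · rw [← Finset.sum_div, div_self hbpos.ne']
      · rw [← Finset.sum_div, Finset.sum_add_distrib, div_eq_one_iff_eq hMpos.ne', hM]
        linarith
      · rw [hpy, ← hM]
        field_simp
        ring
      · exact weaken (by linarith) (hg.hasBinomialTails (γ := δ) hδ.le hr hrδ
          (by rw [hM]; linarith) (by rw [hM]; linarith) (by rw [hM]; linarith))

end Decomposition

open scoped Classical in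
/-- Kolmogorov bound: `f(U^m)` decomposes as `aE + (1-a)X` with `a = O(dTV(f(U^m), D_Ψ))`,
where the weight of `X`, split by parity, is `O(δ)`-close in Kolmogorov distance to the
binomial distribution. -/
theorem stmt3 :
    ∃ C : ℝ, 0 < C ∧ ∀ δ : ℝ, 0 < δ → ∀ d : ℕ, 1 ≤ d →
    ∃ c : ℝ, 0 < c ∧ ∃ N : ℕ, ∀ n : ℕ, N ≤ n → ∀ m : ℕ,
    ∀ f : (Fin m → Bool) → (Fin n → Bool), IsLocal d f →
    ∀ Ψ : Finset ℕ, Ψ ⊆ Finset.range (n + 1) →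
    (∃ s ∈ Ψ, |(s : ℝ) - n / 2| ≤ c * n) →
    ∃ a : ℝ, 0 ≤ a ∧ a ≤ 1 ∧
      a ≤ C * tvd (pushf f (unifOn (Finset.univ : Finset (Fin m → Bool)))) (DPsi n Ψ) ∧
    ∃ E X : (Fin n → Bool) → ℝ,
      (∀ y, 0 ≤ E y) ∧ (∑ y, E y = 1) ∧ (∀ y, 0 ≤ X y) ∧ (∑ y, X y = 1) ∧
      (∀ y, pushf f (unifOn (Finset.univ : Finset (Fin m → Bool))) y
          = a * E y + (1 - a) * X y) ∧
      ∃ η : ℝ, 0 ≤ η ∧ η ≤ 1 ∧ ∀ t : ℝ,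
        |(∑ y ∈ Finset.univ.filter (fun y : Fin n → Bool => t < (hw y : ℝ) ∧ Even (hw y)), X y)
            - η * (((Finset.univ.filter fun y : Fin n → Bool => t < (hw y : ℝ)).card : ℝ) / 2 ^ n)|
          ≤ C * δ ∧
        |(∑ y ∈ Finset.univ.filter (fun y : Fin n → Bool => t < (hw y : ℝ) ∧ Odd (hw y)), X y)
            - (1 - η) * (((Finset.univ.filter fun y : Fin n → Bool => t < (hw y : ℝ)).card : ℝ) / 2 ^ n)|
          ≤ C * δ := by
  refine ⟨12, by norm_num, fun δ hδ d _ => ?_⟩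
  obtain ⟨ε₀, r₀, N₁, hε₀, hN₁⟩ := exists_hasSplitting d hδ
  obtain ⟨c, hc, N₂, hN₂⟩ := exists_abs_sum_DPsi_mul_walsh_le r₀ ε₀ hε₀
  obtain ⟨N₃, hN₃⟩ := exists_hasBinomialTails_law_id hδ
  refine ⟨c, hc, max N₁ (max N₂ N₃), fun n hn m f hf Ψ hΨ hs => ?_⟩
  have hn₁ : N₁ ≤ n := (le_max_left _ _).trans hn
  have hn₂ : N₂ ≤ n := (le_max_left _ _).trans ((le_max_right _ _).trans hn)
  have hn₃ : N₃ ≤ n := (le_max_right _ _).trans ((le_max_right _ _).trans hn)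
  have hD1 : ∑ y, DPsi n Ψ y = 1 := by
    obtain ⟨s, hsΨ, -⟩ := hs
    exact sum_DPsi hsΨ (Nat.lt_succ_iff.1 (Finset.mem_range.1 (hΨ hsΨ)))
  obtain ⟨ρ, hρ, hsplit⟩ := hN₁ n hn₁ m f hf (DPsi n Ψ) (DPsi_nonneg Ψ) hD1
    (hN₂ n hn₂ Ψ hΨ hs)
  obtain ⟨a, ha0, ha1, ha, E, X, hE, hE1, hX, hX1, hmix, η, hη0, hη1, H⟩ :=
    exists_decomposition_of_hasSplitting hδ (sqParityBias_nonneg f) hρ (law_nonneg f)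
      (sum_law f) hD1 hsplit (law_nonneg _) (sum_law _) (hN₃ n hn₃)
  rw [← pushf_unifOn_univ] at ha hmix
  refine ⟨a, ha0, ha1, ?_, E, X, hE, hE1, hX, hX1, ?_, η, hη0, hη1, fun t => ?_⟩
  · convert ha
  · convert hmix
  · have := H t
    unfold evenTail oddTail unifTail at this
    convert this
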